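/- Let K be an infinite field with char(K) = 2 and fix integers n ≥ m ≥ 2. Then the ratio max{D(Q,(2,…,2)) : Q ∈ 𝒬(n,d,m)} / (m·d) tends to 1 as d → ∞, where 𝒬(n,d,m) is the set of strongly connected quivers with n vertices, d arrows and maximal degree of primitive closed paths equal to m. -/

import Mathlib

open Classical BigOperators

/-- A quiver (finite oriented graph data): a type of vertices, a type of arrows,
and source (tail `a''`) and target (head `a'`) maps. -/
structure QuiverData where
  V : Type
  A : Type
  src : A → V
  tgt : A → V

namespace QuiverData

variable (Q : QuiverData)

/-- `Q.IsPathFrom u v l` : the list of arrows `l` is a (possibly empty) path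
from `u` to `v`, i.e. `l = [a₁, …, a_s]` with `a₁'' = u`, `aᵢ' = a_{i+1}''`, `a_s' = v`. -/
def IsPathFrom : Q.V → Q.V → List Q.A → Prop
  | u, v, [] => u = v
  | u, v, a :: l => Q.src a = u ∧ IsPathFrom (Q.tgt a) v l

/-- A (non-empty) closed path in the vertex `v`. -/
def IsClosedAt (v : Q.V) (l : List Q.A) : Prop :=
  l ≠ [] ∧ Q.IsPathFrom v v l

/-- A (non-empty) closed path. -/
def IsClosed (l : List Q.A) : Prop := ∃ v, Q.IsClosedAt v l

/-- `deg_w(l)`: the degree of the closed path `l` in the vertex `w`,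
i.e. the number of `i` with `aᵢ' = w`. -/
noncomputable def vdeg (l : List Q.A) (w : Q.V) : ℕ :=
  Nat.card {i : Fin l.length // Q.tgt (l.get i) = w}

/-- `deg_b(l)`: the number of occurrences of the arrow `b` in the path `l`. -/
noncomputable def adeg (l : List Q.A) (b : Q.A) : ℕ :=
  Nat.card {i : Fin l.length // l.get i = b}

/-- The number of occurrences in `l` of arrows from the set `S`. -/
noncomputable def sdeg (l : List Q.A) (S : Set Q.A) : ℕ :=
  Nat.card {i : Fin l.length // l.get i ∈ S}

/-- A primitive closed path in `v`: a closed path without self-intersections,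
i.e. `deg_w = 1` for every vertex `w` of the path. -/
def IsPrimitiveAt (v : Q.V) (l : List Q.A) : Prop :=
  Q.IsClosedAt v l ∧ ∀ a ∈ l, Q.vdeg l (Q.tgt a) = 1

/-- A primitive closed path. -/
def IsPrimitive (l : List Q.A) : Prop := ∃ v, Q.IsPrimitiveAt v l

/-- `m(Q) = m` : `m` is the maximal degree of primitive closed paths in `Q`. -/
def MaxPrimDeg (m : ℕ) : Prop :=
  (∃ l, Q.IsPrimitive l ∧ l.length = m) ∧ ∀ l, Q.IsPrimitive l → l.length ≤ m

/-- `Q` is strongly connected: there is a closed path containing all vertices;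
a quiver with one vertex and no arrows is also strongly connected. -/
def StronglyConnected : Prop :=
  (∃ v l, Q.IsClosedAt v l ∧ ∀ w, ∃ a ∈ l, Q.tgt a = w) ∨
    (Subsingleton Q.V ∧ IsEmpty Q.A)

/-- Formal negation on the set (closed paths with a formal sign) ∪ {0};
`none` is the symbol `0`, and `some (e, l)` is `(-1)^e·l`. -/
def negO : Option (Bool × List Q.A) → Option (Bool × List Q.A)
  | none => none
  | some (e, l) => some (!e, l)

/-- The equivalence `≡` on the set of closed paths of `Q`, enlarged by an additional
symbol `0` (represented by `none`) and formal signs (`some (e, l)` is `(-1)^e·l`).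
The parameter `c2` is the proposition "the characteristic of the ground field is 2"
(so that the formal sign `(-1)^σ` is trivial exactly when `c2` holds).
It is the smallest equivalence, compatible with formal negation, such that for paths
`a`, `b` with `ab` a closed path and incident closed paths `a₁, a₂, …`:
(1) `ab ≡ ba`; (2) `a_{σ(1)}⋯a_{σ(t)} ≡ (-1)^σ a₁⋯a_t` for `t ≥ 2` and `σ ∈ S_t`
(generated here by transpositions of adjacent factors);
(3) `a₁²a₂ ≡ 0`; (4) if `c2` then `a₁² ≡ 0`, while if `¬c2` then `a₁a₂a₃a₄ ≡ 0`. -/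
inductive PEquiv (c2 : Prop) : Option (Bool × List Q.A) → Option (Bool × List Q.A) → Prop
  | refl (x) : PEquiv c2 x x
  | symm {x y} : PEquiv c2 x y → PEquiv c2 y x
  | trans {x y z} : PEquiv c2 x y → PEquiv c2 y z → PEquiv c2 x z
  | neg {x y} : PEquiv c2 x y → PEquiv c2 (Q.negO x) (Q.negO y)
  | cyc (u v : Q.V) (a b : List Q.A) (e : Bool) :
      Q.IsPathFrom u v a → Q.IsPathFrom v u b → a ++ b ≠ [] →
      PEquiv c2 (some (e, a ++ b)) (some (e, b ++ a))
  | swap (v : Q.V) (w₁ c d w₂ : List Q.A) (e : Bool) :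
      Q.IsPathFrom v v w₁ → Q.IsClosedAt v c → Q.IsClosedAt v d → Q.IsPathFrom v v w₂ →
      PEquiv c2 (some (e, w₁ ++ c ++ d ++ w₂))
        (some (if c2 then e else !e, w₁ ++ d ++ c ++ w₂))
  | sq_mul (v : Q.V) (c d : List Q.A) (e : Bool) :
      Q.IsClosedAt v c → Q.IsClosedAt v d →
      PEquiv c2 (some (e, c ++ c ++ d)) none
  | sq (v : Q.V) (c : List Q.A) (e : Bool) :
      c2 → Q.IsClosedAt v c → PEquiv c2 (some (e, c ++ c)) none
  | four (v : Q.V) (c₁ c₂ c₃ c₄ : List Q.A) (e : Bool) :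
      ¬c2 → Q.IsClosedAt v c₁ → Q.IsClosedAt v c₂ → Q.IsClosedAt v c₃ → Q.IsClosedAt v c₄ →
      PEquiv c2 (some (e, c₁ ++ c₂ ++ c₃ ++ c₄)) none
  | sign_triv (e : Bool) (l : List Q.A) :
      c2 → PEquiv c2 (some (e, l)) (some (!e, l))

/-- `l₁ ≡ l₂` for closed paths. -/
def PathEquiv (c2 : Prop) (l₁ l₂ : List Q.A) : Prop :=
  Q.PEquiv c2 (some (false, l₁)) (some (false, l₂))

/-- `l ≡ 0`. -/
def EquivZero (c2 : Prop) (l : List Q.A) : Prop :=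
  Q.PEquiv c2 (some (false, l)) none

/-! ### Invariants of quivers for the dimension vector `(2,…,2)` -/

/-- Variables `x_{ij}(a)` of the polynomial ring: for each arrow `a` the entries of the
`2 × 2` generic matrix `X_a`. -/
def Var : Type := Q.A × Fin 2 × Fin 2

variable (K : Type) [Field K]

/-- The substitution describing the base-change action of the group
`∏_{v} GL₂(K)` (given by a family of invertible matrices `g`) on the variables:
`x_{ij}(a)` is sent to the `(i,j)` entry of `g_{a'} X_a g_{a''}⁻¹`. -/
noncomputable def actVar (g : Q.V → Matrix (Fin 2) (Fin 2) K) (p : Q.Var) :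
    MvPolynomial Q.Var K :=
  ∑ k : Fin 2, ∑ l : Fin 2,
    MvPolynomial.C (g (Q.tgt p.1) p.2.1 k * (g (Q.src p.1))⁻¹ l p.2.2) *
      MvPolynomial.X (p.1, k, l)

/-- `f` belongs to the algebra of invariants `Inv(Q,(2,…,2))`. -/
def IsInvariant (f : MvPolynomial Q.Var K) : Prop :=
  ∀ g : Q.V → Matrix (Fin 2) (Fin 2) K, (∀ v, IsUnit (g v).det) →
    MvPolynomial.aeval (Q.actVar K g) f = f

/-- The space `Inv(Q,(2,…,2))⁺` of invariants without constant term (the span of the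
homogeneous invariants of positive degree). -/
def PlusSet : Set (MvPolynomial Q.Var K) :=
  {f | Q.IsInvariant K f ∧ MvPolynomial.constantCoeff f = 0}

/-- `f` is decomposable: it lies in the ideal `(Inv⁺)²`, i.e. in the `K`-span of
products of two invariants of positive degree. -/
def Decomposable (f : MvPolynomial Q.Var K) : Prop :=
  f ∈ Submodule.span K
    {x : MvPolynomial Q.Var K | ∃ p ∈ Q.PlusSet K, ∃ q ∈ Q.PlusSet K, x = p * q}

/-- The generic `2 × 2` matrix `X_a` of an arrow `a`. -/
noncomputable def genMat (a : Q.A) : Matrix (Fin 2) (Fin 2) (MvPolynomial Q.Var K) :=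
  Matrix.of fun i j => MvPolynomial.X (a, i, j)

/-- For a path `l = a₁⋯a_s`, the matrix product `X_{a_s} ⋯ X_{a_1}`. -/
noncomputable def pathMat (l : List Q.A) : Matrix (Fin 2) (Fin 2) (MvPolynomial Q.Var K) :=
  ((l.map (Q.genMat K)).reverse).prod

/-- `tr(X_{a_s} ⋯ X_{a_1})` for a path `l = a₁⋯a_s`. -/
noncomputable def pathTr (l : List Q.A) : MvPolynomial Q.Var K :=
  Matrix.trace (Q.pathMat K l)

/-- `det(X_{a_s} ⋯ X_{a_1})` for a path `l = a₁⋯a_s`. -/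
noncomputable def pathDet (l : List Q.A) : MvPolynomial Q.Var K :=
  Matrix.det (Q.pathMat K l)

/-- `σ_k(X_{a_s} ⋯ X_{a_1})`, the `k`-th coefficient of the characteristic polynomial
of the `2 × 2` matrix `X_{a_s} ⋯ X_{a_1}` (which vanishes for `k > 2`). -/
noncomputable def pathSigma (k : ℕ) (l : List Q.A) : MvPolynomial Q.Var K :=
  if k = 0 then 1 else if k = 1 then Q.pathTr K l
    else if k = 2 then Q.pathDet K l else 0

/-- `D(Q,(2,…,2))`: the maximal degree of an indecomposable homogeneous invariant,
i.e. the least upper bound for the degrees of elements of a minimal homogeneous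
system of generators of `Inv(Q,(2,…,2))`. -/
noncomputable def Dnum : ℕ :=
  sSup {k | ∃ f : MvPolynomial Q.Var K,
    Q.IsInvariant K f ∧ f.IsHomogeneous k ∧ ¬ Q.Decomposable K f}

end QuiverData

/-- `max {D(Q,(2,…,2)) | Q ∈ 𝒬(n,d,m)}` where `𝒬(n,d,m)` is the set of strongly
connected quivers with `n` vertices (vertex set `Fin n`), `d` arrows (arrow set `Fin d`)
and maximal degree of primitive closed paths equal to `m`. -/
noncomputable def QuiverData.maxD (K : Type) [Field K] (n d m : ℕ) : ℕ :=
  sSup {N | ∃ s t : Fin d → Fin n,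
    (QuiverData.mk (Fin n) (Fin d) s t).StronglyConnected ∧
    (QuiverData.mk (Fin n) (Fin d) s t).MaxPrimDeg m ∧
    N = (QuiverData.mk (Fin n) (Fin d) s t).Dnum K}

namespace QuiverData

/-- product of matrices along a word, last letter leftmost -/
noncomputable def mprod {α R : Type} [CommRing R] (f : α → Matrix (Fin 2) (Fin 2) R)
    (l : List α) : Matrix (Fin 2) (Fin 2) R := ((l.map f).reverse).prod

section mprod
variable {α R S : Type} [CommRing R] [CommRing S]

@[simp] lemma mprod_nil (f : α → Matrix (Fin 2) (Fin 2) R) : mprod f [] = 1 := by simp [mprod]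

lemma mprod_append (f : α → Matrix (Fin 2) (Fin 2) R) (l₁ l₂ : List α) :
    mprod f (l₁ ++ l₂) = mprod f l₂ * mprod f l₁ := by
  simp [mprod]

lemma mprod_cons (f : α → Matrix (Fin 2) (Fin 2) R) (a : α) (l : List α) :
    mprod f (a :: l) = mprod f l * f a := by
  simp [mprod]

@[simp] lemma mprod_singleton (f : α → Matrix (Fin 2) (Fin 2) R) (a : α) :
    mprod f [a] = f a := by
  simp [mprod]

lemma mprod_map_hom (θ : R →+* S) (f : α → Matrix (Fin 2) (Fin 2) R) (l : List α) :
    (mprod f l).map θ = mprod (fun a => (f a).map θ) l := by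
  induction l with
  | nil => simp
  | cons a l ih => rw [mprod_cons, mprod_cons, Matrix.map_mul, ih]

end mprod

section path
variable {Q : QuiverData}

lemma isPath_append {u v : Q.V} {l₁ l₂ : List Q.A} :
    Q.IsPathFrom u v (l₁ ++ l₂) ↔ ∃ w, Q.IsPathFrom u w l₁ ∧ Q.IsPathFrom w v l₂ := by
  induction l₁ generalizing u with
  | nil => simp [IsPathFrom]
  | cons a l ih => simp [IsPathFrom, ih, and_assoc]

lemma isPath_cons {u v : Q.V} {a : Q.A} {l : List Q.A} :
    Q.IsPathFrom u v (a :: l) ↔ Q.src a = u ∧ Q.IsPathFrom (Q.tgt a) v l := Iff.rfl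

lemma isPath_nil {u v : Q.V} : Q.IsPathFrom u v [] ↔ u = v := Iff.rfl

lemma mprod_conj {R : Type} [CommRing R] (f f' : Q.A → Matrix (Fin 2) (Fin 2) R)
    (G H : Q.V → Matrix (Fin 2) (Fin 2) R) (hHG : ∀ u, H u * G u = 1)
    (hGH : ∀ u, G u * H u = 1)
    (hf : ∀ a, f' a = G (Q.tgt a) * f a * H (Q.src a)) {u v : Q.V} {l : List Q.A}
    (hl : Q.IsPathFrom u v l) : mprod f' l = G v * mprod f l * H u := by
  induction l generalizing u with
  | nil => rw [isPath_nil] at hl; subst hl; simp [hGH]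
  | cons a l ih =>
    obtain ⟨h1, hl2⟩ := isPath_cons.1 hl
    subst h1
    rw [mprod_cons, mprod_cons, ih hl2, hf]
    calc _ = G v * mprod f l * (H (Q.tgt a) * G (Q.tgt a)) * f a * H (Q.src a) := by
            simp only [Matrix.mul_assoc]
      _ = _ := by rw [hHG]; simp only [Matrix.mul_assoc, Matrix.mul_one]

end path

section mat2
variable {R : Type} [CommRing R]

lemma tr_mul_tr (M N : Matrix (Fin 2) (Fin 2) R) :
    M.trace * N.trace = (M * N).trace + (M * N.adjugate).trace := by
  simp [Matrix.trace_fin_two, Matrix.adjugate_fin_two, Matrix.mul_apply, Fin.sum_univ_two]; ring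

lemma tr_adj (M : Matrix (Fin 2) (Fin 2) R) : M.adjugate.trace = M.trace := by
  simp [Matrix.trace_fin_two, Matrix.adjugate_fin_two]; ring

lemma adj_adj (M : Matrix (Fin 2) (Fin 2) R) : M.adjugate.adjugate = M := by
  ext i j; fin_cases i <;> fin_cases j <;> simp [Matrix.adjugate_fin_two]

lemma mul_adj (M : Matrix (Fin 2) (Fin 2) R) : M * M.adjugate = M.det • 1 :=
  Matrix.mul_adjugate M

end mat2

variable (Q : QuiverData) (K : Type) [Field K]

lemma pathMat_eq (l : List Q.A) : Q.pathMat K l = mprod (Q.genMat K) l := rfl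

/-- double quiver -/
abbrev dbl : QuiverData := ⟨Q.V, Q.A × Bool, fun x => cond x.2 (Q.src x.1) (Q.tgt x.1),
  fun x => cond x.2 (Q.tgt x.1) (Q.src x.1)⟩

/-- letters -/
noncomputable def lmat : Q.A × Bool → Matrix (Fin 2) (Fin 2) (MvPolynomial Q.Var K)
  | (a, true) => Q.genMat K a
  | (a, false) => (Q.genMat K a).adjugate

variable {Q} in
/-- flip -/
def hbar (x : Q.A × Bool) : Q.A × Bool := (x.1, !x.2)

variable {Q} in
/-- reversed word -/
def wrev (W : List (Q.A × Bool)) : List (Q.A × Bool) := (W.map hbar).reverse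

/-- matrix of a word -/
noncomputable def wMat (W : List (Q.A × Bool)) : Matrix (Fin 2) (Fin 2) (MvPolynomial Q.Var K) :=
  mprod (Q.lmat K) W

/-- trace of a word -/
noncomputable def wTr (W : List (Q.A × Bool)) : MvPolynomial Q.Var K := (Q.wMat K W).trace

lemma wMat_append (W₁ W₂ : List (Q.A × Bool)) :
    Q.wMat K (W₁ ++ W₂) = Q.wMat K W₂ * Q.wMat K W₁ := mprod_append _ _ _

lemma wMat_cons (x) (W : List (Q.A × Bool)) :
    Q.wMat K (x :: W) = Q.wMat K W * Q.lmat K x := mprod_cons _ _ _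

@[simp] lemma wMat_nil : Q.wMat K [] = 1 := mprod_nil _

lemma lmat_hbar (x) : Q.lmat K (hbar x) = (Q.lmat K x).adjugate := by
  obtain ⟨a, b⟩ := x
  cases b <;> simp [hbar, lmat, adj_adj]

@[simp] lemma hbar_hbar (x : Q.A × Bool) : hbar (hbar x) = x := by
  simp [hbar]

lemma wrev_wrev (W : List (Q.A × Bool)) : wrev (wrev W) = W := by
  simp [wrev, Function.comp_def, List.map_reverse]

lemma wrev_append (W₁ W₂ : List (Q.A × Bool)) : wrev (W₁ ++ W₂) = wrev W₂ ++ wrev W₁ := by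
  simp [wrev]

lemma wMat_wrev (W : List (Q.A × Bool)) : Q.wMat K (wrev W) = (Q.wMat K W).adjugate := by
  induction W with
  | nil => simp [wrev]
  | cons x W ih =>
    have : wrev (x :: W) = wrev W ++ [hbar x] := by simp [wrev]
    rw [this, wMat_append, wMat_cons _ _ x, Matrix.adjugate_mul_distrib, ih]
    simp [wMat, lmat_hbar]

lemma wTr_wrev (W : List (Q.A × Bool)) : Q.wTr K (wrev W) = Q.wTr K W := by
  rw [wTr, wMat_wrev, tr_adj, wTr]

lemma wTr_comm (W₁ W₂ : List (Q.A × Bool)) : Q.wTr K (W₁ ++ W₂) = Q.wTr K (W₂ ++ W₁) := by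
  rw [wTr, wTr, wMat_append, wMat_append, Matrix.trace_mul_comm]

lemma wMat_true (l : List Q.A) : Q.wMat K (l.map fun a => (a, true)) = Q.pathMat K l := by
  simp only [wMat, pathMat_eq, mprod, List.map_map]; rfl

lemma wTr_mul (W₁ W₂ : List (Q.A × Bool)) :
    Q.wTr K W₁ * Q.wTr K W₂ = Q.wTr K (W₁ ++ W₂) + Q.wTr K (W₁ ++ wrev W₂) := by
  simp only [wTr, wMat_append, wMat_wrev, tr_mul_tr]
  rw [Matrix.trace_mul_comm, Matrix.trace_mul_comm (Q.wMat K W₂).adjugate]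

lemma wrev_path {u v : Q.V} {W : List (Q.A × Bool)} (h : Q.dbl.IsPathFrom u v W) :
    Q.dbl.IsPathFrom v u (wrev W) := by
  induction W generalizing u with
  | nil => exact h.symm
  | cons x W ih =>
    obtain ⟨h1, h2⟩ := h
    have : wrev (x :: W) = wrev W ++ [hbar x] := by simp [wrev]
    rw [this]
    refine isPath_append.2 ⟨_, ih h2, ?_⟩
    subst h1
    obtain ⟨a, b⟩ := x
    cases b <;> exact ⟨rfl, rfl⟩

/-- the action hom -/
noncomputable def actHom (g : Q.V → Matrix (Fin 2) (Fin 2) K) :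
    MvPolynomial Q.Var K →ₐ[K] MvPolynomial Q.Var K := MvPolynomial.aeval (Q.actVar K g)

/-- constant matrices -/
noncomputable def cmat (g : Matrix (Fin 2) (Fin 2) K) :
    Matrix (Fin 2) (Fin 2) (MvPolynomial Q.Var K) := g.map (MvPolynomial.C)

lemma cmat_mul (g h : Matrix (Fin 2) (Fin 2) K) : Q.cmat K (g * h) = Q.cmat K g * Q.cmat K h :=
  Matrix.map_mul

lemma cmat_one : Q.cmat K 1 = 1 := by
  ext1 i j
  simp [cmat, Matrix.one_apply, apply_ite]

lemma actHom_genMat (g : Q.V → Matrix (Fin 2) (Fin 2) K) (a : Q.A) :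
    (Q.genMat K a).map (Q.actHom K g) =
      Q.cmat K (g (Q.tgt a)) * Q.genMat K a * Q.cmat K (g (Q.src a))⁻¹ := by
  ext1 i j
  have h : Q.actHom K g (Q.genMat K a i j) = ∑ k : Fin 2, ∑ l : Fin 2,
      MvPolynomial.C (g (Q.tgt a) i k * (g (Q.src a))⁻¹ l j) * Q.genMat K a k l :=
    MvPolynomial.aeval_X _ _
  rw [Matrix.map_apply, h]
  simp only [Matrix.mul_apply, cmat, Fin.sum_univ_two, MvPolynomial.C_mul, Matrix.map_apply]
  ring

lemma pathMat_act {g : Q.V → Matrix (Fin 2) (Fin 2) K} (hg : ∀ v, IsUnit (g v).det)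
    {u v : Q.V} {l : List Q.A} (hl : Q.IsPathFrom u v l) :
    (Q.pathMat K l).map (Q.actHom K g) =
      Q.cmat K (g v) * Q.pathMat K l * Q.cmat K (g u)⁻¹ := by
  have := mprod_map_hom (Q.actHom K g : MvPolynomial Q.Var K →+* MvPolynomial Q.Var K)
    (Q.genMat K) l
  rw [pathMat_eq]
  refine this.trans ?_
  refine mprod_conj _ _ (fun u => Q.cmat K (g u)) (fun u => Q.cmat K (g u)⁻¹) ?_ ?_ ?_ hl
  · intro u; simp only [← cmat_mul, Matrix.nonsing_inv_mul _ (hg u), cmat_one]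
  · intro u; simp only [← cmat_mul, Matrix.mul_nonsing_inv _ (hg u), cmat_one]
  · intro a; exact Q.actHom_genMat K g a

lemma pathTr_inv {u : Q.V} {l : List Q.A} (hl : Q.IsPathFrom u u l) :
    Q.IsInvariant K (Q.pathTr K l) := by
  intro g hg
  have h := Q.pathMat_act K hg hl
  have h2 : Q.actHom K g (Q.pathTr K l) = ((Q.pathMat K l).map (Q.actHom K g)).trace := by
    simp [pathTr, Matrix.trace_fin_two]
  change Q.actHom K g (Q.pathTr K l) = _
  rw [h2, h, Matrix.trace_mul_cycle, ← cmat_mul, Matrix.nonsing_inv_mul _ (hg u), cmat_one,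
    Matrix.one_mul, pathTr]

lemma pathDet_inv {u : Q.V} {l : List Q.A} (hl : Q.IsPathFrom u u l) :
    Q.IsInvariant K (Q.pathDet K l) := by
  intro g hg
  have h := Q.pathMat_act K hg hl
  have h2 : Q.actHom K g (Q.pathDet K l) = ((Q.pathMat K l).map (Q.actHom K g)).det := by
    simp [pathDet, Matrix.det_fin_two]
  change Q.actHom K g (Q.pathDet K l) = _
  rw [h2, h, Matrix.det_mul, Matrix.det_mul, mul_right_comm, ← Matrix.det_mul, ← cmat_mul,
    Matrix.mul_nonsing_inv _ (hg u), cmat_one, Matrix.det_one, one_mul, pathDet]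

lemma actHom_lmat {g : Q.V → Matrix (Fin 2) (Fin 2) K} (hg : ∀ v, (g v).det = 1)
    (x : Q.A × Bool) :
    (Q.lmat K x).map (Q.actHom K g) =
      Q.cmat K (g (Q.dbl.tgt x)) * Q.lmat K x * Q.cmat K (g (Q.dbl.src x))⁻¹ := by
  obtain ⟨a, b⟩ := x
  cases b
  · have h1 : ((Q.genMat K a).adjugate).map (Q.actHom K g) =
      ((Q.genMat K a).map (Q.actHom K g)).adjugate := by
      have := RingHom.map_adjugate (Q.actHom K g : MvPolynomial Q.Var K →+* MvPolynomial Q.Var K)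
        (Q.genMat K a)
      exact this
    have hinv : ∀ u, (g u)⁻¹ = (g u).adjugate := by
      intro u; rw [Matrix.inv_def, hg]; simp
    have hc : ∀ M : Matrix (Fin 2) (Fin 2) K, (Q.cmat K M).adjugate = Q.cmat K M.adjugate := by
      intro M
      exact (RingHom.map_adjugate (MvPolynomial.C) M).symm
    simp only [lmat, h1, actHom_genMat, Matrix.adjugate_mul_distrib, hinv, hc, adj_adj]
    simp only [dbl, cond_false, Matrix.mul_assoc, ← hinv]
  · exact Q.actHom_genMat K g a

lemma wTr_slInv {g : Q.V → Matrix (Fin 2) (Fin 2) K} (hg : ∀ v, (g v).det = 1)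
    {u : Q.V} {W : List (Q.A × Bool)} (hW : Q.dbl.IsPathFrom u u W) :
    Q.actHom K g (Q.wTr K W) = Q.wTr K W := by
  have hg' : ∀ v, IsUnit (g v).det := fun v => by rw [hg]; exact isUnit_one
  have := mprod_map_hom (Q.actHom K g : MvPolynomial Q.Var K →+* MvPolynomial Q.Var K)
    (Q.lmat K) W
  have h3 : (mprod (Q.lmat K) W).map (Q.actHom K g) = 
      Q.cmat K (g u) * mprod (Q.lmat K) W * Q.cmat K (g u)⁻¹ := by
    refine this.trans ?_
    refine mprod_conj (Q := Q.dbl) _ _ (fun u => Q.cmat K (g u)) (fun u => Q.cmat K (g u)⁻¹) 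
      ?_ ?_ ?_ hW
    · intro u; simp only [← cmat_mul, Matrix.nonsing_inv_mul _ (hg' u), cmat_one]
    · intro u; simp only [← cmat_mul, Matrix.mul_nonsing_inv _ (hg' u), cmat_one]
    · intro a; exact Q.actHom_lmat K hg a
  have h2 : Q.actHom K g (Q.wTr K W) = ((Q.wMat K W).map (Q.actHom K g)).trace := by
    simp [wTr, Matrix.trace_fin_two]
  rw [h2, wMat, h3, Matrix.trace_mul_cycle, ← cmat_mul, Matrix.nonsing_inv_mul _ (hg' u), cmat_one,
    Matrix.one_mul, wTr, wMat]

lemma genMat_hom (a : Q.A) (i j : Fin 2) : (Q.genMat K a i j).IsHomogeneous 1 :=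
  MvPolynomial.isHomogeneous_X _ _

lemma mprod_hom {α : Type} (f : α → Matrix (Fin 2) (Fin 2) (MvPolynomial Q.Var K))
    (hf : ∀ a i j, (f a i j).IsHomogeneous 1) (l : List α) (i j : Fin 2) :
    (mprod f l i j).IsHomogeneous l.length := by
  induction l generalizing i j with
  | nil =>
    rw [mprod_nil, Matrix.one_apply]
    split_ifs
    · exact MvPolynomial.isHomogeneous_one _ _
    · exact MvPolynomial.isHomogeneous_zero _ _ _
  | cons a l ih =>
    rw [mprod_cons, Matrix.mul_apply]
    exact MvPolynomial.IsHomogeneous.sum _ _ _ fun k _ => (ih i k).mul (hf a k j)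

lemma lmat_hom (x : Q.A × Bool) (i j : Fin 2) : (Q.lmat K x i j).IsHomogeneous 1 := by
  obtain ⟨a, b⟩ := x
  cases b
  · have := Q.genMat_hom K a
    fin_cases i <;> fin_cases j <;> simp only [lmat, Matrix.adjugate_fin_two] <;> simp
    · exact this _ _
    · exact (this _ _).neg
    · exact (this _ _).neg
    · exact this _ _
  · exact Q.genMat_hom K a i j

lemma wTr_hom (W : List (Q.A × Bool)) : (Q.wTr K W).IsHomogeneous W.length := by
  rw [wTr, Matrix.trace_fin_two]
  exact (mprod_hom Q K _ (Q.lmat_hom K) W 0 0).add (mprod_hom Q K _ (Q.lmat_hom K) W 1 1)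

lemma pathTr_hom (l : List Q.A) : (Q.pathTr K l).IsHomogeneous l.length := by
  rw [pathTr, Matrix.trace_fin_two]
  exact (mprod_hom Q K _ (Q.genMat_hom K) l 0 0).add (mprod_hom Q K _ (Q.genMat_hom K) l 1 1)

lemma pathDet_hom (l : List Q.A) : (Q.pathDet K l).IsHomogeneous (2 * l.length) := by
  have h := mprod_hom Q K _ (Q.genMat_hom K) l
  rw [pathDet, Matrix.det_fin_two, two_mul]
  exact ((h 0 0).mul (h 1 1)).sub ((h 0 1).mul (h 1 0))

end QuiverData

namespace FFT
open MvPolynomial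

section general
variable {σ τ K R : Type} [Fintype σ] [Field K] [CommRing R] [Algebra K R]

lemma aeval_eq_sum (f : σ → R) (F : MvPolynomial σ K) :
    aeval f F = ∑ m ∈ F.support, algebraMap K R (F.coeff m) * ∏ v, f v ^ m v := by
  rw [aeval_def, eval₂_eq']

lemma aeval_scale (f e : σ → R) (t : R) (k : σ → ℕ) (hf : ∀ v, f v = e v * t ^ k v)
    (F : MvPolynomial σ K) (N : ℕ) (hN : ∀ m ∈ F.support, ∑ v, m v * k v = N) :
    aeval f F = t ^ N * aeval e F := by
  rw [aeval_eq_sum, aeval_eq_sum, Finset.mul_sum]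
  refine Finset.sum_congr rfl fun m hm => ?_
  rw [← hN m hm, ← Finset.prod_pow_eq_pow_sum]
  simp only [hf, mul_pow, Finset.prod_mul_distrib, ← pow_mul]
  simp only [mul_comm (m _)]
  ring

lemma X_dvd_sub (v : σ) (F : MvPolynomial σ K) :
    X v ∣ F - aeval (fun w => if w = v then (0 : MvPolynomial σ K) else X w) F := by
  induction F using MvPolynomial.induction_on with
  | C a => simp [algebraMap_eq]
  | add p q hp hq =>
    rw [map_add, add_sub_add_comm]; exact dvd_add hp hq
  | mul_X p w hp =>
    rw [map_mul, aeval_X]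
    by_cases h : w = v
    · subst h; simp
    · simp only [h, if_false]
      rw [← sub_mul]
      exact hp.mul_right _

lemma whom_aeval {M : Type} [AddCommMonoid M] (w' : τ → M) (w : σ → M)
    (f : σ → MvPolynomial τ K) (hf : ∀ v, IsWeightedHomogeneous w' (f v) (w v))
    (F : MvPolynomial σ K) (κ : M) (hF : ∀ m ∈ F.support, ∑ v, m v • w v = κ) :
    IsWeightedHomogeneous w' (aeval f F) κ := by
  rw [aeval_eq_sum]
  refine IsWeightedHomogeneous.sum _ _ _ fun m hm => ?_
  rw [← hF m hm, ← zero_add (∑ v, m v • w v), algebraMap_eq]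
  refine (isWeightedHomogeneous_C _ _).mul ?_
  exact IsWeightedHomogeneous.prod _ _ _ fun v _ => (hf v).pow _

end general

variable {H V K : Type} [Fintype H] [Field K] (ν : H → V)

/-- unipotent substitution -/
noncomputable def uni (u : V) (c : K) : MvPolynomial (H × Fin 2) K →ₐ[K] MvPolynomial (H × Fin 2) K :=
  aeval fun v => if v.2 = 0 ∧ ν v.1 = u then X v + C c * X (v.1, 1) else X v

/-- weights -/
def wt (v : H × Fin 2) : Multiset H × Multiset V := ({v.1}, if v.2 = 0 then 0 else {ν v.1})

variable (K) in
/-- the bracket -/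
noncomputable def br (p : H × H) : MvPolynomial (H × Fin 2) K :=
  X (p.1, 0) * X (p.2, 1) - X (p.1, 1) * X (p.2, 0)

variable (K) in
/-- monomials in y and brackets -/
noncomputable def mon (L : Multiset H) (P : Multiset (H × H)) : MvPolynomial (H × Fin 2) K :=
  (L.map fun h => X (h, 1)).prod * (P.map (br K)).prod

/-- formal weight -/
def mwt (L : Multiset H) (P : Multiset (H × H)) : Multiset H × Multiset V :=
  (L + P.map Prod.fst + P.map Prod.snd, L.map ν + P.map fun p => ν p.1)

variable (K) in
/-- admissible monomials -/
def Mon (κ : Multiset H × Multiset V) : Set (MvPolynomial (H × Fin 2) K) :=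
  {F | ∃ L P, (∀ p ∈ P, ν p.1 = ν p.2) ∧ mwt ν L P = κ ∧ F = mon K L P}

lemma weight_sum {M : Type} [AddCommMonoid M] (w : H × Fin 2 → M) (m : H × Fin 2 →₀ ℕ) :
    Finsupp.weight w m = ∑ v, m v • w v := by
  rw [Finsupp.weight_apply, Finsupp.sum_fintype]; simp

lemma wt_fst (m : H × Fin 2 →₀ ℕ) :
    (∑ v, m v • wt ν v).1 = ∑ h : H, (m (h, 0) + m (h, 1)) • ({h} : Multiset H) := by
  rw [Prod.fst_sum, Fintype.sum_prod_type]
  refine Finset.sum_congr rfl fun h _ => ?_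
  rw [Fin.sum_univ_two, add_smul]; rfl

lemma wt_snd (m : H × Fin 2 →₀ ℕ) :
    (∑ v, m v • wt ν v).2 = ∑ h : H, m (h, 1) • ({ν h} : Multiset V) := by
  rw [Prod.snd_sum, Fintype.sum_prod_type]
  refine Finset.sum_congr rfl fun h _ => ?_
  rw [Fin.sum_univ_two]; simp [wt]

lemma count_fst (m : H × Fin 2 →₀ ℕ) (h : H) :
    (∑ v, m v • wt ν v).1.count h = m (h, 0) + m (h, 1) := by
  rw [wt_fst, Multiset.count_sum']
  simp [Multiset.count_singleton]

lemma count_map_fst (m : H × Fin 2 →₀ ℕ) (u : V) :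
    ((∑ v, m v • wt ν v).1.map ν).count u =
      ∑ h : H, if u = ν h then (m (h, 0) + m (h, 1)) else 0 := by
  rw [wt_fst]
  have : ∀ s : Finset H, ((∑ h ∈ s, (m (h, 0) + m (h, 1)) • ({h} : Multiset H)).map ν).count u =
      ∑ h ∈ s, if u = ν h then (m (h, 0) + m (h, 1)) else 0 := by
    intro s
    induction s using Finset.induction_on with
    | empty => simp
    | insert a s ha ih =>
      rw [Finset.sum_insert ha, Finset.sum_insert ha, Multiset.map_add, Multiset.count_add, ih,
        Multiset.map_nsmul, Multiset.count_nsmul]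
      simp [Multiset.count_singleton]
  exact this _

lemma count_snd (m : H × Fin 2 →₀ ℕ) (u : V) :
    (∑ v, m v • wt ν v).2.count u = ∑ h : H, if u = ν h then m (h, 1) else 0 := by
  rw [wt_snd, Multiset.count_sum']
  simp [Multiset.count_singleton]

/-- Lemma XY -/
lemma XY (u : V) (F : MvPolynomial (H × Fin 2) K) (hF0 : F ≠ 0) (κ : Multiset H × Multiset V)
    (hF : ∀ m ∈ F.support, ∑ v, m v • wt ν v = κ) (hU : uni ν u 1 F = F) :
    (κ.1.map ν).count u ≤ 2 * κ.2.count u := by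
  let s : Polynomial (MvPolynomial (H × Fin 2) K) := Polynomial.X
  let inc : H × Fin 2 → Polynomial (MvPolynomial (H × Fin 2) K) := fun v => Polynomial.C (X v)
  let at0 : H × Fin 2 → Prop := fun v => v.2 = 0 ∧ ν v.1 = u
  let at1 : H × Fin 2 → Prop := fun v => v.2 ≠ 0 ∧ ν v.1 = u
  let σ : H × Fin 2 → Polynomial (MvPolynomial (H × Fin 2) K) := fun v => inc v * s ^ (if at0 v then 1 else 0)
  let τ : H × Fin 2 → Polynomial (MvPolynomial (H × Fin 2) K) := fun v => if at1 v then inc v - s * inc (v.1, 0) else inc v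
  let γ : H × Fin 2 → Polynomial (MvPolynomial (H × Fin 2) K) := fun v => if ν v.1 = u then inc (v.1, 1) -
     (if v.2 = 0 then 0 else s * inc (v.1, 0)) else inc v
  let a : ℕ := (κ.1.map ν).count u - κ.2.count u
  have hsum : ∀ m : H × Fin 2 →₀ ℕ, ∑ v, m v * (if at0 v then 1 else 0) =
      ∑ h : H, if u = ν h then m (h, 0) else 0 := by
    intro m
    rw [Fintype.sum_prod_type]
    refine Finset.sum_congr rfl fun h _ => ?_
    rw [Fin.sum_univ_two]
    simp [at0, eq_comm]
  have hsum1 : ∀ m : H × Fin 2 →₀ ℕ, ∑ v, m v * (if at1 v then 1 else 0) =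
      ∑ h : H, if u = ν h then m (h, 1) else 0 := by
    intro m
    rw [Fintype.sum_prod_type]
    refine Finset.sum_congr rfl fun h _ => ?_
    rw [Fin.sum_univ_two]
    simp [at1, eq_comm]
  have ha : ∀ m ∈ F.support, ∑ v, m v * (if at0 v then 1 else 0) = a := by
    intro m hm
    rw [hsum]
    simp only [a, ← hF m hm, count_map_fst, count_snd]
    have : (∑ h : H, if u = ν h then (m (h, 0) + m (h, 1)) else 0) =
      (∑ h : H, if u = ν h then m (h, 0) else 0) + ∑ h : H, if u = ν h then m (h, 1) else 0 := by
      rw [← Finset.sum_add_distrib]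
      refine Finset.sum_congr rfl fun h _ => ?_
      split_ifs <;> simp
    omega
  have hσ : aeval σ F = s ^ a * aeval inc F :=
    aeval_scale σ inc s _ (fun v => rfl) F a ha
  -- alpha
  have hα : aeval σ (uni ν u 1 F) = s ^ a * aeval inc F := by rw [hU, hσ]
  let T : Polynomial (MvPolynomial (H × Fin 2) K) →+* Polynomial (MvPolynomial (H × Fin 2) K) := Polynomial.eval₂RingHom (aeval τ : _ →ₐ[K] (Polynomial (MvPolynomial (H × Fin 2) K))).toRingHom s
  have hTinc : ∀ G : MvPolynomial (H × Fin 2) K, T (aeval inc G) = aeval τ G := by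
    intro G
    have : (aeval inc G : Polynomial (MvPolynomial (H × Fin 2) K)) = Polynomial.C G := by
      induction G using MvPolynomial.induction_on with
      | C a => simp
      | add p q hp hq => rw [map_add, hp, hq, map_add]
      | mul_X p v hp => rw [map_mul, hp, aeval_X, map_mul]
    rw [this]
    simp [T]
  have hTs : T s = s := by simp [T, s]
  have hTi : ∀ v, T (inc v) = τ v := by
    intro v
    have := hTinc (X v)
    rwa [aeval_X, aeval_X] at this
  have hγ : T (aeval σ (uni ν u 1 F)) = aeval γ F := by
    have : (aeval γ : MvPolynomial (H × Fin 2) K →ₐ[K] (Polynomial (MvPolynomial (H × Fin 2) K))).toRingHom =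
       T.comp (((aeval σ : _ →ₐ[K] (Polynomial (MvPolynomial (H × Fin 2) K))).comp (uni ν u 1)).toRingHom) := by
      apply MvPolynomial.ringHom_ext
      · intro r
        simp [T]
      · intro v
        simp only [AlgHom.toRingHom_eq_coe, RingHom.coe_coe, aeval_X, RingHom.coe_comp,
          Function.comp, AlgHom.comp_apply, uni]
        obtain ⟨h, i⟩ := v
        by_cases hu : ν h = u
        · fin_cases i
          · simp [γ, hu, σ, at0, hTi, τ, at1, hTs]
            ring
          · simp [γ, hu, σ, at0, hTi, τ, at1]
        · simp [γ, hu, σ, at0, hTi, τ, at1]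
    have := congrArg (fun f => f F) this
    exact this.symm
  have key : aeval γ F = s ^ a * aeval τ F := by
    rw [← hγ, hα, map_mul, map_pow, hTs, hTinc]
  have hτ0 : aeval τ F ≠ 0 := by
    intro h0
    apply hF0
    have : ((Polynomial.evalRingHom (0 : MvPolynomial (H × Fin 2) K)).comp
        (aeval τ : MvPolynomial (H × Fin 2) K →ₐ[K] (Polynomial (MvPolynomial (H × Fin 2) K))).toRingHom) = RingHom.id _ := by
      apply MvPolynomial.ringHom_ext
      · intro r
        have : (algebraMap K (Polynomial (MvPolynomial (H × Fin 2) K)) r) = Polynomial.C (C r) := rfl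
        simp [this]
      · intro v
        simp only [AlgHom.toRingHom_eq_coe, RingHom.coe_coe, aeval_X, RingHom.coe_comp,
          Function.comp]
        by_cases h : at1 v <;> simp [τ, inc, s, h]
    have h1 := congrArg (fun f => f F) this
    simp only [AlgHom.toRingHom_eq_coe, RingHom.coe_coe, RingHom.coe_comp,
          Function.comp, h0, map_zero, RingHom.id_apply] at h1
    exact h1.symm
  have hdeg : (aeval γ F : Polynomial (MvPolynomial (H × Fin 2) K)).natDegree ≤ κ.2.count u := by
    rw [aeval_eq_sum]
    refine Polynomial.natDegree_sum_le_of_forall_le _ _ fun m hm => ?_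
    have : (algebraMap K (Polynomial (MvPolynomial (H × Fin 2) K)) (coeff m F)) = Polynomial.C (C (coeff m F)) := rfl
    rw [this]
    refine (Polynomial.natDegree_C_mul_le _ _).trans ?_
    refine (Polynomial.natDegree_prod_le _ _).trans ?_
    rw [← hF m hm, count_snd, ← hsum1]
    refine Finset.sum_le_sum fun v _ => ?_
    refine Polynomial.natDegree_pow_le.trans ?_
    refine Nat.mul_le_mul_left _ ?_
    by_cases hu : ν v.1 = u
    · by_cases h0 : v.2 = 0
      · simp [γ, hu, h0, inc]
      · simp only [γ, hu, h0, at1, if_true, if_false, inc, s, ne_eq, not_false_eq_true, and_self]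
        compute_degree
    · simp [γ, hu, inc]
  have h1 : (aeval γ F : Polynomial (MvPolynomial (H × Fin 2) K)).natDegree = a + (aeval τ F : Polynomial (MvPolynomial (H × Fin 2) K)).natDegree := by
    rw [key, Polynomial.natDegree_mul (pow_ne_zero _ Polynomial.X_ne_zero) hτ0]
    simp [s]
  have : a ≤ κ.2.count u := by omega
  simp only [a] at this
  omega

end FFT

namespace FFT
open MvPolynomial
variable {H V K : Type} [Fintype H] [Field K] (ν : H → V)

lemma uni_X1 (u : V) (c : K) (h : H) : uni ν u c (X (h, 1)) = X (h, 1) := by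
  simp [uni]

lemma uni_br (u : V) (c : K) (p : H × H) (hp : ν p.1 = ν p.2) : uni ν u c (br K p) = br K p := by
  simp only [br, map_sub, map_mul, uni_X1]
  by_cases h : ν p.2 = u
  · simp [uni, h, hp]; ring
  · simp [uni, h, hp]

lemma uni_mon (u : V) (c : K) (L : Multiset H) (P : Multiset (H × H))
    (hP : ∀ p ∈ P, ν p.1 = ν p.2) : uni ν u c (mon K L P) = mon K L P := by
  rw [mon, map_mul, map_multiset_prod, map_multiset_prod, Multiset.map_map, Multiset.map_map]
  congr 2
  · refine Multiset.map_congr rfl fun h _ => uni_X1 ν u c h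
  · refine Multiset.map_congr rfl fun p hp => uni_br ν u c p (hP p hp)

lemma br_hom (p : H × H) (hp : ν p.1 = ν p.2) :
    IsWeightedHomogeneous (wt ν) (br K p) ({p.1} + {p.2}, {ν p.1}) := by
  refine Submodule.sub_mem (weightedHomogeneousSubmodule K (wt ν) _) ?_ ?_
  · have := (isWeightedHomogeneous_X K (wt ν) (p.1, 0)).mul
      (isWeightedHomogeneous_X K (wt ν) (p.2, 1))
    convert this using 1
    simp [wt, hp]
  · have := (isWeightedHomogeneous_X K (wt ν) (p.1, 1)).mul
      (isWeightedHomogeneous_X K (wt ν) (p.2, 0))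
    convert this using 1
    simp [wt]

lemma mon_hom (L : Multiset H) (P : Multiset (H × H))
    (hP : ∀ p ∈ P, ν p.1 = ν p.2) : IsWeightedHomogeneous (wt ν) (mon K L P) (mwt ν L P) := by
  have h1 : IsWeightedHomogeneous (wt ν) (L.map fun h => (X (h, 1) : MvPolynomial (H × Fin 2) K)).prod
      (L, L.map ν) := by
    induction L using Multiset.induction_on with
    | empty => exact isWeightedHomogeneous_one K (wt ν)
    | cons h L ih =>
      rw [Multiset.map_cons, Multiset.prod_cons]
      have := (isWeightedHomogeneous_X K (wt ν) (h, 1)).mul ih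
      convert this using 1
      simp [wt]
  have h2 : IsWeightedHomogeneous (wt ν) (P.map (br K)).prod
      (P.map Prod.fst + P.map Prod.snd, P.map fun p => ν p.1) := by
    induction P using Multiset.induction_on with
    | empty => exact isWeightedHomogeneous_one K (wt ν)
    | cons p P ih =>
      rw [Multiset.map_cons, Multiset.prod_cons]
      have := (br_hom (K := K) ν p (hP p (by simp))).mul (ih fun q hq => hP q (by simp [hq]))
      convert this using 1
      refine Prod.ext ?_ ?_
      · simp only [Multiset.map_cons, Prod.fst_add]
        simp only [← Multiset.singleton_add]; abel
      · simp
  have e : mwt ν L P = (L, L.map ν) + (P.map Prod.fst + P.map Prod.snd, P.map fun p => ν p.1) := by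
    simp [mwt, add_assoc]
  rw [e]
  exact h1.mul h2

lemma supp_of_hom {w : H × Fin 2 → Multiset H × Multiset V} {F : MvPolynomial (H × Fin 2) K}
    {κ : Multiset H × Multiset V}
    (h : IsWeightedHomogeneous w F κ) : ∀ m ∈ F.support, ∑ v, m v • w v = κ := by
  intro m hm
  rw [← weight_sum]
  exact h (mem_support_iff.1 hm)

lemma hom_of_supp {w : H × Fin 2 → Multiset H × Multiset V} {F : MvPolynomial (H × Fin 2) K}
    {κ : Multiset H × Multiset V}
    (h : ∀ m ∈ F.support, ∑ v, m v • w v = κ) : IsWeightedHomogeneous w F κ := by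
  intro m hm
  rw [weight_sum]
  exact h m (mem_support_iff.2 hm)

/-- set x_{h0} = 1, y_{h0} = 0 -/
noncomputable def eps (h₀ : H) : MvPolynomial (H × Fin 2) K →ₐ[K] MvPolynomial (H × Fin 2) K :=
  aeval fun v => if v.1 = h₀ then (if v.2 = 0 then 1 else 0) else X v

lemma eps_uni (h₀ : H) (u : V) (c : K) (F : MvPolynomial (H × Fin 2) K) :
    eps h₀ (uni ν u c F) = uni ν u c (eps h₀ F) := by
  have : (eps h₀).comp (uni ν u c) = (uni ν u c).comp (eps h₀) := by
    apply MvPolynomial.algHom_ext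
    rintro ⟨h, i⟩
    simp only [AlgHom.comp_apply]
    by_cases hh : h = h₀
    · subst hh
      fin_cases i
      · by_cases hu : ν h = u <;> simp [eps, uni, hu]
      · simp [eps, uni]
    · fin_cases i
      · by_cases hu : ν h = u <;> simp [eps, uni, hu, hh, C_eq_smul_one]
      · simp [eps, uni, hh]
  exact congrArg (fun f => f F) this

lemma eps_hom (h₀ : H) (F : MvPolynomial (H × Fin 2) K) (κ : Multiset H × Multiset V)
    (hF : IsWeightedHomogeneous (wt ν) F κ) :
    IsWeightedHomogeneous (wt ν) (eps h₀ F) (κ.1.filter (· ≠ h₀), κ.2) := by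
  refine whom_aeval (wt ν) (fun v => (({v.1} : Multiset H).filter (· ≠ h₀), (wt ν v).2)) _ ?_ F _ ?_
  · rintro ⟨h, i⟩
    by_cases hh : h = h₀
    · subst hh
      fin_cases i
      · simp [wt, Multiset.filter_singleton]
        exact isWeightedHomogeneous_one K (wt ν)
      · simpa using isWeightedHomogeneous_zero K (wt ν) _
    · have := isWeightedHomogeneous_X K (wt ν) (h, i)
      simpa [wt, Multiset.filter_singleton, hh] using this
  · intro m hm
    rw [← supp_of_hom hF m hm]
    refine Prod.ext ?_ ?_
    · simp only [Prod.fst_sum, Prod.smul_fst, wt]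
      let φ : Multiset H →+ Multiset H := ⟨⟨Multiset.filter (· ≠ h₀), Multiset.filter_zero _⟩,
        Multiset.filter_add _⟩
      have := map_sum φ (fun v : H × Fin 2 => m v • ({v.1} : Multiset H)) Finset.univ
      simp only [map_nsmul] at this
      exact this.symm
    · simp [Prod.snd_sum]


lemma eps_mon (h₀ : H) (L : Multiset H) (P : Multiset (H × H)) (hL : h₀ ∉ L)
    (hP : ∀ p ∈ P, p.1 ≠ h₀ ∧ p.2 ≠ h₀) : eps h₀ (mon K L P) = mon K L P := by
  rw [mon, map_mul, map_multiset_prod, map_multiset_prod, Multiset.map_map, Multiset.map_map]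
  congr 2
  · refine Multiset.map_congr rfl fun h hh => ?_
    have : h ≠ h₀ := fun e => hL (e ▸ hh)
    simp [eps, this]
  · refine Multiset.map_congr rfl fun p hp => ?_
    simp [eps, br, hP p hp]

lemma X_dvd_of_eps (h₀ : H) (F : MvPolynomial (H × Fin 2) K) (κ : Multiset H × Multiset V)
    (hF : IsWeightedHomogeneous (wt ν) F κ) (h : eps h₀ F = 0) : X (h₀, 1) ∣ F := by
  have h1 := X_dvd_sub (h₀, 1) F
  have h2 := aeval_scale (fun w => if w = (h₀, 1) then (0 : MvPolynomial (H × Fin 2) K) else X w)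
    (fun v => if v.1 = h₀ then (if v.2 = 0 then 1 else 0) else X v) (X (h₀, 0))
    (fun v => if v.1 = h₀ then 1 else 0) ?_ F (κ.1.count h₀) ?_
  · have h3 : X (h₀, 1) ∣ F - X (h₀, 0) ^ κ.1.count h₀ * eps h₀ F := by
      convert h1 using 2
      convert h2.symm
      all_goals first | rfl | (unfold eps; congr!) | congr!
    rwa [h, mul_zero, sub_zero] at h3
  · rintro ⟨h, i⟩
    by_cases hh : h = h₀
    · subst hh; fin_cases i <;> simp
    · simp [hh]
  · intro m hm
    rw [← supp_of_hom hF m hm, count_fst, Fintype.sum_prod_type, Finset.sum_eq_single h₀]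
    · simp
    · intro h _ hh; simp [hh]
    · simp

theorem fft_uni : ∀ (n : ℕ) (κ : Multiset H × Multiset V) (F : MvPolynomial (H × Fin 2) K),
    κ.1.card = n → IsWeightedHomogeneous (wt ν) F κ → (∀ u c, uni ν u c F = F) →
    F ∈ Submodule.span K (Mon K ν κ) := by
  intro n
  induction n using Nat.strong_induction_on with
  | _ n ih =>
  intro κ F hn hF hU
  by_cases hF0 : F = 0
  · rw [hF0]; exact Submodule.zero_mem _
  by_cases hκ : κ.1 = 0
  · -- constant
    have hm : ∀ m ∈ F.support, m = 0 := by
      intro m hm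
      have h1 := supp_of_hom hF m hm
      ext ⟨h, i⟩
      have h2 := count_fst ν m h
      rw [h1, hκ] at h2
      rw [Multiset.count_zero] at h2
      fin_cases i
      · simp; omega
      · simp; omega
    have hne : F.support.Nonempty := by
      rw [Finset.nonempty_iff_ne_empty]; simpa using hF0
    obtain ⟨m, hmm⟩ := hne
    have hm0 := hm m hmm
    have h1 := supp_of_hom hF m hmm
    have hFC : F = C (F.coeff 0) := by
      ext m'
      rw [coeff_C]
      split_ifs with h
      · rw [h]
      · by_contra hc
        exact h (hm m' (mem_support_iff.2 hc)).symm
    rw [hFC, C_eq_smul_one]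
    refine Submodule.smul_mem _ _ (Submodule.subset_span ⟨0, 0, by simp, ?_, by simp [mon]⟩)
    rw [← h1, hm0]; simp [mwt]
  obtain ⟨h₀, hh₀⟩ := Multiset.exists_mem_of_ne_zero hκ
  have hN : 0 < κ.1.count h₀ := Multiset.count_pos.2 hh₀
  -- the top coefficient
  set δ := κ.1.filter (· ≠ h₀) with hδ
  have hsplit : κ.1 = δ + Multiset.replicate (κ.1.count h₀) h₀ := by
    ext j
    rw [Multiset.count_add, hδ, Multiset.count_filter, Multiset.count_replicate]
    by_cases hj : j = h₀
    · subst hj; simp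
    · simp [hj, Ne.symm hj]
  have hcard : κ.1.card = δ.card + κ.1.count h₀ := by
    conv_lhs => rw [hsplit]
    simp
  have hG := ih δ.card (by omega) (δ, κ.2) (eps h₀ F) rfl (eps_hom ν h₀ F κ hF)
    (fun u c => by rw [← eps_uni, hU])
  have hXY := XY ν (ν h₀) F hF0 κ (supp_of_hom hF) (hU _ _)
  have hlift : ∀ G ∈ Submodule.span K (Mon K ν (δ, κ.2)),
      ∃ M ∈ Submodule.span K (Mon K ν κ), eps h₀ M = G := by
    intro G hG
    induction hG using Submodule.span_induction with
    | zero => exact ⟨0, Submodule.zero_mem _, map_zero _⟩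
    | add x y _ _ hx hy =>
      obtain ⟨a, ha, ha'⟩ := hx
      obtain ⟨b, hb, hb'⟩ := hy
      exact ⟨a + b, Submodule.add_mem _ ha hb, by rw [map_add, ha', hb']⟩
    | smul c x _ hx =>
      obtain ⟨a, ha, ha'⟩ := hx
      exact ⟨c • a, Submodule.smul_mem _ _ ha, by rw [map_smul, ha']⟩
    | mem x hx =>
      obtain ⟨L, P, hP, hw, rfl⟩ := hx
      have hw1 : L + P.map Prod.fst + P.map Prod.snd = δ := congrArg Prod.fst hw
      have hw2 : L.map ν + P.map (fun p => ν p.1) = κ.2 := congrArg Prod.snd hw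
      have hLδ : h₀ ∉ δ := by simp [hδ]
      have hLn : h₀ ∉ L := fun h => hLδ (by rw [← hw1]; simp [h])
      have hPn : ∀ p ∈ P, p.1 ≠ h₀ ∧ p.2 ≠ h₀ := by
        intro p hp
        constructor
        · rintro rfl
          apply hLδ; rw [← hw1]
          simp only [Multiset.mem_add, Multiset.mem_map]
          exact Or.inl (Or.inr ⟨p, hp, rfl⟩)
        · rintro rfl
          apply hLδ; rw [← hw1]
          simp only [Multiset.mem_add, Multiset.mem_map]
          exact Or.inr ⟨p, hp, rfl⟩
      have hPe : P.map (fun p => ν p.1) = (P.map Prod.snd).map ν := by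
        rw [Multiset.map_map]; exact Multiset.map_congr rfl hP
      have hPe' : P.map (fun p => ν p.1) = (P.map Prod.fst).map ν := by
        rw [Multiset.map_map]; rfl
      have hcount : κ.1.count h₀ ≤ (L.filter (fun j => ν j = ν h₀)).card := by
        have e1 : (κ.1.map ν).count (ν h₀) = (δ.map ν).count (ν h₀) + κ.1.count h₀ := by
          conv_lhs => rw [hsplit]
          simp
        have e2 : (δ.map ν).count (ν h₀) = (L.map ν).count (ν h₀) +
            2 * (P.map (fun p => ν p.1)).count (ν h₀) := by
          rw [← hw1, Multiset.map_add, Multiset.map_add, ← hPe, ← hPe', Multiset.count_add,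
            Multiset.count_add]
          ring
        have e3 : κ.2.count (ν h₀) = (L.map ν).count (ν h₀) +
            (P.map (fun p => ν p.1)).count (ν h₀) := by
          rw [← hw2, Multiset.count_add]
        have e4 : (L.map ν).count (ν h₀) = (L.filter (fun j => ν j = ν h₀)).card := by
          rw [Multiset.count_map]
          simp only [eq_comm]
        omega
      obtain ⟨L₁, hL₁c⟩ : ∃ x, x ∈ Multiset.powersetCard (κ.1.count h₀)
          (L.filter (fun j => ν j = ν h₀)) := by
        apply Multiset.card_pos_iff_exists_mem.1
        rw [Multiset.card_powersetCard]
        exact Nat.choose_pos hcount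
      obtain ⟨hL₁, hc₁⟩ := Multiset.mem_powersetCard.1 hL₁c
      have hL₁L : L₁ ≤ L := hL₁.trans (Multiset.filter_le _ _)
      obtain ⟨L₂, rfl⟩ := Multiset.le_iff_exists_add.1 hL₁L
      have hν : ∀ j ∈ L₁, ν j = ν h₀ := fun j hj =>
        (Multiset.mem_filter.1 (Multiset.mem_of_le hL₁ hj)).2
      refine ⟨mon K L₂ (P + L₁.map fun j => (h₀, j)), Submodule.subset_span
        ⟨L₂, _, ?_, ?_, rfl⟩, ?_⟩
      · intro p hp
        rw [Multiset.mem_add, Multiset.mem_map] at hp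
        rcases hp with hp | ⟨j, hj, rfl⟩
        · exact hP p hp
        · exact (hν j hj).symm
      · refine Prod.ext ?_ ?_
        · rw [hsplit, ← hw1]
          simp only [mwt, Multiset.map_add, Multiset.map_map, Function.comp_def, Multiset.map_const',
            hc₁, Multiset.map_id']
          abel
        · rw [← hw2]
          simp only [mwt, Multiset.map_add, Multiset.map_map, Function.comp_def]
          have : L₁.map (fun _ => ν h₀) = L₁.map ν :=
            Multiset.map_congr rfl fun j hj => (hν j hj).symm
          rw [this]; abel
      · have e : mon K L₂ (P + L₁.map fun j => (h₀, j)) =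
            mon K L₂ P * (L₁.map fun j => br K (h₀, j)).prod := by
          simp only [mon, Multiset.map_add, Multiset.prod_add, Multiset.map_map, Function.comp_def]
          ring
        have e' : mon K (L₁ + L₂) P = mon K L₂ P * (L₁.map fun j => X (j, 1)).prod := by
          simp only [mon, Multiset.map_add, Multiset.prod_add]
          ring
        rw [e, e', map_mul, eps_mon h₀ L₂ P (fun h => hLn (by simp [h])) hPn, map_multiset_prod,
          Multiset.map_map]
        congr 2
        refine Multiset.map_congr rfl fun j hj => ?_
        have : j ≠ h₀ := fun h => hLn (by rw [← h]; simp [hj])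
        simp [br, eps, this]
  obtain ⟨M, hM, hMG⟩ := hlift _ hG
  have hMprop : IsWeightedHomogeneous (wt ν) M κ ∧ ∀ u c, uni ν u c M = M := by
    clear hMG
    induction hM using Submodule.span_induction with
    | zero => exact ⟨isWeightedHomogeneous_zero _ _ _, by simp⟩
    | add x y _ _ hx hy =>
      exact ⟨hx.1.add hy.1, fun u c => by rw [map_add, hx.2, hy.2]⟩
    | smul c x _ hx =>
      exact ⟨(weightedHomogeneousSubmodule K (wt ν) κ).smul_mem c hx.1,
        fun u c => by rw [map_smul, hx.2]⟩
    | mem x hx =>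
      obtain ⟨L, P, hP, hw, rfl⟩ := hx
      exact ⟨hw ▸ mon_hom ν L P hP, fun u c => uni_mon ν u c L P hP⟩
  have hdvd : X (h₀, 1) ∣ F - M := by
    refine X_dvd_of_eps ν h₀ (F - M) κ
      ((weightedHomogeneousSubmodule K (wt ν) κ).sub_mem hF hMprop.1) ?_
    rw [map_sub, hMG, sub_self]
  obtain ⟨F₂, hF₂⟩ := hdvd
  have hFM : F = M + X (h₀, 1) * F₂ := by rw [← hF₂]; ring
  rw [hFM]
  refine Submodule.add_mem _ hM ?_
  by_cases h0 : F₂ = 0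
  · rw [h0, mul_zero]; exact Submodule.zero_mem _
  have hhom : IsWeightedHomogeneous (wt ν) (X (h₀, 1) * F₂) κ := by
    rw [← hF₂]
    exact ((weightedHomogeneousSubmodule K (wt ν) κ).sub_mem hF hMprop.1)
  have hw : ∀ m ∈ F₂.support, (∑ v, m v • wt ν v) + wt ν (h₀, 1) = κ := by
    intro m hm
    have h1 : coeff (Finsupp.single (h₀, 1) 1 + m) (X (h₀, 1) * F₂) ≠ 0 := by
      rw [coeff_X_mul]
      exact mem_support_iff.1 hm
    have h2 := hhom h1
    rw [map_add, weight_sum (wt ν) m] at h2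
    rw [← h2, add_comm]
    simp [Finsupp.weight_apply]
  have hne : F₂.support.Nonempty := by
    rw [Finset.nonempty_iff_ne_empty]; simpa using h0
  obtain ⟨m₀, hm₀⟩ := hne
  set κ₂ := ∑ v, m₀ v • wt ν v with hκ₂
  have hκκ : κ₂ + wt ν (h₀, 1) = κ := hw m₀ hm₀
  have hc2 : κ₂.1.card < n := by
    rw [← hn, ← hκκ]; simp [wt]
  have hF₂in := ih κ₂.1.card hc2 κ₂ F₂ rfl
    (hom_of_supp fun m hm => add_right_cancel ((hw m hm).trans hκκ.symm)) (fun u c => by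
      have : X (h₀, 1) * uni ν u c F₂ = X (h₀, 1) * F₂ := by
        rw [← uni_X1 ν u c h₀, ← map_mul, ← hF₂, uni_X1, ← hF₂, map_sub, hU, hMprop.2]
      exact mul_left_cancel₀ (X_ne_zero _) this)
  have hmul : ∀ G ∈ Submodule.span K (Mon K ν κ₂),
      X (h₀, 1) * G ∈ Submodule.span K (Mon K ν κ) := by
    intro G hG
    induction hG using Submodule.span_induction with
    | zero => rw [mul_zero]; exact Submodule.zero_mem _
    | add x y _ _ hx hy => rw [mul_add]; exact Submodule.add_mem _ hx hy
    | smul c x _ hx => rw [mul_smul_comm]; exact Submodule.smul_mem _ _ hx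
    | mem x hx =>
      obtain ⟨L, P, hP, hw, rfl⟩ := hx
      refine Submodule.subset_span ⟨h₀ ::ₘ L, P, hP, ?_, ?_⟩
      · rw [← hκκ, ← hw]
        refine Prod.ext ?_ ?_
        · simp only [mwt, wt, Prod.fst_add, ← Multiset.singleton_add]; abel
        · simp [mwt, wt]
          simp only [← Multiset.singleton_add]; abel
      · simp [mon, mul_assoc]
  exact hmul _ hF₂in

end FFT

namespace FFT
open MvPolynomial

section general
variable {σ K : Type} [Fintype σ] [Field K]

lemma weight_sum' {M : Type} [AddCommMonoid M] (w : σ → M) (m : σ →₀ ℕ) :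
    Finsupp.weight w m = ∑ v, m v • w v := by
  rw [Finsupp.weight_apply, Finsupp.sum_fintype]; simp

lemma sum_comp {M : Type} [AddCommMonoid M] (w : σ → M) (F : MvPolynomial σ K) :
    F = ∑ δ ∈ F.support.image (fun m => Finsupp.weight w m), weightedHomogeneousComponent w δ F := by
  ext m
  rw [coeff_sum]
  simp only [coeff_weightedHomogeneousComponent]
  by_cases hm : m ∈ F.support
  · rw [Finset.sum_eq_single (Finsupp.weight w m)]
    · simp
    · intro b _ hb; simp [hb.symm]
    · intro h; exact absurd (Finset.mem_image_of_mem _ hm) h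
  · rw [notMem_support_iff.1 hm]; simp

lemma comp_aeval {M : Type} [AddCommMonoid M] (w : σ → M) (f : σ → MvPolynomial σ K)
    (hf : ∀ v, IsWeightedHomogeneous w (f v) (w v)) (F : MvPolynomial σ K) (δ : M) :
    weightedHomogeneousComponent w δ (aeval f F) =
      aeval f (weightedHomogeneousComponent w δ F) := by
  have h : ∀ δ', IsWeightedHomogeneous w (aeval f (weightedHomogeneousComponent w δ' F)) δ' := by
    intro δ'
    refine whom_aeval w w f hf _ _ fun m hm => ?_
    rw [← weight_sum']
    exact (weightedHomogeneousComponent_isWeightedHomogeneous (w := w) (n := δ') (φ := F)) (mem_support_iff.1 hm)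
  conv_lhs => rw [sum_comp w F, map_sum, map_sum]
  by_cases hδ : δ ∈ F.support.image (fun m => Finsupp.weight w m)
  · rw [Finset.sum_eq_single δ]
    · exact (h δ).weightedHomogeneousComponent_same
    · intro b _ hb
      exact (h b).weightedHomogeneousComponent_ne _ hb.symm
    · intro h; exact absurd hδ h
  · rw [Finset.sum_eq_zero]
    · have : weightedHomogeneousComponent w δ F = 0 := by
        ext m
        rw [coeff_weightedHomogeneousComponent, coeff_zero]
        split_ifs with h1
        · by_contra hc
          exact hδ (Finset.mem_image.2 ⟨m, mem_support_iff.2 hc, h1⟩)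
        · rfl
      rw [this, map_zero]
    · intro b hb
      refine (h b).weightedHomogeneousComponent_ne _ ?_
      rintro rfl; exact hδ hb

lemma coeff_scale (c : σ → K) (F : MvPolynomial σ K) (m : σ →₀ ℕ) :
    coeff m (aeval (fun v => C (c v) * X v) F) = (∏ v, c v ^ m v) * coeff m F := by
  induction F using MvPolynomial.induction_on' with
  | add p q hp hq => rw [map_add, coeff_add, coeff_add, hp, hq, mul_add]
  | monomial m' r =>
    have : aeval (fun v => (C (c v) * X v : MvPolynomial σ K)) (monomial m' r) =
        monomial m' ((∏ v, c v ^ m' v) * r) := by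
      rw [aeval_monomial, Finsupp.prod_fintype _ _ (by simp)]
      simp only [mul_pow, Finset.prod_mul_distrib, ← map_pow, ← map_prod]
      rw [monomial_eq (s := m'), Finsupp.prod_fintype _ _ (by simp), algebraMap_eq, map_mul]
      ring
    rw [this, coeff_monomial, coeff_monomial]
    split_ifs with h
    · rw [h]
    · simp

lemma pow_inj_field [Infinite K] {a b : ℕ} (h : ∀ s : K, s ≠ 0 → s ^ a = s ^ b) : a = b := by
  have : (Polynomial.X ^ (a + 1) : Polynomial K) = Polynomial.X ^ (b + 1) := by
    apply Polynomial.funext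
    intro s
    by_cases hs : s = 0
    · simp [hs]
    · simp [pow_succ, h s hs]
  have := congrArg Polynomial.natDegree this
  simpa using this

end general

variable {H V K : Type} [Fintype H] [Field K] (ν : H → V)

/-- action on vectors -/
noncomputable def slact (g : V → Matrix (Fin 2) (Fin 2) K) :
    MvPolynomial (H × Fin 2) K →ₐ[K] MvPolynomial (H × Fin 2) K :=
  aeval fun v => ∑ k : Fin 2, C (g (ν v.1) v.2 k) * X (v.1, k)

theorem fft_sl [Infinite K] (F : MvPolynomial (H × Fin 2) K)
    (hF : ∀ g : V → Matrix (Fin 2) (Fin 2) K, (∀ v, (g v).det = 1) → slact ν g F = F)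
    (S : Set (Multiset H)) (hS : ∀ m ∈ F.support, (∑ v, m v • wt ν v).1 ∈ S) :
    F ∈ Submodule.span K {G | ∃ P : Multiset (H × H), (∀ p ∈ P, ν p.1 = ν p.2) ∧
      P.map Prod.fst + P.map Prod.snd ∈ S ∧ G = (P.map (br K)).prod} := by
  let w : H × Fin 2 → Multiset H := fun v => {v.1}
  have hwt : ∀ m : H × Fin 2 →₀ ℕ, (∑ v, m v • wt ν v).1 = Finsupp.weight w m := by
    intro m; rw [weight_sum', Prod.fst_sum]; rfl
  -- torus
  have htor : ∀ m ∈ F.support, ∀ u,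
      ((∑ v, m v • wt ν v).1.map ν).count u = 2 * (∑ v, m v • wt ν v).2.count u := by
    intro m hm u
    have key : (∑ h : H, if u = ν h then m (h, 0) else 0) = ∑ h : H, if u = ν h then m (h, 1) else 0 := by
      apply pow_inj_field (K := K)
      intro s hs
      have h1 := hF (fun v => if v = u then !![s, 0; 0, s⁻¹] else 1) (by
        intro v; split_ifs <;> simp [Matrix.det_fin_two, hs])
      have h2 : slact ν (fun v => if v = u then !![s, 0; 0, s⁻¹] else 1) =
         aeval (fun v : H × Fin 2 => (C (if u = ν v.1 then (if v.2 = 0 then s else s⁻¹) else 1) * X v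
          : MvPolynomial (H × Fin 2) K)) := by
        apply MvPolynomial.algHom_ext
        rintro ⟨h, i⟩
        by_cases hu : ν h = u
        · fin_cases i <;> simp [slact, hu, Fin.sum_univ_two]
        · have hu' : u ≠ ν h := fun h => hu h.symm
          fin_cases i <;> simp [slact, hu, hu', Fin.sum_univ_two]
      rw [h2] at h1
      have h3 := coeff_scale (fun v : H × Fin 2 => (if u = ν v.1 then (if v.2 = 0 then s else s⁻¹) else 1)) F m
      rw [h1] at h3
      have h4 : (∏ v : H × Fin 2, (if u = ν v.1 then (if v.2 = 0 then s else s⁻¹) else 1) ^ m v) = 1 := by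
        have := mem_support_iff.1 hm
        exact (mul_right_cancel₀ this ((one_mul _).trans h3)).symm
      rw [Fintype.prod_prod_type] at h4
      have h5 : ∀ h : H, ∏ i : Fin 2, (if u = ν h then (if i = 0 then s else s⁻¹) else 1) ^ m (h, i) =
          s ^ (if u = ν h then m (h, 0) else 0) * (s ^ (if u = ν h then m (h, 1) else 0))⁻¹ := by
        intro h
        rw [Fin.prod_univ_two]
        by_cases hu : u = ν h <;> simp [hu]
      simp only [h5, Finset.prod_mul_distrib, Finset.prod_inv_distrib, Finset.prod_pow_eq_pow_sum] at h4
      rw [mul_inv_eq_one₀ (pow_ne_zero _ hs)] at h4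
      exact h4
    rw [count_map_fst, count_snd, two_mul]
    nth_rewrite 1 [← key]
    rw [← Finset.sum_add_distrib]
    refine Finset.sum_congr rfl fun h _ => ?_
    split_ifs <;> simp
  rw [sum_comp w F]
  refine Submodule.sum_mem _ fun δ hδ => ?_
  simp only [Finset.mem_image] at hδ
  obtain ⟨m₀, hm₀, hm₀δ⟩ := hδ
  set G := weightedHomogeneousComponent w δ F with hG
  have hGs : ∀ m ∈ G.support, m ∈ F.support ∧ Finsupp.weight w m = δ := by
    intro m hm
    rw [mem_support_iff, hG, coeff_weightedHomogeneousComponent] at hm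
    split_ifs at hm with h
    · exact ⟨mem_support_iff.2 hm, h⟩
    · exact absurd rfl hm
  have hGinv : ∀ g : V → Matrix (Fin 2) (Fin 2) K, (∀ v, (g v).det = 1) → slact ν g G = G := by
    intro g hg
    have := comp_aeval w (fun v : H × Fin 2 => ∑ k : Fin 2, C (g (ν v.1) v.2 k) * X (v.1, k))
      (by
        intro v
        refine IsWeightedHomogeneous.sum _ _ _ fun k _ => ?_
        have := (isWeightedHomogeneous_C w (g (ν v.1) v.2 k)).mul
          (isWeightedHomogeneous_X K w (v.1, k))
        rwa [zero_add] at this) F δ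
    rw [hG, slact, ← this]
    congr 1
    exact hF g hg
  set Y := (∑ v, m₀ v • wt ν v).2 with hY
  have hδν : ∀ u, (δ.map ν).count u = 2 * Y.count u := by
    intro u
    have := htor m₀ hm₀ u
    rwa [hwt, hm₀δ] at this
  have hGhom : IsWeightedHomogeneous (wt ν) G (δ, Y) := by
    refine hom_of_supp fun m hm => ?_
    obtain ⟨h1, h2⟩ := hGs m hm
    refine Prod.ext ?_ ?_
    · rw [hwt, h2]
    · ext u
      have := htor m h1 u
      rw [hwt, h2, hδν] at this
      change _ = Y.count u
      omega
  have huni : ∀ u c, uni ν u c G = G := by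
    intro u c
    have h1 := hGinv (fun v => if v = u then !![1, c; 0, 1] else 1) (by
        intro v; split_ifs <;> simp [Matrix.det_fin_two])
    have h2 : slact ν (fun v => if v = u then !![1, c; 0, 1] else 1) = uni (H := H) ν u c := by
      apply MvPolynomial.algHom_ext
      rintro ⟨h, i⟩
      by_cases hu : ν h = u
      · fin_cases i <;> simp [slact, uni, hu, Fin.sum_univ_two]
      · fin_cases i <;> simp [slact, uni, hu, Fin.sum_univ_two]
    rw [h2] at h1
    exact h1
  have hspan := fft_uni ν _ (δ, Y) G rfl hGhom huni
  refine Submodule.span_mono ?_ hspan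
  rintro x ⟨L, P, hP, hw, rfl⟩
  have hw1 : L + P.map Prod.fst + P.map Prod.snd = δ := congrArg Prod.fst hw
  have hw2 : L.map ν + P.map (fun p => ν p.1) = Y := congrArg Prod.snd hw
  have hPe : P.map (fun p => ν p.1) = (P.map Prod.snd).map ν := by
    rw [Multiset.map_map]; exact Multiset.map_congr rfl hP
  have hPe' : P.map (fun p => ν p.1) = (P.map Prod.fst).map ν := by
    rw [Multiset.map_map]; rfl
  have hL : L = 0 := by
    have : L.map ν = 0 := by
      ext u
      have h1 := hδν u
      rw [← hw1, ← hw2, Multiset.map_add, Multiset.map_add, ← hPe, ← hPe', Multiset.count_add,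
        Multiset.count_add] at h1
      simp only [Multiset.count_zero]
      omega
    simpa using this
  subst hL
  refine ⟨P, hP, ?_, by simp [mon]⟩
  have := hS m₀ hm₀
  rw [hwt, hm₀δ, ← hw1, zero_add] at this
  exact this

end FFT

namespace QuiverData
open MvPolynomial

variable (Q : QuiverData) (K : Type) [Field K]

instance instFintypeVar [Fintype Q.A] : Fintype Q.Var :=
  inferInstanceAs (Fintype (Q.A × Fin 2 × Fin 2))

/-- the ring of vectors -/
abbrev PV : Type := MvPolynomial ((Q.A × Bool) × Fin 2) K

/-- the rank one specialization -/
noncomputable def phi : MvPolynomial Q.Var K →ₐ[K] PV Q K :=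
  aeval fun v : Q.Var => X ((v.1, true), v.2.1) * X ((v.1, false), 1 - v.2.2)

lemma phi_X (a : Q.A) (i j : Fin 2) : Q.phi K (Q.genMat K a i j) =
    X ((a, true), i) * X ((a, false), 1 - j) := aeval_X _ _

variable [CharP K 2]

lemma phi_lmat (x : Q.A × Bool) (i j : Fin 2) : Q.phi K (Q.lmat K x i j) =
    X (x, i) * X (hbar x, 1 - j) := by
  obtain ⟨a, b⟩ := x
  cases b
  · fin_cases i <;> fin_cases j <;>
      simp [lmat, Matrix.adjugate_fin_two, phi_X, hbar, CharTwo.neg_eq, mul_comm]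
  · simp [lmat, phi_X, hbar]

lemma phi_act {g : Q.V → Matrix (Fin 2) (Fin 2) K} (hg : ∀ v, (g v).det = 1)
    (f : MvPolynomial Q.Var K) :
    Q.phi K (Q.actHom K g f) = FFT.slact Q.dbl.tgt g (Q.phi K f) := by
  have : (Q.phi K).comp (Q.actHom K g) = (FFT.slact Q.dbl.tgt g).comp (Q.phi K) := by
    apply MvPolynomial.algHom_ext
    rintro ⟨a, i, j⟩
    have h1 : Q.actHom K g (Q.genMat K a i j) = ∑ k : Fin 2, ∑ l : Fin 2,
      MvPolynomial.C (g (Q.tgt a) i k * (g (Q.src a))⁻¹ l j) * Q.genMat K a k l :=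
      MvPolynomial.aeval_X _ _
    have hinv : (g (Q.src a))⁻¹ = (g (Q.src a)).adjugate := by
      rw [Matrix.inv_def, hg]; simp
    change Q.phi K (Q.actHom K g (Q.genMat K a i j)) =
      FFT.slact _ g (Q.phi K (Q.genMat K a i j))
    rw [h1, phi_X]
    simp only [map_sum, map_add, map_mul, FFT.slact, aeval_X, hinv, Fin.sum_univ_two, algHom_C,
      algebraMap_eq, Matrix.adjugate_fin_two]
    rw [phi_X, phi_X, phi_X, phi_X]
    fin_cases j <;> simp [dbl, CharTwo.neg_eq] <;> ring
  exact congrArg (fun F => F f) this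

/-- determinant of an arrow -/
noncomputable def dt (a : Q.A) : MvPolynomial Q.Var K := (Q.genMat K a).det

lemma dt_eq (a : Q.A) : Q.dt K a = Q.genMat K a 0 0 * Q.genMat K a 1 1 +
    Q.genMat K a 0 1 * Q.genMat K a 1 0 := by
  rw [dt, Matrix.det_fin_two, CharTwo.sub_eq_add]

lemma phi_dt (a : Q.A) : Q.phi K (Q.dt K a) = 0 := by
  rw [dt_eq, map_add, map_mul, map_mul, phi_X, phi_X, phi_X, phi_X]
  simp only [sub_zero, sub_self]
  rw [← CharTwo.sub_eq_add]; ring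

/-- ideal of determinants -/
noncomputable def I1 : Ideal (MvPolynomial Q.Var K) := Ideal.span (Set.range (Q.dt K))

/-- section on exponents -/
noncomputable def sexp [Fintype Q.A] (k : (Q.A × Bool) × Fin 2 →₀ ℕ) : Q.Var →₀ ℕ :=
  Finsupp.equivFunOnFinite.symm fun v : Q.Var =>
    if v.2.1 = 0 then
      (if v.2.2 = 0 then min (k ((v.1, true), 0)) (k ((v.1, false), 1))
        else k ((v.1, true), 0) - k ((v.1, false), 1))
    else (if v.2.2 = 0 then k ((v.1, false), 1) - k ((v.1, true), 0)
        else min (k ((v.1, true), 1)) (k ((v.1, false), 0)))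

/-- exponents of phi -/
noncomputable def rexp [Fintype Q.A] (m : Q.Var →₀ ℕ) : (Q.A × Bool) × Fin 2 →₀ ℕ :=
  ∑ v : Q.Var, m v • (Finsupp.single ((v.1, true), v.2.1) 1 + Finsupp.single ((v.1, false), 1 - v.2.2) 1)

lemma sum_var [Fintype Q.A] {M : Type} [AddCommMonoid M] (f : Q.Var → M) :
    ∑ v, f v = ∑ a : Q.A, (f (a, 0, 0) + f (a, 0, 1) + (f (a, 1, 0) + f (a, 1, 1))) := by
  have h : ∀ f : Q.A × Fin 2 × Fin 2 → M, ∑ v, f v =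
      ∑ a : Q.A, (f (a, 0, 0) + f (a, 0, 1) + (f (a, 1, 0) + f (a, 1, 1))) := by
    intro f
    simp [Fintype.sum_prod_type, Fin.sum_univ_two]
  exact h f

lemma prod_var [Fintype Q.A] {M : Type} [CommMonoid M] (f : Q.Var → M) :
    ∏ v, f v = ∏ a : Q.A, (f (a, 0, 0) * f (a, 0, 1) * (f (a, 1, 0) * f (a, 1, 1))) := by
  have h : ∀ f : Q.A × Fin 2 × Fin 2 → M, ∏ v, f v =
      ∏ a : Q.A, (f (a, 0, 0) * f (a, 0, 1) * (f (a, 1, 0) * f (a, 1, 1))) := by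
    intro f
    simp [Fintype.prod_prod_type, Fin.prod_univ_two]
  exact h f

lemma phi_monomial [Fintype Q.A] (m : Q.Var →₀ ℕ) (r : K) :
    Q.phi K (monomial m r) = monomial (Q.rexp m) r := by
  rw [phi, aeval_monomial, Finsupp.prod_fintype _ _ (by simp), rexp, monomial_eq, algebraMap_eq]
  congr 1
  rw [Finsupp.prod_fintype _ _ (by simp)]
  have : ∀ (s : Finset Q.Var) (f : Q.Var → ((Q.A × Bool) × Fin 2 →₀ ℕ)),
      (∏ i, (X i : PV Q K) ^ ((∑ v ∈ s, f v) i)) = ∏ v ∈ s, ∏ i, (X i : PV Q K) ^ (f v i) := by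
    intro s f
    rw [Finset.prod_comm]
    refine Finset.prod_congr rfl fun i _ => ?_
    rw [Finset.prod_pow_eq_pow_sum, Finsupp.finsetSum_apply]
  rw [this]
  refine Finset.prod_congr rfl fun v _ => ?_
  simp only [Finsupp.coe_smul, Finsupp.coe_add, Pi.smul_apply, Pi.add_apply, smul_eq_mul, mul_pow]
  simp only [mul_add, pow_add, Finset.prod_mul_distrib]
  congr 1
  · rw [Finset.prod_eq_single ((v.1, true), v.2.1)] <;> simp +contextual [Finsupp.single_apply, eq_comm]
  · rw [Finset.prod_eq_single ((v.1, false), 1 - v.2.2)] <;> simp +contextual [Finsupp.single_apply, eq_comm]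

lemma rexp_apply [Fintype Q.A] (m : Q.Var →₀ ℕ) (a : Q.A) :
    Q.rexp m ((a, true), 0) = m (a, 0, 0) + m (a, 0, 1) ∧
    Q.rexp m ((a, true), 1) = m (a, 1, 0) + m (a, 1, 1) ∧
    Q.rexp m ((a, false), 1) = m (a, 0, 0) + m (a, 1, 0) ∧
    Q.rexp m ((a, false), 0) = m (a, 0, 1) + m (a, 1, 1) := by
  simp only [rexp, sum_var, Finsupp.finsetSum_apply]
  refine ⟨?_, ?_, ?_, ?_⟩
  all_goals
    rw [Finset.sum_eq_single a]
    · simp [Finsupp.single_apply]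
    · intro b _ hb; simp [Finsupp.single_apply, hb]
    · simp

lemma sexp_apply [Fintype Q.A] (k : (Q.A × Bool) × Fin 2 →₀ ℕ) (a : Q.A) :
    Q.sexp k (a, 0, 0) = min (k ((a, true), 0)) (k ((a, false), 1)) ∧
    Q.sexp k (a, 0, 1) = k ((a, true), 0) - k ((a, false), 1) ∧
    Q.sexp k (a, 1, 0) = k ((a, false), 1) - k ((a, true), 0) ∧
    Q.sexp k (a, 1, 1) = min (k ((a, true), 1)) (k ((a, false), 0)) := by
  refine ⟨?_, ?_, ?_, ?_⟩
  · change (if (0 : Fin 2) = 0 then (if (0 : Fin 2) = 0 then min (k ((a, true), 0)) (k ((a, false), 1)) else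
      k ((a, true), 0) - k ((a, false), 1)) else (if (0 : Fin 2) = 0 then k ((a, false), 1) - k ((a, true), 0) else
      min (k ((a, true), 1)) (k ((a, false), 0)))) = _
    simp
  · change (if (0 : Fin 2) = 0 then (if (1 : Fin 2) = 0 then min (k ((a, true), 0)) (k ((a, false), 1)) else
      k ((a, true), 0) - k ((a, false), 1)) else (if (1 : Fin 2) = 0 then k ((a, false), 1) - k ((a, true), 0) else
      min (k ((a, true), 1)) (k ((a, false), 0)))) = _
    simp
  · change (if (1 : Fin 2) = 0 then (if (0 : Fin 2) = 0 then min (k ((a, true), 0)) (k ((a, false), 1)) else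
      k ((a, true), 0) - k ((a, false), 1)) else (if (0 : Fin 2) = 0 then k ((a, false), 1) - k ((a, true), 0) else
      min (k ((a, true), 1)) (k ((a, false), 0)))) = _
    simp
  · change (if (1 : Fin 2) = 0 then (if (1 : Fin 2) = 0 then min (k ((a, true), 0)) (k ((a, false), 1)) else
      k ((a, true), 0) - k ((a, false), 1)) else (if (1 : Fin 2) = 0 then k ((a, false), 1) - k ((a, true), 0) else
      min (k ((a, true), 1)) (k ((a, false), 0)))) = _
    simp

lemma ker_phi [Fintype Q.A] (f : MvPolynomial Q.Var K) (hf : Q.phi K f = 0) : f ∈ Q.I1 K := by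
  let π := Ideal.Quotient.mkₐ K (Q.I1 K)
  let Lm : PV Q K →ₗ[K] (MvPolynomial Q.Var K ⧸ Q.I1 K) :=
    (basisMonomials _ K).constr K fun k => π (monomial (Q.sexp k) 1)
  have hrel : ∀ a, π (Q.genMat K a 0 1) * π (Q.genMat K a 1 0) =
      π (Q.genMat K a 0 0) * π (Q.genMat K a 1 1) := by
    intro a
    have h1 : π (Q.dt K a) = 0 := by
      refine Ideal.Quotient.eq_zero_iff_mem.2 (Ideal.subset_span ⟨a, rfl⟩)
    rw [dt, Matrix.det_fin_two, map_sub, map_mul, map_mul, sub_eq_zero] at h1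
    exact h1.symm
  have hmon : ∀ m : Q.Var →₀ ℕ, π (monomial m 1) = ∏ a : Q.A,
      (π (Q.genMat K a 0 0) ^ m (a, 0, 0) * π (Q.genMat K a 0 1) ^ m (a, 0, 1) *
      (π (Q.genMat K a 1 0) ^ m (a, 1, 0) * π (Q.genMat K a 1 1) ^ m (a, 1, 1))) := by
    intro m
    rw [monomial_eq, Finsupp.prod_fintype _ _ (by simp), prod_var]
    simp only [map_mul, map_prod, map_pow, map_one, one_mul]
    rfl
  have key : Lm ∘ₗ (Q.phi K).toLinearMap = π.toLinearMap := by
    refine (basisMonomials _ K).ext fun m => ?_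
    simp only [coe_basisMonomials, LinearMap.comp_apply, AlgHom.toLinearMap_apply, phi_monomial]
    have : Lm (monomial (Q.rexp m) 1) = π (monomial (Q.sexp (Q.rexp m)) 1) := by
      have := (basisMonomials _ K).constr_basis K (fun k => π (monomial (Q.sexp k) 1)) (Q.rexp m)
      rwa [coe_basisMonomials] at this
    rw [this, hmon, hmon]
    refine Finset.prod_congr rfl fun a _ => ?_
    obtain ⟨h1, h2, h3, h4⟩ := Q.rexp_apply m a
    obtain ⟨s1, s2, s3, s4⟩ := Q.sexp_apply (Q.rexp m) a
    rw [s1, s2, s3, s4, h1, h2, h3, h4]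
    have hr := hrel a
    generalize π (Q.genMat K a 0 0) = x at *
    generalize π (Q.genMat K a 0 1) = y at *
    generalize π (Q.genMat K a 1 0) = z at *
    generalize π (Q.genMat K a 1 1) = w at *
    generalize m (a, 0, 0) = e0
    generalize m (a, 0, 1) = e1
    generalize m (a, 1, 0) = e2
    generalize m (a, 1, 1) = e3
    rcases le_total e1 e2 with h | h
    · obtain ⟨r, rfl⟩ := Nat.exists_eq_add_of_le h
      have i1 : min (e0 + e1) (e0 + (e1 + r)) = e0 + e1 := by omega
      have i2 : e0 + e1 - (e0 + (e1 + r)) = 0 := by omega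
      have i3 : e0 + (e1 + r) - (e0 + e1) = r := by omega
      have i4 : min (e1 + r + e3) (e1 + e3) = e1 + e3 := by omega
      rw [i1, i2, i3, i4]
      calc _ = x ^ e0 * (x * w) ^ e1 * z ^ r * w ^ e3 := by ring
        _ = x ^ e0 * (y * z) ^ e1 * z ^ r * w ^ e3 := by rw [hr]
        _ = _ := by ring
    · obtain ⟨r, rfl⟩ := Nat.exists_eq_add_of_le h
      have i1 : min (e0 + (e2 + r)) (e0 + e2) = e0 + e2 := by omega
      have i2 : e0 + (e2 + r) - (e0 + e2) = r := by omega
      have i3 : e0 + e2 - (e0 + (e2 + r)) = 0 := by omega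
      have i4 : min (e2 + e3) (e2 + r + e3) = e2 + e3 := by omega
      rw [i1, i2, i3, i4]
      calc _ = x ^ e0 * (x * w) ^ e2 * y ^ r * w ^ e3 := by ring
        _ = x ^ e0 * (y * z) ^ e2 * y ^ r * w ^ e3 := by rw [hr]
        _ = _ := by ring
  have h := congrArg (fun F => F f) key
  simp only [LinearMap.comp_apply, AlgHom.toLinearMap_apply, hf, map_zero] at h
  exact Ideal.Quotient.eq_zero_iff_mem.1 h.symm

end QuiverData

namespace QuiverData
open MvPolynomial

variable (Q : QuiverData) (K : Type) [Field K] [CharP K 2]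

/-- open word value -/
noncomputable def oval (z : (Q.A × Bool) × List (Q.A × Bool) × (Q.A × Bool)) : PV Q K :=
  ∑ i : Fin 2, ∑ k : Fin 2, X (z.2.2, 1 - i) * Q.phi K (Q.wMat K z.2.1 i k) * X (z.1, k)

lemma oval_nil (q p : Q.A × Bool) : Q.oval K (q, [], p) = FFT.br K (q, p) := by
  simp only [oval, wMat_nil, FFT.br, Fin.sum_univ_two]
  simp [CharTwo.sub_eq_add]
  ring

lemma oval_close (q : Q.A × Bool) (W : List (Q.A × Bool)) :
    Q.oval K (q, W, hbar q) = Q.phi K (Q.wTr K (q :: W)) := by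
  simp only [oval, wTr, wMat_cons, Matrix.trace, Matrix.diag, Matrix.mul_apply, Fin.sum_univ_two,
    map_add, map_mul, phi_lmat]
  simp
  ring

lemma oval_join (q p p' : Q.A × Bool) (W W' : List (Q.A × Bool)) :
    Q.oval K (q, W, p) * Q.oval K (hbar p, W', p') = Q.oval K (q, W ++ (hbar p :: W'), p') := by
  simp only [oval, wMat_cons, wMat_append, Matrix.mul_apply, Fin.sum_univ_two,
    map_add, map_mul, phi_lmat, hbar_hbar]
  ring

lemma oval_rev (q p : Q.A × Bool) (W : List (Q.A × Bool)) :
    Q.oval K (q, W, p) = Q.oval K (p, wrev W, q) := by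
  simp only [oval, wMat_wrev, Matrix.adjugate_fin_two, Fin.sum_univ_two]
  simp [CharTwo.neg_eq]
  ring

variable {Q} in
lemma hbar_ne (p : Q.A × Bool) : hbar p ≠ p := by
  obtain ⟨a, b⟩ := p
  cases b <;> simp [hbar]

lemma dbl_src (p : Q.A × Bool) : Q.dbl.src p = Q.dbl.tgt (hbar p) := by
  obtain ⟨a, b⟩ := p
  cases b <;> rfl

/-- ends -/
def ends {H L : Type} (Z : Multiset (H × L × H)) : Multiset H :=
  Z.map (fun z => z.1) + Z.map (fun z => z.2.2)

lemma ends_cons {H L : Type} (z : H × L × H) (Z : Multiset (H × L × H)) :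
    ends (z ::ₘ Z) = z.1 ::ₘ z.2.2 ::ₘ ends Z := by
  simp only [ends, Multiset.map_cons, Multiset.cons_add, Multiset.add_cons]
  rw [Multiset.cons_swap]

lemma close_up (N : ℕ) : ∀ Z : Multiset ((Q.A × Bool) × List (Q.A × Bool) × (Q.A × Bool)),
    Multiset.card Z = N →
    (∀ z ∈ Z, Q.dbl.IsPathFrom (Q.dbl.tgt z.1) (Q.dbl.tgt z.2.2) z.2.1) →
    (ends Z).map hbar = ends Z →
    ∃ Ws : Multiset (List (Q.A × Bool)), (∀ W ∈ Ws, Q.dbl.IsClosed W) ∧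
      (Z.map (Q.oval K)).prod = Q.phi K (Ws.map (Q.wTr K)).prod := by
  induction N with
  | zero =>
    intro Z hZ _ _
    rw [Multiset.card_eq_zero] at hZ
    subst hZ
    exact ⟨0, by simp, by simp⟩
  | succ N ih =>
    intro Z hZ hp hE
    obtain ⟨⟨q, W, p⟩, Z', rfl⟩ := Multiset.card_pos_iff_exists_mem.1 (by omega : 0 < Multiset.card Z)
      |>.imp fun z hz => Multiset.exists_cons_of_mem hz
    have hcard : Multiset.card Z' = N := by simpa using hZ
    have hW := hp _ (Multiset.mem_cons_self _ _)
    simp only at hW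
    by_cases hq : hbar p = q
    · subst hq
      rw [ends_cons] at hE
      simp only [Multiset.map_cons, hbar_hbar] at hE
      rw [Multiset.cons_swap] at hE
      obtain ⟨Ws, h1, h2⟩ := ih Z' hcard (fun z hz => hp z (Multiset.mem_cons_of_mem hz))
        (by simpa using hE)
      refine ⟨(hbar p :: W) ::ₘ Ws, ?_, ?_⟩
      · intro W' hW'
        rcases Multiset.mem_cons.1 hW' with rfl | h
        · exact ⟨_, by simp, isPath_cons.2 ⟨rfl, by rw [dbl_src, hbar_hbar]; exact hW⟩⟩
        · exact h1 _ h
      · rw [Multiset.map_cons, Multiset.prod_cons, Multiset.map_cons, Multiset.prod_cons, map_mul, h2,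
          ← oval_close, hbar_hbar]
    · have hm : hbar p ∈ ends ((q, W, p) ::ₘ Z') := by
        rw [← hE, ends_cons]
        exact Multiset.mem_map_of_mem _ (by simp)
      rw [ends_cons] at hm
      have hm' : hbar p ∈ ends Z' := by
        rcases Multiset.mem_cons.1 hm with h | h
        · exact absurd h hq
        · rcases Multiset.mem_cons.1 h with h | h
          · exact absurd h (hbar_ne p)
          · exact h
      have key : ∃ (W' : List (Q.A × Bool)) (p' : Q.A × Bool)
          (Z'' : Multiset ((Q.A × Bool) × List (Q.A × Bool) × (Q.A × Bool))),
          Q.dbl.IsPathFrom (Q.dbl.tgt (hbar p)) (Q.dbl.tgt p') W' ∧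
          (Z'.map (Q.oval K)).prod = Q.oval K (hbar p, W', p') * (Z''.map (Q.oval K)).prod ∧
          ends Z' = hbar p ::ₘ p' ::ₘ ends Z'' ∧ Multiset.card Z' = Multiset.card Z'' + 1 ∧
          ∀ z ∈ Z'', z ∈ Z' := by
        rcases Multiset.mem_add.1 hm' with h | h
        · obtain ⟨⟨q₁, W₁, p₁⟩, hz, hh⟩ := Multiset.mem_map.1 h
          obtain ⟨Z'', rfl⟩ := Multiset.exists_cons_of_mem hz
          simp only at hh
          subst hh
          refine ⟨W₁, p₁, Z'', hp _ (Multiset.mem_cons_of_mem hz), by simp, by rw [ends_cons],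
            by simp, fun z hz => Multiset.mem_cons_of_mem hz⟩
        · obtain ⟨⟨q₁, W₁, p₁⟩, hz, hh⟩ := Multiset.mem_map.1 h
          obtain ⟨Z'', rfl⟩ := Multiset.exists_cons_of_mem hz
          simp only at hh
          subst hh
          refine ⟨wrev W₁, q₁, Z'', Q.wrev_path (hp _ (Multiset.mem_cons_of_mem hz)),
            by simp [← oval_rev], by rw [ends_cons, Multiset.cons_swap],
            by simp, fun z hz => Multiset.mem_cons_of_mem hz⟩
      obtain ⟨W', p', Z'', k1, k2, k3, k4, k5⟩ := key
      obtain ⟨Ws, h1, h2⟩ := ih ((q, W ++ (hbar p :: W'), p') ::ₘ Z'') (by simp; omega)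
        (by
          intro z hz
          rcases Multiset.mem_cons.1 hz with rfl | h
          · refine isPath_append.2 ⟨_, hW, isPath_cons.2 ⟨?_, k1⟩⟩
            rw [dbl_src, hbar_hbar]
          · exact hp z (Multiset.mem_cons_of_mem (k5 z h)))
        (by
          rw [ends_cons, k3] at hE
          rw [ends_cons]
          have e1 : (q ::ₘ p ::ₘ hbar p ::ₘ p' ::ₘ ends Z'') =
            p ::ₘ hbar p ::ₘ (q ::ₘ p' ::ₘ ends Z'') := by
            rw [Multiset.cons_swap q p, Multiset.cons_swap q (hbar p)]
          rw [e1, Multiset.map_cons, Multiset.map_cons, hbar_hbar, Multiset.cons_swap] at hE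
          simpa only [Multiset.cons_inj_right] using hE)
      refine ⟨Ws, h1, ?_⟩
      rw [← h2, Multiset.map_cons, Multiset.prod_cons, Multiset.map_cons, Multiset.prod_cons, k2,
        ← mul_assoc, oval_join]

lemma phi_support [Fintype Q.A] (c : MvPolynomial Q.Var K) (m) (hm : m ∈ (Q.phi K c).support) :
    ∃ k : Q.Var →₀ ℕ, m = Q.rexp k := by
  by_contra hcon
  push Not at hcon
  have : ∀ c : MvPolynomial Q.Var K, coeff m (Q.phi K c) = 0 := by
    intro c
    induction c using MvPolynomial.induction_on' with
    | monomial k r => rw [phi_monomial, coeff_monomial, if_neg (hcon k).symm]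
    | add p q hp hq => rw [map_add, coeff_add, hp, hq, add_zero]
  exact mem_support_iff.1 hm (this c)

/-- M2 -/
lemma sl_lift [Fintype Q.A] [Fintype Q.V] [Infinite K] (c : MvPolynomial Q.Var K)
    (hc : ∀ g : Q.V → Matrix (Fin 2) (Fin 2) K, (∀ v, (g v).det = 1) →
      FFT.slact Q.dbl.tgt g (Q.phi K c) = Q.phi K c) :
    ∃ s ∈ Submodule.span K {G | ∃ Ws : Multiset (List (Q.A × Bool)),
      (∀ W ∈ Ws, Q.dbl.IsClosed W) ∧ G = (Ws.map (Q.wTr K)).prod}, Q.phi K c = Q.phi K s := by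
  have h := FFT.fft_sl (ν := Q.dbl.tgt) (Q.phi K c) hc {E | E.map hbar = E} (by
    intro m hm
    obtain ⟨k, rfl⟩ := Q.phi_support K c m hm
    rw [Set.mem_ofPred_eq, Prod.fst_sum]
    have : ∀ v, (Q.rexp k v • FFT.wt (Q.dbl.tgt) v).1 = Q.rexp k v • {v.1} := fun v => rfl
    simp only [this]
    rw [Fintype.sum_prod_type, Fintype.sum_prod_type]
    simp only [Fin.sum_univ_two, Fintype.sum_bool, (Q.rexp_apply k _).1, (Q.rexp_apply k _).2.1,
      (Q.rexp_apply k _).2.2.1, (Q.rexp_apply k _).2.2.2]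
    have hs : ∀ (f : Q.A → Multiset (Q.A × Bool)), (∑ a, f a).map hbar = ∑ a, (f a).map hbar :=
      fun f => map_sum (Multiset.mapAddMonoidHom hbar) f _
    rw [hs]
    refine Finset.sum_congr rfl fun a _ => ?_
    simp only [Multiset.map_add, Multiset.map_nsmul, Multiset.map_singleton]
    have e1 : hbar (a, true) = (a, false) := rfl
    have e2 : hbar (a, false) = (a, true) := rfl
    rw [e1, e2]
    module)
  have h2 : Q.phi K c ∈ (Submodule.span K {G | ∃ Ws : Multiset (List (Q.A × Bool)),
      (∀ W ∈ Ws, Q.dbl.IsClosed W) ∧ G = (Ws.map (Q.wTr K)).prod}).map (Q.phi K).toLinearMap := by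
    refine Submodule.span_le.2 ?_ h
    rintro G ⟨P, hP, hE, rfl⟩
    obtain ⟨Ws, h1, h2⟩ := Q.close_up K _ (P.map fun p => (p.1, [], p.2)) rfl
      (by
        intro z hz
        obtain ⟨p, hp, rfl⟩ := Multiset.mem_map.1 hz
        exact hP p hp)
      (by simpa [ends, Multiset.map_map, Function.comp_def] using hE)
    refine ⟨_, Submodule.subset_span ⟨Ws, h1, rfl⟩, ?_⟩
    rw [AlgHom.toLinearMap_apply, ← h2, Multiset.map_map]
    simp only [Function.comp_def, oval_nil]
  obtain ⟨s, hs, h3⟩ := h2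
  exact ⟨s, hs, h3.symm⟩

end QuiverData

namespace QuiverData
open MvPolynomial

lemma span_comp {σ M K : Type} [Field K] [AddCommMonoid M] (w : σ → M) (T : Set (MvPolynomial σ K))
    (hT : ∀ t ∈ T, ∃ m, IsWeightedHomogeneous w t m) (f : MvPolynomial σ K)
    (hf : f ∈ Submodule.span K T) (m : M) :
    weightedHomogeneousComponent w m f ∈
      Submodule.span K {t | t ∈ T ∧ IsWeightedHomogeneous w t m} := by
  induction hf using Submodule.span_induction with
  | mem x hx =>
    obtain ⟨m', hm'⟩ := hT x hx
    by_cases h : m' = m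
    · subst h
      rw [hm'.weightedHomogeneousComponent_same]
      exact Submodule.subset_span ⟨hx, hm'⟩
    · rw [hm'.weightedHomogeneousComponent_ne _ (Ne.symm h)]
      exact Submodule.zero_mem _
  | zero => rw [map_zero]; exact Submodule.zero_mem _
  | add x y _ _ hx hy => rw [map_add]; exact Submodule.add_mem _ hx hy
  | smul c x _ hx => rw [map_smul]; exact Submodule.smul_mem _ _ hx

variable (Q : QuiverData) (K : Type) [Field K] [CharP K 2]

/-- product of determinants -/
noncomputable def dtp (js : Multiset Q.A) : MvPolynomial Q.Var K := (js.map (Q.dt K)).prod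

/-- deformation -/
noncomputable def theta : MvPolynomial Q.Var K →ₐ[K] MvPolynomial Q.A (PV Q K) :=
  aeval fun v : Q.Var => C (Q.phi K (X v)) + if v.2 = (0, 0) then X v.1 else 0

lemma theta_gen (a : Q.A) (i j : Fin 2) : Q.theta K (Q.genMat K a i j) =
    C (Q.phi K (Q.genMat K a i j)) + if (i, j) = (0, 0) then X a else 0 := by
  refine (aeval_X _ _).trans ?_
  rfl

lemma theta_const (c : MvPolynomial Q.Var K) : constantCoeff (Q.theta K c) = Q.phi K c := by
  have : ((constantCoeff (σ := Q.A) (R := PV Q K))).comp (Q.theta K).toRingHom = (Q.phi K).toRingHom := by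
    apply MvPolynomial.ringHom_ext
    · intro r
      simp [theta, algebraMap_eq]
    · rintro ⟨a, i, j⟩
      change constantCoeff (Q.theta K (Q.genMat K a i j)) = Q.phi K (Q.genMat K a i j)
      rw [theta_gen]
      split_ifs <;> simp
  exact congrArg (fun F => F c) this

lemma theta_dt (a : Q.A) : Q.theta K (Q.dt K a) =
    monomial (Finsupp.single a 1) (Q.phi K (Q.genMat K a 1 1)) := by
  have h : Q.phi K (Q.dt K a) = 0 := Q.phi_dt K a
  rw [dt_eq] at h ⊢
  simp only [map_add, map_mul] at h ⊢
  have h2 := congrArg (C : PV Q K → MvPolynomial Q.A (PV Q K)) h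
  rw [theta_gen, theta_gen, theta_gen, theta_gen]
  rw [if_pos rfl, if_neg (by simp), if_neg (by simp), if_neg (by simp)]
  simp only [C_add, C_mul, C_0, add_zero] at h2 ⊢
  rw [add_mul, add_right_comm, h2, zero_add, X, mul_comm, C_mul_monomial, mul_one]

lemma phi_gen_ne (a : Q.A) (i j) : Q.phi K (Q.genMat K a i j) ≠ 0 := by
  rw [phi_X]
  exact mul_ne_zero (X_ne_zero _) (X_ne_zero _)

lemma theta_dtp (js : Multiset Q.A) : Q.theta K (Q.dtp K js) =
    monomial (Multiset.toFinsupp js) ((js.map fun a => Q.phi K (Q.genMat K a 1 1)).prod) := by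
  induction js using Multiset.induction_on with
  | empty => simp [dtp]
  | cons a js ih =>
    rw [dtp] at ih
    rw [dtp, Multiset.map_cons, Multiset.prod_cons, map_mul, ih, theta_dt, monomial_mul,
      Multiset.map_cons, Multiset.prod_cons, ← Multiset.singleton_add, map_add,
      Multiset.toFinsupp_singleton]

lemma dtp_indep (k : ℕ) (c : Multiset Q.A →₀ MvPolynomial Q.Var K)
    (hk : ∀ js ∈ c.support, Multiset.card js = k)
    (h0 : c.sum (fun js x => x * Q.dtp K js) = 0) (js : Multiset Q.A) : Q.phi K (c js) = 0 := by
  by_cases hjs : js ∈ c.support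
  swap
  · rw [Finsupp.notMem_support_iff.1 hjs, map_zero]
  have h := congrArg (fun F => coeff (Multiset.toFinsupp js) (Q.theta K F)) h0
  simp only [Finsupp.sum, map_sum, map_mul, theta_dtp, coeff_sum, coeff_mul_monomial', map_zero,
    coeff_zero] at h
  rw [Finset.sum_eq_single js] at h
  · rw [if_pos le_rfl, tsub_self] at h
    rcases mul_eq_zero.1 h with h | h
    · rw [← theta_const]; exact h
    · rw [Multiset.prod_eq_zero_iff, Multiset.mem_map] at h
      obtain ⟨a, _, ha⟩ := h
      exact absurd ha (Q.phi_gen_ne K a 1 1)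
  · intro js' hjs' hne
    rw [if_neg]
    intro hle
    apply hne
    have : js' ≤ js := Multiset.le_iff_count.2 fun a => by simpa using hle a
    exact Multiset.eq_of_le_of_card_le this (by rw [hk _ hjs, hk _ hjs'])
  · intro h; exact absurd hjs h

/-- filtration -/
noncomputable def Fil (k : ℕ) : Ideal (MvPolynomial Q.Var K) :=
  Ideal.span ((Q.dtp K) '' {js | Multiset.card js = k})

/-- the generators for SL -/
def slGens : Set (MvPolynomial Q.Var K) :=
  {G | ∃ (js : Multiset Q.A) (Ws : Multiset (List (Q.A × Bool))), (∀ W ∈ Ws, Q.dbl.IsClosed W) ∧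
    G = Q.dtp K js * (Ws.map (Q.wTr K)).prod}

lemma dt_slInv {g : Q.V → Matrix (Fin 2) (Fin 2) K} (hg : ∀ v, (g v).det = 1) (a : Q.A) :
    Q.actHom K g (Q.dt K a) = Q.dt K a := by
  have h2 : Q.actHom K g (Q.dt K a) = ((Q.genMat K a).map (Q.actHom K g)).det := by
    simp [dt, Matrix.det_fin_two]
  have hd : ∀ M : Matrix (Fin 2) (Fin 2) K, (Q.cmat K M).det = C M.det := fun M =>
    (RingHom.map_det (C : K →+* MvPolynomial Q.Var K) M).symm
  have hi : ((g (Q.src a))⁻¹).det = 1 := by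
    rw [Matrix.det_nonsing_inv, hg]; simp
  rw [h2, actHom_genMat, Matrix.det_mul, Matrix.det_mul, hd, hd, hg, hi, dt]
  simp

lemma dtp_slInv {g : Q.V → Matrix (Fin 2) (Fin 2) K} (hg : ∀ v, (g v).det = 1) (js : Multiset Q.A) :
    Q.actHom K g (Q.dtp K js) = Q.dtp K js := by
  rw [dtp, map_multiset_prod, Multiset.map_map]
  congr 1
  exact Multiset.map_congr rfl fun a _ => Q.dt_slInv K hg a

lemma slGens_slInv {g : Q.V → Matrix (Fin 2) (Fin 2) K} (hg : ∀ v, (g v).det = 1)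
    (s : MvPolynomial Q.Var K) (hs : s ∈ Submodule.span K (Q.slGens K)) :
    Q.actHom K g s = s := by
  induction hs using Submodule.span_induction with
  | mem x hx =>
    obtain ⟨js, Ws, hW, rfl⟩ := hx
    rw [map_mul, dtp_slInv _ _ hg, map_multiset_prod, Multiset.map_map]
    congr 2
    refine Multiset.map_congr rfl fun W hW' => ?_
    obtain ⟨u, _, hu⟩ := hW W hW'
    exact Q.wTr_slInv K hg hu
  | zero => rw [map_zero]
  | add x y _ _ hx hy => rw [map_add, hx, hy]
  | smul c x _ hx => rw [map_smul, hx]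

lemma I1_mul_dtp (c : MvPolynomial Q.Var K) (hc : c ∈ Q.I1 K) (js : Multiset Q.A) :
    c * Q.dtp K js ∈ Q.Fil K (Multiset.card js + 1) := by
  refine Submodule.span_induction (p := fun c _ => c * Q.dtp K js ∈ Q.Fil K (Multiset.card js + 1))
    ?_ ?_ ?_ ?_ hc
  · rintro _ ⟨a, rfl⟩
    refine Ideal.subset_span ⟨a ::ₘ js, by simp, ?_⟩
    simp [dtp]
  · rw [zero_mul]; exact Ideal.zero_mem _
  · intro x y _ _ hx hy; rw [add_mul]; exact Ideal.add_mem _ hx hy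
  · intro r x _ hx; rw [smul_eq_mul, mul_assoc]; exact Ideal.mul_mem_left _ _ hx

lemma sl_step [Fintype Q.A] [Fintype Q.V] [Infinite K] (k : ℕ) (f : MvPolynomial Q.Var K)
    (hf : ∀ g : Q.V → Matrix (Fin 2) (Fin 2) K, (∀ v, (g v).det = 1) → Q.actHom K g f = f)
    (hk : f ∈ Q.Fil K k) :
    ∃ s ∈ Submodule.span K (Q.slGens K), f - s ∈ Q.Fil K (k + 1) := by
  rw [Fil, Ideal.span, Finsupp.mem_span_image_iff_linearCombination] at hk
  obtain ⟨c, hc, rfl⟩ := hk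
  rw [Finsupp.mem_supported] at hc
  have hcard : ∀ js ∈ c.support, Multiset.card js = k := fun js hjs => hc hjs
  simp only [Finsupp.linearCombination_apply, smul_eq_mul] at hf ⊢
  have hinv : ∀ js, ∃ s ∈ Submodule.span K {G | ∃ Ws : Multiset (List (Q.A × Bool)),
      (∀ W ∈ Ws, Q.dbl.IsClosed W) ∧ G = (Ws.map (Q.wTr K)).prod}, Q.phi K (c js) = Q.phi K s := by
    intro js
    apply Q.sl_lift K
    intro g hg
    rw [← phi_act _ _ hg, ← sub_eq_zero, ← map_sub]
    have h := hf g hg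
    have h2 := Q.dtp_indep K k (c.mapRange (fun x => Q.actHom K g x - x) (by simp))
      (fun js hjs => hcard js (Finsupp.support_mapRange hjs))
      (by
        rw [Finsupp.sum_mapRange_index (by simp)]
        simp only [sub_mul]
        rw [Finsupp.sum_sub, sub_eq_zero]
        conv_rhs => rw [← h]
        simp only [Finsupp.sum, map_sum, map_mul, dtp_slInv _ _ hg]) js
    simpa using h2
  choose s hs1 hs2 using hinv
  refine ⟨c.sum fun js _ => s js * Q.dtp K js, ?_, ?_⟩
  · refine Submodule.sum_mem _ fun js _ => ?_
    have : ∀ x ∈ Submodule.span K {G | ∃ Ws : Multiset (List (Q.A × Bool)),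
      (∀ W ∈ Ws, Q.dbl.IsClosed W) ∧ G = (Ws.map (Q.wTr K)).prod},
      x * Q.dtp K js ∈ Submodule.span K (Q.slGens K) := by
      intro x hx
      induction hx using Submodule.span_induction with
      | mem x hx =>
        obtain ⟨Ws, hW, rfl⟩ := hx
        exact Submodule.subset_span ⟨js, Ws, hW, mul_comm _ _⟩
      | zero => rw [zero_mul]; exact Submodule.zero_mem _
      | add x y _ _ hx hy => rw [add_mul]; exact Submodule.add_mem _ hx hy
      | smul r x _ hx => rw [smul_mul_assoc]; exact Submodule.smul_mem _ _ hx
    exact this _ (hs1 js)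
  · rw [← Finsupp.sum_sub]
    refine Ideal.sum_mem _ fun js hjs => ?_
    simp only
    rw [← sub_mul, ← hcard js hjs]
    apply I1_mul_dtp
    apply Q.ker_phi K
    rw [map_sub, hs2, sub_self]

lemma sl_iter [Fintype Q.A] [Fintype Q.V] [Infinite K] (f : MvPolynomial Q.Var K)
    (hf : ∀ g : Q.V → Matrix (Fin 2) (Fin 2) K, (∀ v, (g v).det = 1) → Q.actHom K g f = f)
    (k : ℕ) : ∃ s ∈ Submodule.span K (Q.slGens K), f - s ∈ Q.Fil K k := by
  induction k with
  | zero =>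
    refine ⟨0, Submodule.zero_mem _, ?_⟩
    have : (1 : MvPolynomial Q.Var K) ∈ Q.Fil K 0 := Ideal.subset_span ⟨0, by simp, by simp [dtp]⟩
    rw [(Ideal.eq_top_iff_one _).2 this]
    trivial
  | succ k ih =>
    obtain ⟨s, hs, h⟩ := ih
    obtain ⟨s', hs', h'⟩ := Q.sl_step K k (f - s) (by
      intro g hg
      rw [map_sub, hf g hg, Q.slGens_slInv K hg s hs]) h
    exact ⟨s + s', Submodule.add_mem _ hs hs', by rwa [← sub_sub]⟩

lemma dtp_hom (js : Multiset Q.A) : (Q.dtp K js).IsHomogeneous (2 * Multiset.card js) := by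
  induction js using Multiset.induction_on with
  | empty => simpa [dtp] using isHomogeneous_one _ _
  | cons a js ih =>
    rw [dtp, Multiset.map_cons, Multiset.prod_cons, Multiset.card_cons, mul_add, add_comm]
    refine IsHomogeneous.mul ?_ ih
    have h := Q.genMat_hom K a
    rw [dt, Matrix.det_fin_two]
    exact ((h 0 0).mul (h 1 1)).sub ((h 0 1).mul (h 1 0))

lemma prod_hom {σ M ι : Type} [AddCommMonoid M] (w : σ → M) (Ws : Multiset ι)
    (f : ι → MvPolynomial σ K) (d : ι → M) (h : ∀ i ∈ Ws, IsWeightedHomogeneous w (f i) (d i)) :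
    IsWeightedHomogeneous w (Ws.map f).prod (Ws.map d).sum := by
  induction Ws using Multiset.induction_on with
  | empty => simpa using isWeightedHomogeneous_one K w
  | cons a Ws ih =>
    simp only [Multiset.map_cons, Multiset.prod_cons, Multiset.sum_cons]
    exact (h a (by simp)).mul (ih fun i hi => h i (Multiset.mem_cons_of_mem hi))

lemma sl_gen [Fintype Q.A] [Fintype Q.V] [Infinite K] (N : ℕ) (f : MvPolynomial Q.Var K)
    (hN : f.IsHomogeneous N)
    (hf : ∀ g : Q.V → Matrix (Fin 2) (Fin 2) K, (∀ v, (g v).det = 1) → Q.actHom K g f = f) :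
    f ∈ Submodule.span K (Q.slGens K) := by
  obtain ⟨s, hs, h⟩ := Q.sl_iter K f hf (N + 1)
  have h0 : ∀ x ∈ Q.Fil K (N + 1), weightedHomogeneousComponent (1 : Q.Var → ℕ) N x = 0 := by
    intro x hx
    rw [Fil, Ideal.span, Finsupp.mem_span_image_iff_linearCombination] at hx
    obtain ⟨c, hc, rfl⟩ := hx
    rw [Finsupp.mem_supported] at hc
    rw [Finsupp.linearCombination_apply, Finsupp.sum, map_sum]
    refine Finset.sum_eq_zero fun js hjs => ?_
    have hcard : Multiset.card js = N + 1 := hc hjs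
    ext m
    rw [coeff_weightedHomogeneousComponent, coeff_zero]
    split_ifs with hm
    · rw [smul_eq_mul, coeff_mul]
      refine Finset.sum_eq_zero fun p hp => ?_
      rw [Finset.HasAntidiagonal.mem_antidiagonal] at hp
      rw [(Q.dtp_hom K js).coeff_eq_zero, mul_zero]
      rw [← hp, map_add] at hm
      have : Finsupp.weight (1 : Q.Var → ℕ) p.2 = p.2.degree := by
        rw [Finsupp.degree_eq_weight_one]
        rfl
      rw [this] at hm
      rw [hcard]
      omega
    · rfl
  have h1 := h0 _ h
  rw [map_sub, sub_eq_zero] at h1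
  have h2 : weightedHomogeneousComponent (1 : Q.Var → ℕ) N f = f :=
    IsWeightedHomogeneous.weightedHomogeneousComponent_same hN
  rw [h2] at h1
  rw [h1]
  refine Submodule.span_mono ?_ (span_comp (1 : Q.Var → ℕ) (Q.slGens K) ?_ s hs N)
  · rintro x ⟨hx, _⟩; exact hx
  · rintro x ⟨js, Ws, hW, rfl⟩
    exact ⟨_, IsWeightedHomogeneous.mul (Q.dtp_hom K js)
      (prod_hom K _ Ws _ (fun W => W.length) fun W _ => Q.wTr_hom K W)⟩

end QuiverData

namespace QuiverData

variable (Q : QuiverData)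

/-- boundary -/
noncomputable def bd (a : Q.A) (u : Q.V) : ℤ :=
  (if Q.tgt a = u then 1 else 0) - (if Q.src a = u then 1 else 0)

/-- boundary of a multiset -/
noncomputable def bds (js : Multiset Q.A) (u : Q.V) : ℤ := (js.map fun a => Q.bd a u).sum

lemma bds_add (s t : Multiset Q.A) (u : Q.V) : Q.bds (s + t) u = Q.bds s u + Q.bds t u := by
  simp [bds]

lemma bds_path {u v : Q.V} {l : List Q.A} (h : Q.IsPathFrom u v l) (w : Q.V) :
    Q.bds (l : Multiset Q.A) w = (if v = w then 1 else 0) - (if u = w then 1 else 0) := by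
  induction l generalizing u with
  | nil => cases h; simp [bds]
  | cons a l ih =>
    obtain ⟨rfl, h2⟩ := h
    have := ih h2
    simp only [bds, Multiset.map_coe, Multiset.sum_coe, List.map_cons, List.sum_cons] at this ⊢
    rw [this, bd]
    ring

lemma bds_closed {l : List Q.A} (h : Q.IsClosed l) (w : Q.V) : Q.bds (l : Multiset Q.A) w = 0 := by
  obtain ⟨v, _, h⟩ := h
  rw [Q.bds_path h, sub_self]

/-- nodup list formulation of primitivity -/
def IsPrimL (l : List Q.A) : Prop := Q.IsClosed l ∧ (l.map Q.tgt).Nodup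

lemma exists_dup {α β : Type} (f : α → β) (l : List α) (h : ¬ (l.map f).Nodup) :
    ∃ A a B b C, l = A ++ a :: (B ++ b :: C) ∧ f a = f b := by
  induction l with
  | nil => simp at h
  | cons x l ih =>
    rw [List.map_cons, List.nodup_cons, not_and_or, not_not] at h
    rcases h with h | h
    · obtain ⟨b, hb, hb'⟩ := List.mem_map.1 h
      obtain ⟨B, C, rfl⟩ := List.append_of_mem hb
      exact ⟨[], x, B, b, C, rfl, hb'.symm⟩
    · obtain ⟨A, a, B, b, C, rfl, h'⟩ := ih h
      exact ⟨x :: A, a, B, b, C, rfl, h'⟩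

lemma sub_prim (N : ℕ) : ∀ (u v : Q.V) (l : List Q.A), l.length = N → Q.IsPathFrom u v l →
    ¬ (l.map Q.tgt).Nodup → ∃ A C B w, l = A ++ C ++ B ∧ A ≠ [] ∧ Q.IsPrimL C ∧
      Q.IsPathFrom w w C ∧ Q.IsPathFrom u w A ∧ Q.IsPathFrom w v B := by
  induction N using Nat.strong_induction_on with
  | _ N ih =>
  intro u v l hN hp hd
  obtain ⟨A, a, B, b, C, rfl, hab⟩ := exists_dup _ l hd
  rw [isPath_append] at hp
  obtain ⟨x, h1, h2, h3⟩ := hp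
  rw [isPath_append] at h3
  obtain ⟨y, h3, h4, h5⟩ := h3
  have hA : Q.IsPathFrom u (Q.tgt a) (A ++ [a]) := isPath_append.2 ⟨x, h1, h2, rfl⟩
  have hB : Q.IsPathFrom (Q.tgt a) (Q.tgt a) (B ++ [b]) := isPath_append.2 ⟨y, h3, h4, hab.symm⟩
  by_cases hn : ((B ++ [b]).map Q.tgt).Nodup
  · refine ⟨A ++ [a], B ++ [b], C, Q.tgt a, by simp, by simp, ⟨⟨_, by simp, hB⟩, hn⟩, hB, hA, ?_⟩
    rw [hab]; exact h5
  · obtain ⟨A', C', B', w, e, -, k1, k2, k3, k4⟩ := ih (B ++ [b]).length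
      (by rw [← hN]; simp; omega) _ _ _ rfl hB hn
    refine ⟨A ++ [a] ++ A', C', B' ++ C, w, ?_, by simp, k1, k2, isPath_append.2 ⟨_, hA, k3⟩,
      isPath_append.2 ⟨_, k4, by rw [hab]; exact h5⟩⟩
    have : A ++ a :: (B ++ b :: C) = A ++ [a] ++ (B ++ [b]) ++ C := by simp
    rw [this, e]; simp

lemma tgt_mem_of_path {u v : Q.V} {l : List Q.A} (h : Q.IsPathFrom u v l) (hl : l ≠ []) :
    ∃ a ∈ l, Q.tgt a = v := by
  induction l generalizing u with
  | nil => exact absurd rfl hl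
  | cons a l ih =>
    by_cases h' : l = []
    · subst h'; exact ⟨a, by simp, h.2⟩
    · obtain ⟨b, hb, hb'⟩ := ih h.2 h'
      exact ⟨b, by simp [hb], hb'⟩

/-- circulation contains a primitive closed path -/
lemma circ_prim [Fintype Q.V] (js : Multiset Q.A) (hne : js ≠ 0) (hb : ∀ u, Q.bds js u = 0) :
    ∃ l : List Q.A, Q.IsPrimL l ∧ (l : Multiset Q.A) ≤ js := by
  have hnext : ∀ a ∈ js, ∃ b ∈ js, Q.src b = Q.tgt a := by
    intro a ha
    by_contra hcon
    push Not at hcon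
    have h := hb (Q.tgt a)
    have h1 : ∀ b ∈ js, (0 : ℤ) ≤ Q.bd b (Q.tgt a) := by
      intro b hb
      rw [bd, if_neg (hcon b hb)]
      split_ifs <;> simp
    obtain ⟨t, rfl⟩ := Multiset.exists_cons_of_mem ha
    rw [bds, Multiset.map_cons, Multiset.sum_cons] at h
    have h2 : Q.bd a (Q.tgt a) = 1 := by rw [bd, if_pos rfl, if_neg (hcon a ha)]; simp
    have h3 : 0 ≤ (t.map fun b => Q.bd b (Q.tgt a)).sum := by
      apply Multiset.sum_nonneg
      intro x hx
      obtain ⟨b, hb, rfl⟩ := Multiset.mem_map.1 hx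
      exact h1 b (Multiset.mem_cons_of_mem hb)
    omega
  have hpath : ∀ k : ℕ, ∀ a ∈ js, ∃ (l : List Q.A) (v : Q.V), l.length = k ∧ (∀ b ∈ l, b ∈ js) ∧
      Q.IsPathFrom (Q.tgt a) v l := by
    intro k
    induction k with
    | zero => intro a ha; exact ⟨[], Q.tgt a, rfl, by simp, rfl⟩
    | succ k ih =>
      intro a ha
      obtain ⟨b, hb, hb'⟩ := hnext a ha
      obtain ⟨l, v, h1, h2, h3⟩ := ih b hb
      refine ⟨b :: l, v, by simp [h1], ?_, hb', h3⟩
      intro c hc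
      rcases List.mem_cons.1 hc with rfl | h
      · exact hb
      · exact h2 c h
  obtain ⟨a, ha⟩ := Multiset.exists_mem_of_ne_zero hne
  obtain ⟨l, v, h1, h2, h3⟩ := hpath (Fintype.card Q.V + 1) a ha
  have hn : ¬ (l.map Q.tgt).Nodup := by
    intro h
    have := h.length_le_card
    rw [List.length_map] at this
    omega
  obtain ⟨A, C, B, w, rfl, -, hC, -⟩ := Q.sub_prim _ _ _ l rfl h3 hn
  refine ⟨C, hC, ?_⟩
  rw [Multiset.le_iff_subset (Multiset.coe_nodup.2 (List.Nodup.of_map _ hC.2))]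
  intro x hx
  exact h2 x (by simp [Multiset.mem_coe.1 hx])

lemma circ_decomp [Fintype Q.V] (N : ℕ) : ∀ (js : Multiset Q.A), Multiset.card js = N →
    (∀ u, Q.bds js u = 0) → ∃ Ls : Multiset (List Q.A), (∀ l ∈ Ls, Q.IsPrimL l) ∧
      js = (Ls.map fun l : List Q.A => (l : Multiset Q.A)).sum := by
  induction N using Nat.strong_induction_on with
  | _ N ih =>
  intro js hN hb
  by_cases hne : js = 0
  · exact ⟨0, by simp, by simp [hne]⟩
  obtain ⟨l, hl, hle⟩ := Q.circ_prim js hne hb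
  obtain ⟨t, rfl⟩ := Multiset.le_iff_exists_add.1 hle
  have hlen : 0 < l.length := List.length_pos_iff.2 (by obtain ⟨v, h, _⟩ := hl.1; exact h)
  obtain ⟨Ls, h1, h2⟩ := ih (Multiset.card t) (by rw [← hN]; simp; omega) t rfl (by
    intro u
    have := hb u
    rwa [bds_add, Q.bds_closed hl.1, zero_add] at this)
  refine ⟨l ::ₘ Ls, ?_, by rw [Multiset.map_cons, Multiset.sum_cons, ← h2]⟩
  intro l' hl'
  rcases Multiset.mem_cons.1 hl' with rfl | h
  · exact hl
  · exact h1 _ h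

end QuiverData

namespace QuiverData

section lists
variable {H : Type}

/-- linear junction pairs -/
def lp : List H → Multiset (H × H)
  | [] => 0
  | [_] => 0
  | x :: y :: l => (x, y) ::ₘ lp (y :: l)

/-- cyclic junction pairs -/
def cyc : List H → Multiset (H × H)
  | [] => 0
  | x :: l => lp (x :: (l ++ [x]))

/-- head and last -/
def HL (y x : H) (W : List H) : Prop := (∃ B, W = y :: B) ∧ (∃ A, W = A ++ [x])

lemma lp_mid (A : List H) (x y : H) (B : List H) :
    lp (A ++ x :: y :: B) = lp (A ++ [x]) + (x, y) ::ₘ lp (y :: B) := by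
  induction A with
  | nil => simp [lp]
  | cons a A ih =>
    cases A with
    | nil => simp only [List.cons_append, List.nil_append, lp, Multiset.cons_add, zero_add]
    | cons b A =>
      simp only [List.cons_append, lp] at ih ⊢
      rw [ih, Multiset.cons_add]

lemma lp_append {y₁ x₁ y₂ x₂ : H} {U V : List H} (hU : HL y₁ x₁ U) (hV : HL y₂ x₂ V) :
    lp (U ++ V) = lp U + (x₁, y₂) ::ₘ lp V := by
  obtain ⟨-, A, rfl⟩ := hU
  obtain ⟨⟨B, rfl⟩, -⟩ := hV
  rw [← lp_mid]; simp

lemma HL_append {y₁ x₁ y₂ x₂ : H} {U V : List H} (hU : HL y₁ x₁ U) (hV : HL y₂ x₂ V) :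
    HL y₁ x₂ (U ++ V) := by
  obtain ⟨⟨B, rfl⟩, -⟩ := hU
  obtain ⟨-, A, rfl⟩ := hV
  exact ⟨⟨B ++ (A ++ [x₂]), by simp⟩, ⟨y₁ :: B ++ A, by simp⟩⟩

lemma HL_cyc {y x : H} {W : List H} (h : HL y x W) : cyc W = (x, y) ::ₘ lp W := by
  obtain ⟨⟨B, rfl⟩, A, hA⟩ := h
  have : lp (y :: (B ++ [y])) = lp (A ++ x :: y :: []) := by
    rw [← List.cons_append, hA]; simp
  rw [cyc, this, lp_mid, ← hA]
  simp [lp, ← Multiset.singleton_add, add_comm]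

lemma HL_exists {W : List H} (h : W ≠ []) : ∃ y x, HL y x W := by
  obtain ⟨y, B, rfl⟩ := List.exists_cons_of_ne_nil h
  refine ⟨y, (y :: B).getLast h, ⟨B, rfl⟩, (y :: B).dropLast, ?_⟩
  rw [List.dropLast_append_getLast]

lemma lp_mem {W : List H} {x y : H} (h : (x, y) ∈ lp W) : ∃ P R, W = P ++ x :: y :: R := by
  induction W with
  | nil => simp [lp] at h
  | cons a W ih =>
    cases W with
    | nil => simp [lp] at h
    | cons b W =>
      rw [lp, Multiset.mem_cons] at h
      rcases h with h | h
      · obtain ⟨rfl, rfl⟩ := Prod.mk.inj h; exact ⟨[], W, rfl⟩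
      · obtain ⟨P, R, e⟩ := ih h
        exact ⟨a :: P, R, by rw [e]; rfl⟩

lemma lp_split {W : List H} {x y x₂ y₂ : H} (hW : HL y x W) (h : (x₂, y₂) ∈ lp W) :
    ∃ U V, W = U ++ V ∧ HL y x₂ U ∧ HL y₂ x V := by
  obtain ⟨P, R, rfl⟩ := lp_mem h
  obtain ⟨⟨B, hB⟩, A, hA⟩ := hW
  refine ⟨P ++ [x₂], y₂ :: R, by simp, ⟨?_, P, rfl⟩, ⟨R, rfl⟩, ?_⟩
  · cases P with
    | nil => simp at hB; exact ⟨[], by simp [hB.1]⟩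
    | cons p P => simp at hB; exact ⟨P ++ [x₂], by simp [hB.1]⟩
  · rcases List.eq_nil_or_concat R with rfl | ⟨R', r, rfl⟩
    · have := congrArg List.getLast? hA
      simp at this
      exact ⟨[], by simp [this]⟩
    · have := congrArg List.getLast? hA
      rw [List.concat_eq_append, ← List.cons_append, ← List.cons_append, ← List.append_assoc,
        List.getLast?_concat, List.getLast?_concat] at this
      exact ⟨y₂ :: R', by simpa using this⟩

/-- rotation to a junction -/
lemma cyc_mem {W : List H} {x y : H} (h : (x, y) ∈ cyc W) :
    ∃ U V, W = U ++ V ∧ HL y x (V ++ U) ∧ cyc (V ++ U) = cyc W := by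
  have hne : W ≠ [] := by rintro rfl; simp [cyc] at h
  obtain ⟨y₁, x₁, hW⟩ := HL_exists hne
  rw [HL_cyc hW, Multiset.mem_cons] at h
  rcases h with h | h
  · obtain ⟨rfl, rfl⟩ := Prod.mk.inj h
    exact ⟨[], W, rfl, by simpa using hW, by simp⟩
  · obtain ⟨U, V, rfl, hU, hV⟩ := lp_split hW h
    refine ⟨U, V, rfl, HL_append hV hU, ?_⟩
    rw [HL_cyc (HL_append hV hU), HL_cyc hW, lp_append hV hU, lp_append hU hV]
    simp only [← Multiset.singleton_add]
    abel

end lists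

variable {Q : QuiverData}

lemma HL_wrev {y x : Q.A × Bool} {W : List (Q.A × Bool)} (h : HL y x W) :
    HL (hbar x) (hbar y) (wrev W) := by
  obtain ⟨⟨B, hB⟩, A, hA⟩ := h
  refine ⟨⟨wrev A, ?_⟩, ⟨wrev B, ?_⟩⟩
  · rw [hA]; simp [wrev]
  · rw [hB]; simp [wrev]

/-- sink pair -/
def isTF (p : (Q.A × Bool) × (Q.A × Bool)) : Prop := p.1.2 = true ∧ p.2.2 = false

/-- number of sinks -/
noncomputable def lsk (W : List (Q.A × Bool)) : ℕ := (lp W).countP isTF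
/-- number of sinks, cyclic -/
noncomputable def sk (W : List (Q.A × Bool)) : ℕ := (cyc W).countP isTF

lemma lsk_append {y₁ x₁ y₂ x₂ : Q.A × Bool} {U V : List (Q.A × Bool)} (hU : HL y₁ x₁ U)
    (hV : HL y₂ x₂ V) : lsk (U ++ V) = lsk U + lsk V + (if isTF (x₁, y₂) then 1 else 0) := by
  rw [lsk, lp_append hU hV, Multiset.countP_add, Multiset.countP_cons, lsk, lsk, add_assoc]

lemma sk_eq {y x : Q.A × Bool} {W : List (Q.A × Bool)} (h : HL y x W) :
    sk W = lsk W + (if isTF (x, y) then 1 else 0) := by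
  rw [sk, HL_cyc h, Multiset.countP_cons, lsk]

lemma lsk_wrev (W : List (Q.A × Bool)) : lsk (wrev W) = lsk W := by
  induction W with
  | nil => rfl
  | cons a W ih =>
    cases W with
    | nil => simp [wrev, lsk, lp]
    | cons b W =>
      have e : wrev (a :: b :: W) = wrev (b :: W) ++ [hbar a] := by simp [wrev]
      obtain ⟨y, x, h⟩ := HL_exists (W := b :: W) (by simp)
      have hb : y = b := by obtain ⟨⟨B, hB⟩, -⟩ := h; simp at hB; exact hB.1.symm
      subst hb
      have h1 : HL a a [a] := ⟨⟨[], rfl⟩, [], rfl⟩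
      have h2 : HL (hbar a) (hbar a) [hbar a] := ⟨⟨[], rfl⟩, [], rfl⟩
      rw [e, lsk_append (HL_wrev h) h2, ih, show a :: y :: W = [a] ++ (y :: W) from rfl,
        lsk_append h1 h]
      have : isTF (hbar y, hbar a) ↔ isTF (a, y) := by
        simp [isTF, hbar, and_comm]
      simp only [this]
      simp [lsk, lp]

/-- source half-edge -/
noncomputable def hs (w : Q.V) (x : Q.A × Bool) : ℤ :=
  (if x.2 then -1 else 1) * (if Q.dbl.src x = w then 1 else 0)
/-- target half-edge -/
noncomputable def ht (w : Q.V) (x : Q.A × Bool) : ℤ :=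
  (if x.2 then 1 else -1) * (if Q.dbl.tgt x = w then 1 else 0)

lemma hs_ht (w : Q.V) (x : Q.A × Bool) : hs w x + ht w x = Q.bd x.1 w := by
  obtain ⟨a, b⟩ := x
  cases b <;> simp [hs, ht, bd] <;> split_ifs <;> simp

/-- junction contribution -/
noncomputable def jc (w : Q.V) (p : (Q.A × Bool) × (Q.A × Bool)) : ℤ :=
  ht w p.1 + hs w p.2

/-- total boundary of a word -/
noncomputable def wbd (W : List (Q.A × Bool)) (w : Q.V) : ℤ := (W.map fun x => Q.bd x.1 w).sum

lemma lp_sum (w : Q.V) {y x : Q.A × Bool} {W : List (Q.A × Bool)} (h : HL y x W) :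
    ((lp W).map (jc w)).sum = wbd W w - hs w y - ht w x := by
  induction W generalizing y with
  | nil => obtain ⟨⟨B, hB⟩, -⟩ := h; simp at hB
  | cons a W ih =>
    have ha : y = a := by obtain ⟨⟨B, hB⟩, -⟩ := h; simp at hB; exact hB.1.symm
    subst ha
    cases W with
    | nil =>
      have hb : y = x := by
        obtain ⟨-, A, hA⟩ := h
        have := congrArg List.getLast? hA
        simpa using this
      subst hb
      simp [lp, wbd, ← hs_ht]
    | cons b W =>
      have hb : HL b x (b :: W) := by
        refine ⟨⟨W, rfl⟩, ?_⟩
        obtain ⟨-, A, hA⟩ := h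
        cases A with
        | nil => simp at hA
        | cons c A => simp at hA; exact ⟨A, hA.2⟩
      rw [lp, Multiset.map_cons, Multiset.sum_cons, ih hb, jc, wbd, wbd]
      simp only [List.map_cons, List.sum_cons, ← hs_ht]
      ring

lemma cyc_sum (w : Q.V) {W : List (Q.A × Bool)} (h : W ≠ []) :
    ((cyc W).map (jc w)).sum = wbd W w := by
  obtain ⟨y, x, hW⟩ := HL_exists h
  rw [HL_cyc hW, Multiset.map_cons, Multiset.sum_cons, lp_sum w hW, jc]
  ring

lemma lp_inc {u v : Q.V} {W : List (Q.A × Bool)} (h : Q.dbl.IsPathFrom u v W) :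
    ∀ p ∈ lp W, Q.dbl.tgt p.1 = Q.dbl.src p.2 := by
  rintro ⟨x, y⟩ hp
  obtain ⟨P, R, rfl⟩ := lp_mem hp
  obtain ⟨z, -, h1, h2, h3⟩ := isPath_append.1 h
  exact h2.symm

lemma HL_path {u v : Q.V} {y x : Q.A × Bool} {W : List (Q.A × Bool)} (h : Q.dbl.IsPathFrom u v W)
    (hW : HL y x W) : Q.dbl.src y = u ∧ Q.dbl.tgt x = v := by
  obtain ⟨⟨B, rfl⟩, A, hA⟩ := hW
  refine ⟨h.1, ?_⟩
  rw [hA] at h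
  obtain ⟨z, _, h1, h2⟩ := isPath_append.1 h
  exact h2

lemma cyc_inc {u : Q.V} {W : List (Q.A × Bool)} (h : Q.dbl.IsClosedAt u W) :
    ∀ p ∈ cyc W, Q.dbl.tgt p.1 = Q.dbl.src p.2 := by
  obtain ⟨y, x, hW⟩ := HL_exists h.1
  rw [HL_cyc hW]
  intro p hp
  rcases Multiset.mem_cons.1 hp with rfl | hp
  · have := HL_path h.2 hW
    exact this.2.trans this.1.symm
  · exact lp_inc h.2 p hp

lemma jc_eq (w : Q.V) (p : (Q.A × Bool) × (Q.A × Bool)) (h : Q.dbl.tgt p.1 = Q.dbl.src p.2) :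
    jc w p = if Q.dbl.src p.2 = w then
      (if isTF p then 2 else if (p.1.2 = false ∧ p.2.2 = true) then -2 else 0) else 0 := by
  obtain ⟨x, y⟩ := p
  change Q.dbl.tgt x = Q.dbl.src y at h
  rw [jc, ht, hs, isTF]
  by_cases hw : Q.dbl.src y = w
  · have hx : Q.dbl.tgt x = w := h.trans hw
    rw [if_pos (show Q.dbl.tgt (x, y).1 = w from hx), if_pos (show Q.dbl.src (x, y).2 = w from hw),
      if_pos (show Q.dbl.src (x, y).2 = w from hw)]
    rcases x with ⟨a, _ | _⟩ <;> rcases y with ⟨b, _ | _⟩ <;> simp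
  · have hx : ¬ Q.dbl.tgt x = w := fun hh => hw (h.symm.trans hh)
    rw [if_neg (show ¬ Q.dbl.tgt (x, y).1 = w from hx),
      if_neg (show ¬ Q.dbl.src (x, y).2 = w from hw),
      if_neg (show ¬ Q.dbl.src (x, y).2 = w from hw)]
    simp

/-- a word without sinks is monochrome -/
lemma mono_true {l : List (Q.A × Bool)} (h : lsk l = 0) {y x : Q.A × Bool} (hl : HL y x l)
    (hy : y.2 = true) : ∀ z ∈ l, z.2 = true := by
  induction l generalizing y with
  | nil => simp
  | cons a l ih =>
    have ha : y = a := by obtain ⟨⟨B, hB⟩, -⟩ := hl; simp at hB; exact hB.1.symm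
    subst ha
    cases l with
    | nil => simpa using hy
    | cons b l =>
      rw [lsk, lp, Multiset.countP_cons] at h
      have h1 : lsk (b :: l) = 0 := by rw [lsk]; omega
      have h2 : ¬ isTF (y, b) := by intro hh; rw [if_pos hh] at h; omega
      have hb : b.2 = true := by
        by_contra hc
        exact h2 ⟨hy, by simpa using hc⟩
      have hb' : HL b x (b :: l) := by
        refine ⟨⟨l, rfl⟩, ?_⟩
        obtain ⟨-, A, hA⟩ := hl
        cases A with
        | nil => simp at hA
        | cons c A => simp at hA; exact ⟨A, hA.2⟩
      intro z hz
      rcases List.mem_cons.1 hz with rfl | hz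
      · exact hy
      · exact ih h1 hb' hb z hz

lemma mono {W : List (Q.A × Bool)} (h : sk W = 0) :
    (∀ z ∈ W, z.2 = true) ∨ (∀ z ∈ W, z.2 = false) := by
  by_cases hT : ∃ z ∈ W, z.2 = true
  · left
    obtain ⟨z, hz, hzt⟩ := hT
    obtain ⟨U, V, rfl⟩ := List.append_of_mem hz
    have hrot : sk ((z :: V) ++ U) = 0 := by
      cases U with
      | nil => simpa using h
      | cons u U =>
        obtain ⟨y₁, x₁, h1⟩ := HL_exists (W := u :: U) (by simp)
        obtain ⟨y₂, x₂, h2⟩ := HL_exists (W := z :: V) (by simp)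
        rw [sk_eq (HL_append h1 h2), lsk_append h1 h2] at h
        rw [sk_eq (HL_append h2 h1), lsk_append h2 h1]
        omega
    obtain ⟨y, x, hW⟩ := HL_exists (W := (z :: V) ++ U) (by simp)
    have hy : y = z := by obtain ⟨⟨B, hB⟩, -⟩ := hW; simp at hB; exact hB.1.symm
    subst hy
    rw [sk_eq hW] at hrot
    have := mono_true (by omega) hW hzt
    intro w hw
    apply this
    simp at hw ⊢
    tauto
  · right
    push Not at hT
    intro z hz
    simpa using hT z hz

end QuiverData

namespace QuiverData
open MvPolynomial

section conv
variable (Q : QuiverData) (K : Type) [Field K]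

/-- products of traces and determinants of closed paths -/
def pathGens : Set (MvPolynomial Q.Var K) :=
  {G | ∃ Ls Cs : Multiset (List Q.A), (∀ l ∈ Ls, Q.IsClosed l) ∧ (∀ l ∈ Cs, Q.IsPrimL l) ∧
    G = (Ls.map (Q.pathTr K)).prod * (Cs.map (Q.pathDet K)).prod}

variable {Q}

lemma wbd_append (U V : List (Q.A × Bool)) (w : Q.V) : wbd (U ++ V) w = wbd U w + wbd V w := by
  simp [wbd]

lemma wbd_wrev (U : List (Q.A × Bool)) (w : Q.V) : wbd (wrev U) w = wbd U w := by
  simp [wbd, wrev, List.map_reverse, Function.comp_def, hbar]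

/-- rotation of a closed word -/
lemma rot_closed {Q : QuiverData} {U V : List Q.A} (h : Q.IsClosed (U ++ V)) : Q.IsClosed (V ++ U) := by
  obtain ⟨w, hne, hp⟩ := h
  obtain ⟨z, h1, h2⟩ := isPath_append.1 hp
  refine ⟨z, ?_, isPath_append.2 ⟨w, h2, h1⟩⟩
  simp only [ne_eq, List.append_eq_nil_iff] at hne ⊢
  tauto

lemma HL_ne {H : Type} {y x : H} {W : List H} (h : HL y x W) : W ≠ [] := by
  obtain ⟨⟨B, rfl⟩, -⟩ := h; simp

lemma HL_closed {y x : Q.A × Bool} {W : List (Q.A × Bool)} (h : Q.dbl.IsClosed W)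
    (hW : HL y x W) : Q.dbl.IsPathFrom (Q.dbl.src y) (Q.dbl.src y) W ∧ Q.dbl.tgt x = Q.dbl.src y := by
  obtain ⟨w, _, hp⟩ := h
  obtain ⟨h1, h2⟩ := HL_path hp hW
  rw [h1]
  exact ⟨hp, h2⟩

lemma wbd_nonneg {W : List (Q.A × Bool)} (h : Q.dbl.IsClosed W) (u : Q.V)
    (hs : ∀ p ∈ cyc W, Q.dbl.src p.2 = u → ¬ (p.1.2 = false ∧ p.2.2 = true)) : 0 ≤ wbd W u := by
  obtain ⟨w, hc⟩ := h
  rw [← cyc_sum u hc.1]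
  apply Multiset.sum_nonneg
  intro z hz
  obtain ⟨p, hp, rfl⟩ := Multiset.mem_map.1 hz
  rw [jc_eq u p (cyc_inc hc p hp)]
  have := hs p hp
  split_ifs <;> simp_all

lemma wbd_pos {W : List (Q.A × Bool)} (h : Q.dbl.IsClosed W) (u : Q.V) {y x : Q.A × Bool}
    (hW : HL y x W) (hy : Q.dbl.src y = u) (htf : isTF (x, y))
    (hs : ∀ p ∈ cyc W, Q.dbl.src p.2 = u → ¬ (p.1.2 = false ∧ p.2.2 = true)) : 0 < wbd W u := by
  obtain ⟨w, hc⟩ := h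
  have hi := cyc_inc hc
  rw [← cyc_sum u hc.1]
  rw [HL_cyc hW] at hs hi ⊢
  rw [Multiset.map_cons, Multiset.sum_cons, jc_eq u _ (hi _ (Multiset.mem_cons_self _ _)),
    if_pos hy, if_pos htf]
  have : 0 ≤ ((lp W).map (jc u)).sum := by
    apply Multiset.sum_nonneg
    intro z hz
    obtain ⟨p, hp, rfl⟩ := Multiset.mem_map.1 hz
    rw [jc_eq u p (hi p (Multiset.mem_cons_of_mem hp))]
    have := hs p (Multiset.mem_cons_of_mem hp)
    split_ifs <;> simp_all
  omega

lemma dtp_list (l : List Q.A) : Q.dtp K (l : Multiset Q.A) = Q.pathDet K l := by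
  induction l with
  | nil => simp [dtp, pathDet, pathMat_eq]
  | cons a l ih =>
    rw [pathDet, pathMat_eq, mprod_cons, Matrix.det_mul, ← pathMat_eq]
    rw [← Multiset.cons_coe, dtp, Multiset.map_cons, Multiset.prod_cons]
    rw [dtp, pathDet] at ih
    rw [ih, mul_comm]; rfl

lemma dtp_sum (Ls : Multiset (List Q.A)) :
    Q.dtp K (Ls.map fun l : List Q.A => (l : Multiset Q.A)).sum = (Ls.map (Q.pathDet K)).prod := by
  induction Ls using Multiset.induction_on with
  | empty => simp [dtp]
  | cons l Ls ih =>
    rw [Multiset.map_cons, Multiset.sum_cons, Multiset.map_cons, Multiset.prod_cons, ← ih, ← dtp_list]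
    simp [dtp]

lemma dbl_true_path {u v : Q.V} {l : List Q.A} :
    Q.dbl.IsPathFrom u v (l.map fun a => (a, true)) ↔ Q.IsPathFrom u v l := by
  induction l generalizing u with
  | nil => exact Iff.rfl
  | cons a l ih => rw [List.map_cons, isPath_cons, isPath_cons, ih]; rfl

lemma mono_path {W : List (Q.A × Bool)} (hc : Q.dbl.IsClosed W) (h : sk W = 0) :
    ∃ l, Q.IsClosed l ∧ Q.wTr K W = Q.pathTr K l ∧ ∀ u, wbd W u = 0 := by
  have key : ∀ W : List (Q.A × Bool), Q.dbl.IsClosed W → (∀ z ∈ W, z.2 = true) →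
      ∃ l, Q.IsClosed l ∧ Q.wTr K W = Q.pathTr K l ∧ ∀ u, wbd W u = 0 := by
    intro W hc hT
    have hW : W = (W.map Prod.fst).map fun a => (a, true) := by
      rw [List.map_map]
      conv_lhs => rw [← List.map_id W]
      apply List.map_congr_left
      intro z hz
      exact Prod.ext rfl (hT z hz)
    generalize W.map Prod.fst = l at hW
    subst hW
    obtain ⟨w, hne, hp⟩ := hc
    have hcl : Q.IsClosed l := ⟨w, by simpa using hne, dbl_true_path.1 hp⟩
    refine ⟨l, hcl, ?_, ?_⟩
    · rw [wTr, wMat_true, pathTr]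
    · intro u
      rw [← Q.bds_closed hcl u]
      simp [wbd, bds, Function.comp_def]
  rcases mono h with hT | hF
  · exact key W hc hT
  · have h2 : Q.dbl.IsClosed (wrev W) := by
      obtain ⟨w, hne, hp⟩ := hc
      exact ⟨w, by simpa [wrev] using hne, Q.wrev_path hp⟩
    obtain ⟨l, h3, h4, h5⟩ := key (wrev W) h2 (by
      intro z hz
      simp only [wrev, List.mem_reverse, List.mem_map] at hz
      obtain ⟨z', hz', rfl⟩ := hz
      simp [hbar, hF z' hz'])
    exact ⟨l, h3, by rw [← h4, wTr_wrev], fun u => by rw [← h5 u, wbd_wrev]⟩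

/-- balance condition -/
def Bal (js : Multiset Q.A) (Ws : Multiset (List (Q.A × Bool))) : Prop :=
  ∀ u, 2 * Q.bds js u + (Ws.map (fun W => wbd W u)).sum = 0

lemma conv_term [Fintype Q.V] (js : Multiset Q.A) (Ws : Multiset (List (Q.A × Bool)))
    (h0 : ∀ W ∈ Ws, sk W = 0) (hc : ∀ W ∈ Ws, Q.dbl.IsClosed W) (hb : Bal js Ws) :
    Q.dtp K js * (Ws.map (Q.wTr K)).prod ∈ Q.pathGens K := by
  have h1 : ∀ u, (Ws.map (fun W => wbd W u)).sum = 0 := by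
    intro u
    apply Multiset.sum_eq_zero
    intro z hz
    obtain ⟨W, hW, rfl⟩ := Multiset.mem_map.1 hz
    exact (mono_path K (hc W hW) (h0 W hW)).choose_spec.2.2 u
  have h2 : ∀ u, Q.bds js u = 0 := by
    intro u
    have := hb u
    rw [h1] at this
    omega
  obtain ⟨Cs, hC, rfl⟩ := Q.circ_decomp _ js rfl h2
  have h3 : ∃ Ls : Multiset (List Q.A), (∀ l ∈ Ls, Q.IsClosed l) ∧
      (Ws.map (Q.wTr K)).prod = (Ls.map (Q.pathTr K)).prod := by
    clear hb h1 h2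
    induction Ws using Multiset.induction_on with
    | empty => exact ⟨0, by simp, by simp⟩
    | cons W Ws ih =>
      obtain ⟨Ls, a1, a2⟩ := ih (fun W hW => h0 W (Multiset.mem_cons_of_mem hW))
        (fun W hW => hc W (Multiset.mem_cons_of_mem hW))
      obtain ⟨l, b1, b2, -⟩ := mono_path K (hc W (Multiset.mem_cons_self _ _))
        (h0 W (Multiset.mem_cons_self _ _))
      refine ⟨l ::ₘ Ls, ?_, ?_⟩
      · intro l' hl'
        rcases Multiset.mem_cons.1 hl' with rfl | h
        · exact b1
        · exact a1 _ h
      · simp [a2, b2]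
  obtain ⟨Ls, a1, a2⟩ := h3
  exact ⟨Ls, Cs, a1, hC, by rw [a2, dtp_sum, mul_comm]⟩

end conv
end QuiverData

namespace QuiverData
open MvPolynomial

section conv
variable {Q : QuiverData} (K : Type) [Field K]

lemma closed_app {u : Q.V} {U V : List (Q.A × Bool)} (hU : U ≠ [])
    (h1 : Q.dbl.IsPathFrom u u U) (h2 : Q.dbl.IsPathFrom u u V) : Q.dbl.IsClosed (U ++ V) :=
  ⟨u, by simp [hU], isPath_append.2 ⟨u, h1, h2⟩⟩

lemma wTr_dt (W : List (Q.A × Bool)) (a : Q.A) :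
    Q.wTr K (W ++ [(a, true), (a, false)]) = Q.dt K a * Q.wTr K W := by
  have : Q.wMat K [(a, true), (a, false)] = (Q.dt K a) • 1 := by
    rw [wMat, mprod_cons, mprod_singleton]
    exact Matrix.adjugate_mul _
  rw [wTr, wMat_append, this, Matrix.smul_mul, one_mul, Matrix.trace_smul, wTr, smul_eq_mul]

lemma conv_gen [Fintype Q.V] (N : ℕ) : ∀ (k : ℕ) (js : Multiset Q.A)
    (Ws : Multiset (List (Q.A × Bool))), (Ws.map sk).sum = N → Multiset.card js = k →
    (∀ W ∈ Ws, Q.dbl.IsClosed W) → Bal js Ws →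
    Q.dtp K js * (Ws.map (Q.wTr K)).prod ∈ Submodule.span K (Q.pathGens K) := by
  induction N using Nat.strong_induction_on with
  | _ N ihN =>
  intro k
  induction k using Nat.strong_induction_on with
  | _ k ihk =>
  intro js Ws hN hk hc hb
  by_cases h0 : ∀ W ∈ Ws, sk W = 0
  · exact Submodule.subset_span (conv_term K js Ws h0 hc hb)
  push Not at h0
  obtain ⟨W₀, hW₀, hsk⟩ := h0
  obtain ⟨R, rfl⟩ := Multiset.exists_cons_of_mem hW₀
  obtain ⟨⟨x, y⟩, hp, htf⟩ := Multiset.countP_pos.1 (Nat.pos_of_ne_zero hsk)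
  obtain ⟨U, V, rfl, hHL, hcyc⟩ := cyc_mem hp
  have hclW : Q.dbl.IsClosed (V ++ U) := rot_closed (hc _ (Multiset.mem_cons_self _ _))
  have hTr : Q.wTr K (U ++ V) = Q.wTr K (V ++ U) := Q.wTr_comm K U V
  have hskW : sk (U ++ V) = sk (V ++ U) := by rw [sk, sk, hcyc]
  have hbdW : ∀ u, wbd (U ++ V) u = wbd (V ++ U) u := fun u => by
    rw [wbd_append, wbd_append, add_comm]
  have hcR : ∀ W ∈ R, Q.dbl.IsClosed W := fun W hW => hc W (Multiset.mem_cons_of_mem hW)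
  rw [Multiset.map_cons, Multiset.sum_cons, hskW] at hN
  rw [Multiset.map_cons, Multiset.prod_cons, hTr]
  have hb' : Bal js ((V ++ U) ::ₘ R) := by
    intro u
    have := hb u
    rw [Multiset.map_cons, Multiset.sum_cons] at this ⊢
    rw [← hbdW]; exact this
  clear hb hc hW₀ hskW hbdW hTr hcyc hsk hp
  generalize V ++ U = W at *
  clear U V
  obtain ⟨hWp, hxy⟩ := HL_closed hclW hHL
  have hx : x.2 = true := htf.1
  have hy : y.2 = false := htf.2
  have nTF1 : ∀ p : (Q.A × Bool) × (Q.A × Bool), p.1.2 = false → ¬ isTF p := by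
    intro p hp h; rw [isTF, hp] at h; simp at h
  have nTF2 : ∀ p : (Q.A × Bool) × (Q.A × Bool), p.2.2 = true → ¬ isTF p := by
    intro p hp h; rw [isTF, hp] at h; simp at h
  have hskW := sk_eq hHL
  rw [if_pos htf] at hskW
  by_cases hA : ∃ p ∈ lp W, Q.dbl.src p.2 = Q.dbl.src y ∧ p.1.2 = false ∧ p.2.2 = true
  · obtain ⟨⟨x₂, y₂⟩, hp, hs, hx2, hy2⟩ := hA
    change Q.dbl.src y₂ = Q.dbl.src y at hs
    change x₂.2 = false at hx2
    change y₂.2 = true at hy2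
    obtain ⟨B₁, B₂, rfl, h1, h2⟩ := lp_split hHL hp
    rw [lsk_append h1 h2, if_neg (nTF1 _ hx2)] at hskW
    obtain ⟨z, p1, p2⟩ := isPath_append.1 hWp
    have hz : z = Q.dbl.src y := by rw [← hs]; exact (HL_path p2 h2).1.symm
    subst hz
    have s1 := sk_eq h1
    rw [if_neg (nTF1 _ hx2)] at s1
    have s2 := sk_eq h2
    rw [if_neg (nTF2 _ hy2)] at s2
    have h3 := HL_wrev h2
    have s3 := sk_eq (HL_append h1 h3)
    rw [lsk_append h1 h3, lsk_wrev, if_neg (nTF1 _ hx2),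
      if_neg (nTF1 _ (by simp [hbar, hy2]))] at s3
    have e1 : Q.wTr K (B₁ ++ B₂) = Q.wTr K B₁ * Q.wTr K B₂ - Q.wTr K (B₁ ++ wrev B₂) := by
      rw [wTr_mul]; ring
    have e2 : Q.dtp K js * (Q.wTr K (B₁ ++ B₂) * (R.map (Q.wTr K)).prod) =
      Q.dtp K js * ((B₁ ::ₘ B₂ ::ₘ R).map (Q.wTr K)).prod -
      Q.dtp K js * (((B₁ ++ wrev B₂) ::ₘ R).map (Q.wTr K)).prod := by
      rw [e1]; simp only [Multiset.map_cons, Multiset.prod_cons]; ring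
    rw [e2]
    refine Submodule.sub_mem _ ?_ ?_
    · refine ihN _ ?_ _ js _ rfl rfl ?_ ?_
      · simp only [Multiset.map_cons, Multiset.sum_cons]; omega
      · intro W hW
        rcases Multiset.mem_cons.1 hW with rfl | hW
        · exact ⟨_, HL_ne h1, p1⟩
        rcases Multiset.mem_cons.1 hW with rfl | hW
        · exact ⟨_, HL_ne h2, p2⟩
        · exact hcR W hW
      · intro u
        have := hb' u
        simp only [Multiset.map_cons, Multiset.sum_cons, wbd_append] at this ⊢
        rw [← this]; ring
    · refine ihN _ ?_ _ js _ rfl rfl ?_ ?_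
      · simp only [Multiset.map_cons, Multiset.sum_cons]; omega
      · intro W hW
        rcases Multiset.mem_cons.1 hW with rfl | hW
        · exact closed_app (HL_ne h1) p1 (Q.wrev_path p2)
        · exact hcR W hW
      · intro u
        have := hb' u
        simp only [Multiset.map_cons, Multiset.sum_cons, wbd_append, wbd_wrev] at this ⊢
        rw [← this]
  by_cases hB : ∃ W₂ ∈ R, ∃ p ∈ cyc W₂, Q.dbl.src p.2 = Q.dbl.src y ∧ p.1.2 = false ∧ p.2.2 = true
  · obtain ⟨W₂, hW2, ⟨x₂, y₂⟩, hp, hs, hx2, hy2⟩ := hB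
    change Q.dbl.src y₂ = Q.dbl.src y at hs
    change x₂.2 = false at hx2
    change y₂.2 = true at hy2
    obtain ⟨R', rfl⟩ := Multiset.exists_cons_of_mem hW2
    obtain ⟨U, V, rfl, h2, hcyc⟩ := cyc_mem hp
    have hclV : Q.dbl.IsClosed (V ++ U) := rot_closed (hcR _ (Multiset.mem_cons_self _ _))
    have hTr : Q.wTr K (U ++ V) = Q.wTr K (V ++ U) := Q.wTr_comm K U V
    have hskV : sk (U ++ V) = sk (V ++ U) := by rw [sk, sk, hcyc]
    have hbdV : ∀ u, wbd (U ++ V) u = wbd (V ++ U) u := fun u => by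
      rw [wbd_append, wbd_append, add_comm]
    have hcR' : ∀ W ∈ R', Q.dbl.IsClosed W := fun W hW => hcR W (Multiset.mem_cons_of_mem hW)
    have hb2 : Bal js (W ::ₘ (V ++ U) ::ₘ R') := by
      intro u
      have := hb' u
      simp only [Multiset.map_cons, Multiset.sum_cons] at this ⊢
      rw [← hbdV]; exact this
    simp only [Multiset.map_cons, Multiset.sum_cons, hskV] at hN
    simp only [Multiset.map_cons, Multiset.prod_cons, hTr]
    clear hb' hcR hW2 hskV hbdV hTr hcyc hp
    generalize V ++ U = W₂ at *
    obtain ⟨p2, -⟩ := HL_closed hclV h2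
    rw [hs] at p2
    have s2 := sk_eq h2
    rw [if_neg (nTF1 _ hx2)] at s2
    have s1 := sk_eq (HL_append hHL h2)
    rw [lsk_append hHL h2, if_neg (nTF2 _ hy2), if_neg (nTF1 _ hx2)] at s1
    have h3 := HL_wrev h2
    have s3 := sk_eq (HL_append hHL h3)
    rw [lsk_append hHL h3, lsk_wrev, if_neg (nTF2 _ (by simp [hbar, hx2])),
      if_neg (nTF1 _ (by simp [hbar, hy2]))] at s3
    have e2 : Q.dtp K js * (Q.wTr K W * (Q.wTr K W₂ * (R'.map (Q.wTr K)).prod)) =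
      Q.dtp K js * (((W ++ W₂) ::ₘ R').map (Q.wTr K)).prod +
      Q.dtp K js * (((W ++ wrev W₂) ::ₘ R').map (Q.wTr K)).prod := by
      rw [← mul_assoc (Q.wTr K W), wTr_mul]; simp only [Multiset.map_cons, Multiset.prod_cons]; ring
    rw [e2]
    refine Submodule.add_mem _ ?_ ?_
    · refine ihN _ ?_ _ js _ rfl rfl ?_ ?_
      · simp only [Multiset.map_cons, Multiset.sum_cons]; omega
      · intro W' hW
        rcases Multiset.mem_cons.1 hW with rfl | hW
        · exact closed_app (HL_ne hHL) hWp p2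
        · exact hcR' W' hW
      · intro u
        have := hb2 u
        simp only [Multiset.map_cons, Multiset.sum_cons, wbd_append] at this ⊢
        rw [← this]; ring
    · refine ihN _ ?_ _ js _ rfl rfl ?_ ?_
      · simp only [Multiset.map_cons, Multiset.sum_cons]; omega
      · intro W' hW
        rcases Multiset.mem_cons.1 hW with rfl | hW
        · exact closed_app (HL_ne hHL) hWp (Q.wrev_path p2)
        · exact hcR' W' hW
      · intro u
        have := hb2 u
        simp only [Multiset.map_cons, Multiset.sum_cons, wbd_append, wbd_wrev] at this ⊢
        rw [← this]; ring
  push Not at hA hB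
  have hpos : 0 < wbd W (Q.dbl.src y) := by
    refine wbd_pos hclW _ hHL rfl htf ?_
    rw [HL_cyc hHL]
    intro p hp hs
    rcases Multiset.mem_cons.1 hp with rfl | hp
    · simp [hx]
    · rintro ⟨h1, h2⟩; exact hA p hp hs h1 h2
  have hnn : 0 ≤ (R.map (fun W => wbd (Q := Q) W (Q.dbl.src y))).sum := by
    apply Multiset.sum_nonneg
    intro z hz
    obtain ⟨W₂, hW2, rfl⟩ := Multiset.mem_map.1 hz
    exact wbd_nonneg (hcR _ hW2) _ fun p hp hs h => hB W₂ hW2 p hp hs h.1 h.2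
  have hneg : Q.bds js (Q.dbl.src y) < 0 := by
    have := hb' (Q.dbl.src y)
    rw [Multiset.map_cons, Multiset.sum_cons] at this
    omega
  have hex : ∃ a ∈ js, Q.src a = Q.dbl.src y := by
    by_contra hcon
    push Not at hcon
    have : 0 ≤ Q.bds js (Q.dbl.src y) := by
      apply Multiset.sum_nonneg
      intro z hz
      obtain ⟨a, ha, rfl⟩ := Multiset.mem_map.1 hz
      rw [bd, if_neg (hcon a ha)]
      split_ifs <;> simp
    omega
  obtain ⟨a, ha, hsa⟩ := hex
  obtain ⟨js', rfl⟩ := Multiset.exists_cons_of_mem ha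
  have h4 : HL (a, true) (a, false) ([(a, true), (a, false)] : List (Q.A × Bool)) :=
    ⟨⟨[(a, false)], rfl⟩, ⟨[(a, true)], rfl⟩⟩
  have l4 : lsk ([(a, true), (a, false)] : List (Q.A × Bool)) = 1 := by
    rw [lsk, lp, lp, Multiset.countP_cons, if_pos (show isTF _ from ⟨rfl, rfl⟩)]; simp
  have s4 := sk_eq (HL_append hHL h4)
  rw [lsk_append hHL h4, l4, if_neg (nTF2 _ rfl), if_neg (nTF1 _ rfl)] at s4
  have e3 : Q.dtp K (a ::ₘ js') * (Q.wTr K W * (R.map (Q.wTr K)).prod) =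
      Q.dtp K js' * (((W ++ [(a, true), (a, false)]) ::ₘ R).map (Q.wTr K)).prod := by
    rw [Multiset.map_cons, Multiset.prod_cons, wTr_dt, dtp, Multiset.map_cons, Multiset.prod_cons, dtp]
    ring
  rw [e3]
  rw [Multiset.card_cons] at hk
  refine ihk (Multiset.card js') (by omega) js' _ ?_ rfl ?_ ?_
  · rw [Multiset.map_cons, Multiset.sum_cons]; omega
  · intro W' hW
    rcases Multiset.mem_cons.1 hW with rfl | hW
    · exact closed_app (HL_ne hHL) hWp ⟨hsa, rfl, hsa⟩
    · exact hcR W' hW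
  · intro u
    have := hb' u
    simp only [Multiset.map_cons, Multiset.sum_cons, wbd_append, bds] at this ⊢
    simp only [wbd, List.map_cons, List.map_nil, List.sum_cons, List.sum_nil] at this ⊢
    linarith

end conv
end QuiverData

namespace QuiverData
open MvPolynomial

section gl
variable (Q : QuiverData) (K : Type) [Field K]

/-- weight -/
noncomputable def vw (v : Q.Var) : Q.V → ℤ := fun u => Q.bd v.1 u

lemma actVar_scal (u : Q.V) (s : K) (hs : s ≠ 0) (v : Q.Var) :
    Q.actVar K (fun z => if z = u then s • (1 : Matrix (Fin 2) (Fin 2) K) else 1) v =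
      C ((if Q.tgt v.1 = u then s else 1) * (if Q.src v.1 = u then s⁻¹ else 1)) * X v := by
  have e : ∀ z, (if z = u then s • (1 : Matrix (Fin 2) (Fin 2) K) else 1) =
      (if z = u then s else 1) • 1 := by intro z; split_ifs <;> simp
  have e2 : ∀ z, (if z = u then s • (1 : Matrix (Fin 2) (Fin 2) K) else 1)⁻¹ =
      (if z = u then s⁻¹ else 1) • 1 := by
    intro z; split_ifs
    · apply Matrix.inv_eq_left_inv
      rw [Matrix.smul_mul, Matrix.mul_smul, smul_smul, inv_mul_cancel₀ hs]; simp
    · simp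
  obtain ⟨a, i, j⟩ := v
  unfold actVar
  simp only [e2]
  simp only [e]
  rw [Finset.sum_eq_single i, Finset.sum_eq_single j]
  · simp; rfl
  · intro b _ hb; simp [Matrix.one_apply, hb]; exact zero_mul _
  · simp
  · intro b _ hb; simp [Matrix.one_apply, Ne.symm hb]
    exact (congrArg₂ (· + ·) (zero_mul _) (zero_mul _)).trans (add_zero _)
  · simp

lemma inv_weight [Fintype Q.A] [Infinite K] (f : MvPolynomial Q.Var K) (hf : Q.IsInvariant K f) :
    IsWeightedHomogeneous (Q.vw) f 0 := by
  intro m hm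
  funext u
  have key : ∀ s : K, s ≠ 0 → s ^ (∑ v : Q.Var, (if Q.tgt v.1 = u then m v else 0)) =
      s ^ (∑ v : Q.Var, (if Q.src v.1 = u then m v else 0)) := by
    intro s hs
    have h := hf (fun z => if z = u then s • (1 : Matrix (Fin 2) (Fin 2) K) else 1) (by
      intro z; split_ifs
      · simp [hs]
      · simp)
    have h2 := FFT.coeff_scale (fun v : Q.Var =>
      ((if Q.tgt v.1 = u then s else 1) * (if Q.src v.1 = u then s⁻¹ else 1))) f m
    have h3 : (fun v : Q.Var => C ((if Q.tgt v.1 = u then s else 1) *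
      (if Q.src v.1 = u then s⁻¹ else 1)) * X v) = Q.actVar K
        (fun z => if z = u then s • (1 : Matrix (Fin 2) (Fin 2) K) else 1) := by
      funext v; rw [actVar_scal Q K u s hs]
    rw [h3, h] at h2
    have h4 := mul_right_cancel₀ hm ((one_mul _).trans h2)
    have h5 : ∀ v : Q.Var, ((if Q.tgt v.1 = u then s else 1) *
        (if Q.src v.1 = u then s⁻¹ else 1)) ^ m v =
        s ^ (if Q.tgt v.1 = u then m v else 0) * (s ^ (if Q.src v.1 = u then m v else 0))⁻¹ := by
      intro v; split_ifs <;> simp [mul_pow]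
    rw [Finset.prod_congr rfl fun v _ => h5 v, Finset.prod_mul_distrib, Finset.prod_inv_distrib,
      Finset.prod_pow_eq_pow_sum, Finset.prod_pow_eq_pow_sum] at h4
    rw [eq_mul_inv_iff_mul_eq₀ (pow_ne_zero _ hs), one_mul] at h4
    exact h4.symm
  have h := FFT.pow_inj_field key
  rw [Finsupp.weight_apply, Finsupp.sum_fintype _ _ (by simp)]
  rw [Finset.sum_apply]
  have h6 : ∀ v : Q.Var, (m v • Q.vw v) u = (((if Q.tgt v.1 = u then m v else 0 : ℕ) : ℤ)) -
     ((if Q.src v.1 = u then m v else 0 : ℕ) : ℤ) := by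
    intro v
    rw [Pi.smul_apply, vw, bd]
    split_ifs <;> simp
  rw [Finset.sum_congr rfl fun v _ => h6 v, Finset.sum_sub_distrib, ← Nat.cast_sum, ← Nat.cast_sum, h]
  simp

lemma lmat_wt (x : Q.A × Bool) (i j : Fin 2) :
    IsWeightedHomogeneous Q.vw (Q.lmat K x i j) (Q.bd x.1) := by
  obtain ⟨a, b⟩ := x
  have hX : ∀ i j, IsWeightedHomogeneous Q.vw (Q.genMat K a i j) (Q.bd a) := fun i j =>
    isWeightedHomogeneous_X K Q.vw (a, i, j)
  cases b
  · have hN : ∀ i j, IsWeightedHomogeneous Q.vw (-Q.genMat K a i j) (Q.bd a) := fun i j => by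
      rw [← neg_one_smul K]
      exact (weightedHomogeneousSubmodule K Q.vw (Q.bd a)).smul_mem _ (hX i j)
    have := hX 
    fin_cases i <;> fin_cases j <;> simp only [lmat, Matrix.adjugate_fin_two]
    · exact hX 1 1
    · exact hN 0 1
    · exact hN 1 0
    · exact hX 0 0
  · exact hX i j

lemma wMat_wt (W : List (Q.A × Bool)) (i j : Fin 2) :
    IsWeightedHomogeneous Q.vw (Q.wMat K W i j) (wbd W) := by
  induction W generalizing i j with
  | nil =>
    have h0 : wbd ([] : List (Q.A × Bool)) = 0 := by funext u; simp [wbd]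
    rw [h0, wMat_nil, Matrix.one_apply]
    split_ifs
    · exact isWeightedHomogeneous_one K _
    · exact isWeightedHomogeneous_zero K _ _
  | cons x W ih =>
    have h0 : wbd (x :: W) = wbd W + Q.bd x.1 := by
      funext u; simp [wbd]; ring
    rw [h0, wMat_cons, Matrix.mul_apply]
    refine IsWeightedHomogeneous.sum _ _ _ fun k _ => ?_
    exact (ih i k).mul (Q.lmat_wt K x k j)

lemma wTr_wt (W : List (Q.A × Bool)) : IsWeightedHomogeneous Q.vw (Q.wTr K W) (wbd W) := by
  rw [wTr, Matrix.trace_fin_two]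
  exact (Q.wMat_wt K W 0 0).add (Q.wMat_wt K W 1 1)

lemma dt_wt (a : Q.A) : IsWeightedHomogeneous Q.vw (Q.dt K a) (2 • Q.bd a) := by
  have hX : ∀ i j, IsWeightedHomogeneous Q.vw (Q.genMat K a i j) (Q.bd a) := fun i j =>
    isWeightedHomogeneous_X K Q.vw (a, i, j)
  rw [dt, Matrix.det_fin_two, two_smul]
  exact ((weightedHomogeneousSubmodule K Q.vw _).sub_mem ((hX 0 0).mul (hX 1 1))
    ((hX 0 1).mul (hX 1 0)))

lemma gl_gen [Fintype Q.A] [Fintype Q.V] [Infinite K] [CharP K 2] (N : ℕ) (f : MvPolynomial Q.Var K)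
    (hN : f.IsHomogeneous N) (hf : Q.IsInvariant K f) :
    f ∈ Submodule.span K {t | t ∈ Q.pathGens K ∧ t.IsHomogeneous N} := by
  have h1 := Q.sl_gen K N f hN fun g hg => hf g fun v => by rw [hg]; exact isUnit_one
  have hw : ∀ (js : Multiset Q.A) (Ws : Multiset (List (Q.A × Bool))),
      IsWeightedHomogeneous Q.vw (Q.dtp K js * (Ws.map (Q.wTr K)).prod)
        ((js.map fun a => 2 • Q.bd a).sum + (Ws.map fun W => wbd W).sum) := fun js Ws =>
    (prod_hom K Q.vw js (Q.dt K) _ fun a _ => Q.dt_wt K a).mul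
      (prod_hom K Q.vw Ws (Q.wTr K) _ fun W _ => Q.wTr_wt K W)
  have h2 := span_comp Q.vw (Q.slGens K) (by
    rintro t ⟨js, Ws, -, rfl⟩
    exact ⟨_, hw js Ws⟩) f h1 0
  rw [(Q.inv_weight K f hf).weightedHomogeneousComponent_same] at h2
  have h3 : f ∈ Submodule.span K (Q.pathGens K) := by
    refine Submodule.span_le.2 ?_ h2
    rintro t ⟨⟨js, Ws, hc, rfl⟩, ht⟩
    by_cases h0 : Q.dtp K js * (Ws.map (Q.wTr K)).prod = 0
    · rw [h0]; exact Submodule.zero_mem _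
    have hbal := (hw js Ws).inj_right h0 ht
    refine conv_gen K _ _ js Ws rfl rfl hc fun u => ?_
    have := congrFun hbal u
    have e1 : (js.map fun a => 2 • Q.bd a).sum u = 2 * Q.bds js u := by
      have h := map_multiset_sum (Pi.evalAddMonoidHom (fun _ : Q.V => ℤ) u) (js.map fun a => 2 • Q.bd a)
      rw [Multiset.map_map] at h
      refine h.trans ?_
      rw [bds, ← Multiset.sum_map_mul_left]
      congr 1
    have e2 : (Ws.map fun W => wbd W).sum u = (Ws.map fun W => wbd W u).sum := by
      have h := map_multiset_sum (Pi.evalAddMonoidHom (fun _ : Q.V => ℤ) u) (Ws.map fun W => wbd W)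
      rw [Multiset.map_map] at h
      exact h
    rw [Pi.add_apply, e1, e2] at this
    exact this
  have h4 := span_comp (1 : Q.Var → ℕ) (Q.pathGens K) (by
    rintro t ⟨Ls, Cs, -, -, rfl⟩
    exact ⟨_, (prod_hom K _ Ls (Q.pathTr K) _ fun l _ => Q.pathTr_hom K l).mul
      (prod_hom K _ Cs (Q.pathDet K) _ fun l _ => Q.pathDet_hom K l)⟩) f h3 N
  have h5 : weightedHomogeneousComponent (1 : Q.Var → ℕ) N f = f :=
    IsWeightedHomogeneous.weightedHomogeneousComponent_same hN
  rw [h5] at h4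
  exact h4

end gl
end QuiverData

namespace QuiverData
open MvPolynomial

section dec
variable (Q : QuiverData) (K : Type) [Field K]

/-- decomposables -/
noncomputable def dec : Submodule K (MvPolynomial Q.Var K) := Submodule.span K
    {x : MvPolynomial Q.Var K | ∃ p ∈ Q.PlusSet K, ∃ q ∈ Q.PlusSet K, x = p * q}

lemma dec_mul {p q : MvPolynomial Q.Var K} (hp : p ∈ Q.PlusSet K) (hq : q ∈ Q.PlusSet K) :
    p * q ∈ Q.dec K := Submodule.subset_span ⟨p, hp, q, hq, rfl⟩

lemma plus_mul {p q : MvPolynomial Q.Var K} (hp : p ∈ Q.PlusSet K) (hq : Q.IsInvariant K q) :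
    p * q ∈ Q.PlusSet K := by
  refine ⟨fun g hg => ?_, ?_⟩
  · rw [map_mul, hp.1 g hg, hq g hg]
  · rw [map_mul, hp.2, zero_mul]

lemma hom_const {f : MvPolynomial Q.Var K} {k : ℕ} (hf : f.IsHomogeneous k) (hk : k ≠ 0) :
    constantCoeff f = 0 := by
  rw [constantCoeff_eq]
  exact hf.coeff_eq_zero (by simpa using hk.symm)

lemma pathTr_plus {l : List Q.A} (hl : Q.IsClosed l) : Q.pathTr K l ∈ Q.PlusSet K := by
  obtain ⟨v, hne, hp⟩ := hl
  exact ⟨Q.pathTr_inv K hp, Q.hom_const K (Q.pathTr_hom K l) (by simpa using hne)⟩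

lemma pathDet_plus {l : List Q.A} (hl : Q.IsClosed l) : Q.pathDet K l ∈ Q.PlusSet K := by
  obtain ⟨v, hne, hp⟩ := hl
  exact ⟨Q.pathDet_inv K hp, Q.hom_const K (Q.pathDet_hom K l) (by simpa using hne)⟩

lemma pathMat_append (l₁ l₂ : List Q.A) :
    Q.pathMat K (l₁ ++ l₂) = Q.pathMat K l₂ * Q.pathMat K l₁ := mprod_append _ _ _

lemma pathTr_comm (l₁ l₂ : List Q.A) : Q.pathTr K (l₁ ++ l₂) = Q.pathTr K (l₂ ++ l₁) := by
  rw [pathTr, pathTr, pathMat_append, pathMat_append, Matrix.trace_mul_comm]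

lemma tr_three {R : Type} [CommRing R] (a b c : Matrix (Fin 2) (Fin 2) R) :
    (c * (b * a)).trace + (b * (c * a)).trace = (a * b).trace * c.trace + (a * c).trace * b.trace +
      (b * c).trace * a.trace - a.trace * b.trace * c.trace := by
  simp only [Matrix.trace_fin_two, Matrix.mul_apply, Fin.sum_univ_two]
  ring

lemma tr_sq {R : Type} [CommRing R] (c d : Matrix (Fin 2) (Fin 2) R) :
    (d * (c * c)).trace = (d * c).trace * c.trace - c.det * d.trace := by
  simp only [Matrix.trace_fin_two, Matrix.mul_apply, Fin.sum_univ_two, Matrix.det_fin_two]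
  ring

variable [CharP K 2]

lemma swap_loops {v : Q.V} {a b c : List Q.A} (ha : Q.IsPathFrom v v a) (hb : Q.IsPathFrom v v b)
    (hc : Q.IsPathFrom v v c) : Q.pathTr K (a ++ b ++ c) - Q.pathTr K (a ++ c ++ b) ∈ Q.dec K := by
  by_cases ha0 : a = []
  · subst ha0; simp only [List.nil_append]; rw [pathTr_comm, sub_self]; exact zero_mem _
  by_cases hb0 : b = []
  · subst hb0; simp
  by_cases hc0 : c = []
  · subst hc0; simp
  have pa := Q.pathTr_plus K ⟨v, ha0, ha⟩
  have pb := Q.pathTr_plus K ⟨v, hb0, hb⟩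
  have pc := Q.pathTr_plus K ⟨v, hc0, hc⟩
  have pba := Q.pathTr_plus K (l := b ++ a) ⟨v, by simp [hb0], isPath_append.2 ⟨v, hb, ha⟩⟩
  have pca := Q.pathTr_plus K (l := c ++ a) ⟨v, by simp [hc0], isPath_append.2 ⟨v, hc, ha⟩⟩
  have pcb := Q.pathTr_plus K (l := c ++ b) ⟨v, by simp [hc0], isPath_append.2 ⟨v, hc, hb⟩⟩
  have key := tr_three (Q.pathMat K a) (Q.pathMat K b) (Q.pathMat K c)
  have e : Q.pathTr K (a ++ b ++ c) - Q.pathTr K (a ++ c ++ b) =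
      Q.pathTr K (b ++ a) * Q.pathTr K c + Q.pathTr K (c ++ a) * Q.pathTr K b +
      Q.pathTr K (c ++ b) * Q.pathTr K a - Q.pathTr K a * Q.pathTr K b * Q.pathTr K c := by
    rw [CharTwo.sub_eq_add]
    rw [List.append_assoc, List.append_assoc]
    simp only [pathTr, pathMat_append]
    rw [Matrix.mul_assoc, Matrix.mul_assoc, key]
  rw [e]
  exact sub_mem (add_mem (add_mem (Q.dec_mul K pba pc) (Q.dec_mul K pca pb)) (Q.dec_mul K pcb pa))
    (Q.dec_mul K (Q.plus_mul K pa pb.1) pc)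

lemma swap_mid {v : Q.V} {P B b c : List Q.A} (ha : Q.IsPathFrom v v (B ++ P))
    (hb : Q.IsPathFrom v v b) (hc : Q.IsPathFrom v v c) :
    Q.pathTr K (P ++ b ++ c ++ B) - Q.pathTr K (P ++ c ++ b ++ B) ∈ Q.dec K := by
  have := Q.swap_loops K ha hb hc
  rw [pathTr_comm, Q.pathTr_comm K (P ++ c ++ b)]
  simpa using this

lemma sq_dec {v : Q.V} {c d : List Q.A} (hc : Q.IsClosedAt v c) (hd : Q.IsPathFrom v v d) :
    Q.pathTr K (c ++ c ++ d) ∈ Q.dec K := by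
  have key := tr_sq (Q.pathMat K c) (Q.pathMat K d)
  have pc := Q.pathTr_plus K ⟨v, hc⟩
  have e : Q.pathTr K (c ++ c ++ d) = Q.pathTr K (c ++ d) * Q.pathTr K c -
    Q.pathDet K c * Q.pathTr K d := by
    simp only [pathTr, pathMat_append, pathDet]
    rw [← key]
  by_cases hd0 : d = []
  · subst hd0
    rw [e]
    have : Q.pathTr K [] = 0 := by
      rw [pathTr, pathMat_eq, mprod_nil, Matrix.trace_fin_two]
      simp [CharTwo.add_self_eq_zero]
    rw [this, mul_zero, sub_zero, List.append_nil]
    exact Q.dec_mul K pc pc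
  · rw [e]
    refine sub_mem (Q.dec_mul K ?_ pc) (Q.dec_mul K (Q.pathDet_plus K ⟨v, hc⟩) ?_)
    · exact Q.pathTr_plus K ⟨v, by simp [hc.1], isPath_append.2 ⟨v, hc.2, hd⟩⟩
    · exact Q.pathTr_plus K ⟨v, hd0, hd⟩

end dec

section reroute
variable {Q : QuiverData} (K : Type) [Field K] [CharP K 2]

lemma dup_count {α β : Type} (s : α → β) (A : List α) : ∀ (Y : Finset β),
    Y.card < A.countP (fun a => decide (s a ∈ Y)) →
    ∃ A₁ a A₂ b A₃, A = A₁ ++ a :: (A₂ ++ b :: A₃) ∧ s a = s b ∧ s a ∈ Y := by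
  induction A with
  | nil => intro Y h; simp at h
  | cons a A ih =>
    intro Y h
    by_cases ha : s a ∈ Y
    · by_cases hb : ∃ b ∈ A, s b = s a
      · obtain ⟨b, hb, hs⟩ := hb
        obtain ⟨U, V, rfl⟩ := List.append_of_mem hb
        exact ⟨[], a, U, b, V, rfl, hs.symm, ha⟩
      · push Not at hb
        obtain ⟨A₁, a', A₂, b, A₃, rfl, h1, h2⟩ := ih (Y.erase (s a)) (by
          rw [List.countP_cons_of_pos (by simpa using ha)] at h
          have e : A.countP (fun x => decide (s x ∈ Y.erase (s a))) =
              A.countP (fun x => decide (s x ∈ Y)) := by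
            apply List.countP_congr
            intro x hx
            simp [hb x hx]
          rw [e, Finset.card_erase_of_mem ha]
          have := Finset.card_pos.2 ⟨_, ha⟩
          omega)
        exact ⟨a :: A₁, a', A₂, b, A₃, rfl, h1, Finset.mem_of_mem_erase h2⟩
    · rw [List.countP_cons_of_neg (by simpa using ha)] at h
      obtain ⟨A₁, a', A₂, b, A₃, rfl, h1, h2⟩ := ih Y h
      exact ⟨a :: A₁, a', A₂, b, A₃, rfl, h1, h2⟩

lemma split_at {u v x : Q.V} {T : List Q.A} (h : Q.IsPathFrom u v T) (hx : ∃ a ∈ T, Q.tgt a = x) :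
    ∃ T₁ T₂, T = T₁ ++ T₂ ∧ T₁ ≠ [] ∧ Q.IsPathFrom u x T₁ ∧ Q.IsPathFrom x v T₂ := by
  obtain ⟨a, ha, rfl⟩ := hx
  obtain ⟨U, V, rfl⟩ := List.append_of_mem ha
  obtain ⟨z, h1, h2, h3⟩ := isPath_append.1 h
  exact ⟨U ++ [a], V, by simp, by simp, isPath_append.2 ⟨z, h1, h2, rfl⟩, h3⟩

lemma reroute_step [Fintype Q.V] {u v : Q.V} (P : List Q.A) (f : Q.A) (l : List Q.A)
    (p : Multiset Q.A)
    (hP : Q.IsPathFrom u v P) (hf : Q.src f = v) (hPp : (P : Multiset Q.A) ≤ p)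
    (hcut : ∀ Y : Finset Q.V, u ∈ Y → v ∉ Y → Fintype.card Q.V ≤
      ((l : Multiset Q.A) - p).countP (fun z => Q.src z ∈ Y ∧ Q.tgt z ∉ Y)) (N : ℕ) :
    ∀ A B, A.length = N → Q.IsPathFrom v v A → Q.IsPathFrom v u (f :: B) →
      (P ++ A ++ f :: B).Perm l → Q.pathTr K l - Q.pathTr K (P ++ A ++ f :: B) ∈ Q.dec K →
      ∃ B', Q.IsPathFrom v u (f :: B') ∧ (P ++ f :: B').Perm l ∧
        Q.pathTr K l - Q.pathTr K (P ++ f :: B') ∈ Q.dec K := by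
  induction N using Nat.strong_induction_on with
  | _ N ih =>
  intro A B hN hA hB hperm hE
  by_cases hv : ∃ a ∈ f :: B, Q.tgt a = v
  · obtain ⟨T₁, T₂, hT, hne, h1, h2⟩ := split_at hB hv
    obtain ⟨f', T₁, rfl⟩ := List.exists_cons_of_ne_nil hne
    have hff : f = f' := by simp at hT; exact hT.1
    subst hff
    refine ⟨T₁ ++ A ++ T₂, ?_, ?_, ?_⟩
    · have : f :: (T₁ ++ A ++ T₂) = (f :: T₁) ++ (A ++ T₂) := by simp
      rw [this]
      exact isPath_append.2 ⟨v, h1, isPath_append.2 ⟨v, hA, h2⟩⟩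
    · refine List.Perm.trans ?_ hperm
      rw [hT]
      rw [← Multiset.coe_eq_coe]
      have : P ++ f :: (T₁ ++ A ++ T₂) = P ++ (f :: T₁) ++ A ++ T₂ := by simp
      rw [this]
      simp only [← Multiset.coe_add]
      abel
    · have h3 := Q.swap_mid K (P := P) (B := T₂) (isPath_append.2 ⟨u, h2, hP⟩) hA h1
      rw [hT, ← List.append_assoc] at hE
      have h4 := add_mem hE h3
      rw [sub_add_sub_cancel] at h4
      simpa using h4
  · set Y : Finset Q.V := ((f :: B).map Q.tgt).toFinset with hY
    have memY : ∀ z, z ∈ Y ↔ ∃ a ∈ f :: B, Q.tgt a = z := by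
      intro z; rw [hY, List.mem_toFinset, List.mem_map]
    have hvY : v ∉ Y := by rw [memY]; exact hv
    have huY : u ∈ Y := by rw [memY]; exact Q.tgt_mem_of_path hB (by simp)
    have hc := hcut Y huY hvY
    have hcard : Y.card < Fintype.card Q.V := by
      rw [← Finset.card_univ]
      exact Finset.card_lt_card (Finset.ssubset_univ_iff.2 (fun h => hvY (h ▸ Finset.mem_univ _)))
    have hle : (l : Multiset Q.A) - p ≤ ((A ++ f :: B : List Q.A) : Multiset Q.A) := by
      rw [Multiset.sub_le_iff_le_add, ← Multiset.coe_eq_coe.2 hperm, List.append_assoc,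
        ← Multiset.coe_add, add_comm]
      exact add_le_add_right hPp _
    have hc2 := hc.trans (Multiset.countP_le_of_le _ hle)
    rw [← Multiset.coe_add, Multiset.countP_add] at hc2
    have hz : ((f :: B : List Q.A) : Multiset Q.A).countP (fun z => Q.src z ∈ Y ∧ Q.tgt z ∉ Y) = 0 := by
      rw [Multiset.countP_eq_zero]
      rintro z hz ⟨-, h⟩
      exact h ((memY _).2 ⟨z, hz, rfl⟩)
    rw [hz, add_zero] at hc2
    have hc3 : Y.card < A.countP (fun a => decide (Q.src a ∈ Y)) := by
      refine hcard.trans_le (hc2.trans ?_)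
      rw [Multiset.coe_countP]
      apply List.countP_mono_left
      intro z _ h
      simp at h ⊢
      exact h.1
    obtain ⟨A₁, a, A₂, b, A₃, hAA, hab, haY⟩ := dup_count Q.src A Y hc3
    obtain ⟨T₁, T₂, hT, hne, h1, h2⟩ := split_at hB ((memY _).1 haY)
    obtain ⟨f', T₁, rfl⟩ := List.exists_cons_of_ne_nil hne
    have hff : f = f' := by simp at hT; exact hT.1
    subst hff
    have hAA' : A = A₁ ++ (a :: A₂) ++ (b :: A₃) := by rw [hAA]; simp
    rw [hAA', List.append_assoc] at hA
    obtain ⟨x, hA1, hA'⟩ := isPath_append.1 hA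
    obtain ⟨x', hA2, hA3⟩ := isPath_append.1 hA'
    have hx : Q.src a = x := hA2.1
    have hx' : Q.src b = x' := hA3.1
    rw [← hx] at hA1 hA2
    rw [← hx', ← hab] at hA2 hA3
    refine ih (A₁ ++ (b :: A₃)).length ?_ (A₁ ++ (b :: A₃)) (T₁ ++ (a :: A₂) ++ T₂) rfl ?_ ?_ ?_ ?_
    · rw [← hN, hAA']; simp
    · exact isPath_append.2 ⟨_, hA1, hA3⟩
    · have : f :: (T₁ ++ (a :: A₂) ++ T₂) = (f :: T₁) ++ ((a :: A₂) ++ T₂) := by simp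
      rw [this]
      exact isPath_append.2 ⟨_, h1, isPath_append.2 ⟨_, hA2, h2⟩⟩
    · refine List.Perm.trans ?_ hperm
      rw [hT, hAA', ← Multiset.coe_eq_coe]
      have : P ++ (A₁ ++ b :: A₃) ++ f :: (T₁ ++ a :: A₂ ++ T₂) =
        P ++ (A₁ ++ b :: A₃) ++ ((f :: T₁) ++ (a :: A₂ ++ T₂)) := by simp
      rw [this]
      simp only [← Multiset.coe_add]
      abel
    · have h3 := Q.swap_mid K (P := P ++ A₁) (B := T₂) (v := Q.src a)
        (isPath_append.2 ⟨u, h2, isPath_append.2 ⟨v, hP, hA1⟩⟩) hA2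
        (isPath_append.2 ⟨v, hA3, h1⟩)
      rw [hT, hAA'] at hE
      have : P ++ (A₁ ++ a :: A₂ ++ b :: A₃) ++ (f :: T₁ ++ T₂) =
          P ++ A₁ ++ a :: A₂ ++ (b :: A₃ ++ f :: T₁) ++ T₂ := by simp
      rw [this] at hE
      have h4 := add_mem hE h3
      rw [sub_add_sub_cancel] at h4
      simpa using h4

lemma reroute [Fintype Q.V] {u : Q.V} (l p : List Q.A) (hl : Q.IsPathFrom u u l)
    (hpl : (p : Multiset Q.A) ≤ l)
    (hcut : ∀ Y : Finset Q.V, u ∈ Y → (∃ f ∈ p, Q.src f ∉ Y) → Fintype.card Q.V ≤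
      ((l : Multiset Q.A) - (p : Multiset Q.A)).countP (fun z => Q.src z ∈ Y ∧ Q.tgt z ∉ Y)) (P : List Q.A) :
    ∀ v, P <+: p → Q.IsPathFrom u v P → ∃ B, Q.IsPathFrom v u B ∧ (P ++ B).Perm l ∧
        Q.pathTr K l - Q.pathTr K (P ++ B) ∈ Q.dec K := by
  induction P using List.reverseRecOn with
  | nil =>
    intro v _ hv
    cases hv
    exact ⟨l, hl, by simp, by simp⟩
  | append_singleton P f ih =>
    intro v hpre hPf
    obtain ⟨w, hP, hf, hfv⟩ := isPath_append.1 hPf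
    have hpre' : P <+: p := (List.prefix_append P [f]).trans hpre
    have hle := fun L : List Q.A => fun h : L <+: p => (Multiset.coe_le.2 h.sublist.subperm)
    obtain ⟨B, hB, hperm, hE⟩ := ih w hpre' hP
    have hfB : f ∈ B := by
      have h1 : ((P ++ [f] : List Q.A) : Multiset Q.A) ≤ ((P ++ B : List Q.A) : Multiset Q.A) := by
        rw [Multiset.coe_eq_coe.2 hperm]; exact (hle _ hpre).trans hpl
      rw [← Multiset.coe_add, ← Multiset.coe_add, add_le_add_iff_left] at h1
      simpa using Multiset.mem_of_le h1 (by simp : f ∈ (([f] : List Q.A) : Multiset Q.A))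
    obtain ⟨A, C, rfl⟩ := List.append_of_mem hfB
    obtain ⟨w', hA, hC⟩ := isPath_append.1 hB
    have hw : w' = w := hC.1.symm.trans hf
    subst hw
    obtain ⟨B', h1, h2, h3⟩ := reroute_step K P f l p hP hf (hle _ hpre')
      (fun Y hu hv => hcut Y hu ⟨f, hpre.subset (by simp), by rw [hf]; exact hv⟩) _ A C rfl hA hC
      (by simpa using hperm) (by simpa using hE)
    have hfv' : Q.tgt f = v := hfv
    refine ⟨B', hfv' ▸ h1.2, by simpa using h2, by simpa using h3⟩

/-- a doubled closed path inside a closed path with no sparse cuts -/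
lemma double_dec [Fintype Q.V] {u : Q.V} (l c : List Q.A) (hl : Q.IsPathFrom u u l)
    (hc : Q.IsClosedAt u c) (hcl : (c : Multiset Q.A) + c ≤ l)
    (hcut : ∀ Y : Finset Q.V, u ∈ Y → (∃ f ∈ c, Q.src f ∉ Y) → Fintype.card Q.V ≤
      ((l : Multiset Q.A) - (c + c)).countP (fun z => Q.src z ∈ Y ∧ Q.tgt z ∉ Y)) :
    Q.pathTr K l ∈ Q.dec K := by
  obtain ⟨B, h1, h2, h3⟩ := reroute K l (c ++ c) hl (by rw [← Multiset.coe_add]; exact hcl)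
    (fun Y hu ⟨f, hf, hf2⟩ => by
      rw [← Multiset.coe_add]
      exact hcut Y hu ⟨f, by simpa using hf, hf2⟩) (c ++ c) u List.prefix_rfl
      (isPath_append.2 ⟨u, hc.2, hc.2⟩)
  have h4 := Q.sq_dec K hc h1
  simpa using add_mem h3 h4

end reroute
end QuiverData

namespace QuiverData
open MvPolynomial

section cuts
variable {Q : QuiverData}

/-- crossing a cut -/
def crs (Y : Finset Q.V) (z : List Q.A) : Prop := ∃ a ∈ z, ¬ (Q.src a ∈ Y ↔ Q.tgt a ∈ Y)

lemma stay {Y : Finset Q.V} {l : List Q.A} : ∀ {u v : Q.V}, Q.IsPathFrom u v l →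
    (∀ a ∈ l, Q.src a ∈ Y → Q.tgt a ∈ Y) → u ∈ Y → v ∈ Y := by
  induction l with
  | nil => rintro u v h - hu; cases h; exact hu
  | cons a l ih =>
    rintro u v ⟨rfl, h⟩ hs hu
    exact ih h (fun b hb => hs b (List.mem_cons_of_mem _ hb)) (hs a (by simp) hu)

lemma crs_leave {Y : Finset Q.V} {z : List Q.A} (hz : Q.IsClosed z) (h : crs Y z) :
    ∃ a ∈ z, Q.src a ∈ Y ∧ Q.tgt a ∉ Y := by
  by_contra hcon
  push Not at hcon
  obtain ⟨a, ha, hna⟩ := h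
  obtain ⟨u, -, hp⟩ := hz
  obtain ⟨A, B, rfl⟩ := List.append_of_mem ha
  obtain ⟨w, h1, h2, h3⟩ := isPath_append.1 hp
  apply hna
  refine ⟨hcon a ha, fun ht => ?_⟩
  have h4 := stay h3 (fun b hb => hcon b (by simp [hb])) ht
  rw [h2]
  exact stay h1 (fun b hb => hcon b (by simp [hb])) h4

/-- uncrossed functions -/
def unc {ι : Type} (z : ι → List Q.A) (I : Finset ι) : Submodule ℚ (Q.V → ℚ) where
  carrier := {φ | ∀ i ∈ I, ∀ a ∈ z i, φ (Q.src a) = φ (Q.tgt a)}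
  add_mem' := by
    intro φ ψ h1 h2 i hi a ha
    simp [h1 i hi a ha, h2 i hi a ha]
  zero_mem' := by intro i hi a ha; rfl
  smul_mem' := by
    intro c φ h i hi a ha
    simp [h i hi a ha]

lemma sparse [Fintype Q.V] {ι : Type} (z : ι → List Q.A) (k : ℕ) : ∀ I : Finset ι,
    Fintype.card Q.V ≤ Module.finrank ℚ (unc z I) + k →
    ∃ J ⊆ I, I.card ≤ J.card + 3 * Fintype.card Q.V * k ∧
      ∀ Y : Finset Q.V, (∃ i ∈ J, crs Y (z i)) →
        3 * Fintype.card Q.V ≤ (J.filter fun i => crs Y (z i)).card := by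
  induction k with
  | zero =>
    intro I hI
    refine ⟨I, subset_rfl, by simp, ?_⟩
    rintro Y ⟨i, hi, a, ha, hn⟩
    exfalso
    have htop : unc z I = ⊤ := by
      apply Submodule.eq_top_of_finrank_eq
      apply le_antisymm (Submodule.finrank_le _)
      rw [Module.finrank_fintype_fun_eq_card]
      simpa using hI
    have : (fun v => if v ∈ Y then (1 : ℚ) else 0) ∈ unc z I := by rw [htop]; trivial
    have h2 := this i hi a ha
    apply hn
    dsimp only at h2
    split_ifs at h2 <;> simp_all
  | succ k ih =>
    intro I hI
    by_cases hgood : ∀ Y : Finset Q.V, (∃ i ∈ I, crs Y (z i)) →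
        3 * Fintype.card Q.V ≤ (I.filter fun i => crs Y (z i)).card
    · exact ⟨I, subset_rfl, by omega, hgood⟩
    push Not at hgood
    obtain ⟨Y, ⟨i, hi, a, ha, hn⟩, hlt⟩ := hgood
    have hlt2 : unc z I < unc z (I.filter fun i => ¬ crs Y (z i)) := by
      refine lt_of_le_of_ne (fun φ h i hi => h i (Finset.mem_of_mem_filter _ hi)) fun heq => ?_
      have : (fun v => if v ∈ Y then (1 : ℚ) else 0) ∈ unc z (I.filter fun i => ¬ crs Y (z i)) := by
        intro j hj b hb
        have h1 := (Finset.mem_filter.1 hj).2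
        simp only [crs, not_exists, not_and, not_not] at h1
        have := h1 b hb
        by_cases h : Q.src b ∈ Y
        · simp [h, this.1 h]
        · have h' : Q.tgt b ∉ Y := fun h' => h (this.2 h')
          simp [h, h']
      rw [← heq] at this
      have h2 := this i hi a ha
      apply hn
      dsimp only at h2
      split_ifs at h2 <;> simp_all
    have hfr := Submodule.finrank_lt_finrank_of_lt hlt2
    obtain ⟨J, hJ, hc, hg⟩ := ih (I.filter fun i => ¬ crs Y (z i)) (by omega)
    refine ⟨J, hJ.trans (Finset.filter_subset _ _), ?_, hg⟩
    have := Finset.card_filter_add_card_filter_not (s := I) (fun i => crs Y (z i))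
    rw [mul_add, mul_one]
    omega

lemma parity [Fintype Q.A] {ι : Type} (z : ι → Multiset Q.A) (I : Finset ι)
    (hI : Fintype.card Q.A < I.card) : ∃ J ⊆ I, J.Nonempty ∧ ∀ a, 2 ∣ (∑ i ∈ J, z i).count a := by
  let v : I → (Q.A → ZMod 2) := fun i a => ((z i).count a : ZMod 2)
  have hnl : ¬ LinearIndependent (ZMod 2) v := by
    intro h
    have := h.fintype_card_le_finrank
    rw [Module.finrank_fintype_fun_eq_card, Fintype.card_coe] at this
    omega
  obtain ⟨g, hg, ⟨i₀, hi₀⟩⟩ := Fintype.not_linearIndependent_iff.1 hnl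
  refine ⟨(Finset.univ.filter fun i : I => g i ≠ 0).map (Function.Embedding.subtype _), ?_, ?_, ?_⟩
  · intro i hi
    obtain ⟨j, -, rfl⟩ := Finset.mem_map.1 hi
    exact j.2
  · exact ⟨i₀, Finset.mem_map.2 ⟨i₀, by simp [hi₀], rfl⟩⟩
  · intro a
    rw [← ZMod.natCast_eq_zero_iff, Finset.sum_map, Multiset.count_sum']
    have h := congrFun hg a
    rw [Finset.sum_apply, Pi.zero_apply] at h
    rw [Finset.sum_filter, Nat.cast_sum]
    refine Eq.trans ?_ h
    apply Finset.sum_congr rfl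
    intro i _
    have h2 : ∀ x : ZMod 2, x ≠ 0 → x = 1 := by decide
    by_cases hgi : g i = 0
    · simp [hgi]
    · rw [if_pos hgi, Pi.smul_apply, h2 _ hgi, one_smul]; rfl

end cuts
end QuiverData

namespace QuiverData
open MvPolynomial

section longdec
variable {Q : QuiverData}

lemma long_dec [Fintype Q.V] [Fintype Q.A] (K : Type) [Field K] [CharP K 2] (m : ℕ)
    (hm : ∀ l, Q.IsPrimL l → l.length ≤ m) (l : List Q.A) (hl : Q.IsClosed l)
    (hlen : m * (Fintype.card Q.A + 3 * Fintype.card Q.V * Fintype.card Q.V) < l.length) :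
    Q.pathTr K l ∈ Q.dec K := by
  obtain ⟨Ls, hLs, hsum⟩ := Q.circ_decomp _ (l : Multiset Q.A) rfl (fun u => Q.bds_closed hl u)
  obtain ⟨L, rfl⟩ := Quot.exists_rep Ls
  change (l : Multiset Q.A) = (((L : Multiset (List Q.A)).map fun l : List Q.A => (l : Multiset Q.A))).sum at hsum
  have hLs' : ∀ c ∈ L, Q.IsPrimL c := fun c hc => hLs c (by exact hc)
  let z : Fin L.length → List Q.A := fun i => L[i.1]
  have hz : ∀ i, Q.IsPrimL (z i) := fun i => hLs' _ (List.getElem_mem _)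
  have hsum2 : (l : Multiset Q.A) = ∑ i, (z i : Multiset Q.A) := by
    rw [hsum, Multiset.map_coe, Multiset.sum_coe]
    exact (Fin.sum_univ_fun_getElem L (fun l : List Q.A => (l : Multiset Q.A))).symm
  have hN : l.length ≤ m * L.length := by
    have := congrArg Multiset.card hsum2
    rw [Multiset.card_sum] at this
    simp only [Multiset.coe_card] at this
    rw [this]
    calc ∑ i, (z i).length ≤ ∑ i : Fin L.length, m := Finset.sum_le_sum fun i _ => hm _ (hz i)
      _ = m * L.length := by simp [mul_comm]
  have hN2 : Fintype.card Q.A + 3 * Fintype.card Q.V * Fintype.card Q.V < L.length :=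
    lt_of_mul_lt_mul_left' (lt_of_lt_of_le hlen hN)
  obtain ⟨J₀, -, hJ₀, hcut⟩ := sparse z (Fintype.card Q.V) Finset.univ (by omega)
  rw [Finset.card_univ, Fintype.card_fin] at hJ₀
  obtain ⟨J, hJ, hJne, hpar⟩ := parity (fun i => (z i : Multiset Q.A)) J₀ (by omega)
  obtain ⟨s, hs⟩ := Multiset.exists_smul_of_dvd_count _ (fun a _ => hpar a)
  have hle : ∑ i ∈ J, (z i : Multiset Q.A) ≤ l := by
    rw [hsum2]
    exact Finset.sum_le_sum_of_subset (Finset.subset_univ J)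
  have hsne : s ≠ 0 := by
    rintro rfl
    obtain ⟨i, hi⟩ := hJne
    obtain ⟨⟨u, hne, -⟩, -⟩ := hz i
    obtain ⟨a, ha⟩ := List.exists_mem_of_ne_nil _ hne
    have : a ∈ ∑ i ∈ J, (z i : Multiset Q.A) := Multiset.mem_sum.2 ⟨i, hi, by simpa using ha⟩
    rw [hs] at this
    simp at this
  have hbs : ∀ u, Q.bds s u = 0 := by
    intro u
    have h1 : Q.bds (∑ i ∈ J, (z i : Multiset Q.A)) u = 0 := by
      have : ∀ T : Finset (Fin L.length), Q.bds (∑ i ∈ T, (z i : Multiset Q.A)) u = 0 := by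
        intro T
        induction T using Finset.induction_on with
        | empty => simp [bds]
        | insert i T hi ih =>
          rw [Finset.sum_insert hi, bds_add, ih, Q.bds_closed (hz i).1, add_zero]
      exact this J
    rw [hs, two_nsmul, bds_add] at h1
    omega
  obtain ⟨c, hc, hcs⟩ := Q.circ_prim s hsne hbs
  have hcc : (c : Multiset Q.A) + c ≤ ∑ i ∈ J, (z i : Multiset Q.A) := by
    rw [hs, two_nsmul]; exact add_le_add hcs hcs
  have hclen : c.length ≤ Fintype.card Q.V := by
    have := hc.2.length_le_card
    simpa using this
  obtain ⟨⟨u, hcu⟩, -⟩ := hc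
  -- rotate
  obtain ⟨f, c', rfl⟩ := List.exists_cons_of_ne_nil hcu.1
  have hfu : Q.src f = u := hcu.2.1
  have hfl : f ∈ l := by
    have : f ∈ (l : Multiset Q.A) := Multiset.mem_of_le (hcc.trans hle) (by simp)
    simpa using this
  obtain ⟨A, B, rfl⟩ := List.append_of_mem hfl
  rw [pathTr_comm]
  have hperm : ((A ++ f :: B : List Q.A) : Multiset Q.A) = ((f :: B ++ A : List Q.A) : Multiset Q.A) :=
    Multiset.coe_eq_coe.2 List.perm_append_comm
  rw [hperm] at hle hsum2
  obtain ⟨w, -, hp⟩ := rot_closed hl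
  have hw : w = u := by rw [← hfu]; exact hp.1.symm
  subst hw
  refine double_dec K _ (f :: c') hp hcu (hcc.trans hle) ?_
  rintro Y huY ⟨g, hg, hgY⟩
  have hcrs : ∃ i ∈ J₀, crs Y (z i) := by
    have : crs Y (f :: c') := by
      by_contra hcon
      simp only [crs, not_exists, not_and, not_not] at hcon
      obtain ⟨A', B', h'⟩ := List.append_of_mem hg
      have hpc := hcu.2
      rw [h'] at hpc hcon
      obtain ⟨w, h1, h2, h3⟩ := isPath_append.1 hpc
      apply hgY
      rw [h2]
      exact stay h1 (fun b hb => (hcon b (by simp [hb])).1) huY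
    obtain ⟨a, ha, hna⟩ := this
    have : a ∈ ∑ i ∈ J, (z i : Multiset Q.A) :=
      Multiset.mem_of_le hcc (Multiset.mem_add.2 (Or.inl (by simpa using ha)))
    obtain ⟨i, hi, hai⟩ := Multiset.mem_sum.1 this
    exact ⟨i, hJ hi, a, by simpa using hai, hna⟩
  have h3 := hcut Y hcrs
  rw [Multiset.countP_sub (hcc.trans hle)]
  have h4 : Multiset.countP (fun z => Q.src z ∈ Y ∧ Q.tgt z ∉ Y) (((f :: c' : List Q.A) : Multiset Q.A) + (f :: c' : List Q.A)) ≤ 2 * Fintype.card Q.V := by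
    refine (Multiset.countP_le_card _ _).trans ?_
    rw [Multiset.card_add, Multiset.coe_card]
    omega
  have h5 : 3 * Fintype.card Q.V ≤ Multiset.countP (fun z => Q.src z ∈ Y ∧ Q.tgt z ∉ Y) ((f :: B ++ A : List Q.A) : Multiset Q.A) := by
    refine h3.trans ?_
    rw [hsum2, ← Multiset.coe_countPAddMonoidHom, map_sum, Finset.card_eq_sum_ones]
    refine le_trans (Finset.sum_le_sum ?_) (Finset.sum_le_sum_of_subset (Finset.subset_univ _))
    intro i hi
    obtain ⟨a, ha, h⟩ := crs_leave (hz i).1 (Finset.mem_filter.1 hi).2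
    rw [Multiset.coe_countPAddMonoidHom]
    exact Multiset.countP_pos.2 ⟨a, by simpa using ha, h⟩
  omega

/-- list-primitive iff primitive -/
lemma vdeg_eq (l : List Q.A) (w : Q.V) : Q.vdeg l w = (l.map Q.tgt).count w := by
  rw [vdeg, Nat.card_eq_fintype_card, Fintype.card_subtype, List.count_eq_countP, List.countP_map]
  have := Fin.sum_univ_fun_getElem l (fun a => if Q.tgt a = w then 1 else 0)
  rw [Finset.card_filter]
  simp only [List.get_eq_getElem]
  rw [this]
  clear this
  induction l with
  | nil => simp
  | cons a l ih => 
    rw [List.map_cons, List.sum_cons, ih, List.countP_cons]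
    simp [add_comm]

lemma isPrimL_iff (l : List Q.A) : Q.IsPrimL l ↔ Q.IsPrimitive l := by
  constructor
  · rintro ⟨⟨v, hv⟩, hn⟩
    refine ⟨v, hv, fun a ha => ?_⟩
    rw [vdeg_eq]
    exact List.count_eq_one_of_mem hn (List.mem_map_of_mem ha)
  · rintro ⟨v, hv, h⟩
    refine ⟨⟨v, hv⟩, List.nodup_iff_count_le_one.2 fun w => ?_⟩
    by_cases hw : w ∈ l.map Q.tgt
    · obtain ⟨a, ha, rfl⟩ := List.mem_map.1 hw
      rw [← vdeg_eq, h a ha]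
    · rw [List.count_eq_zero_of_not_mem hw]; omega

end longdec
end QuiverData

namespace QuiverData
open MvPolynomial

section upper
variable {Q : QuiverData} (K : Type) [Field K]

lemma plus_prod (M : Multiset (MvPolynomial Q.Var K)) (hM : ∀ p ∈ M, p ∈ Q.PlusSet K)
    (hc : 1 ≤ Multiset.card M) : M.prod ∈ Q.PlusSet K := by
  induction M using Multiset.induction_on with
  | empty => simp at hc
  | cons a M ih =>
    by_cases h0 : M = 0
    · subst h0; simpa using hM a (by simp)
    · rw [Multiset.prod_cons]
      have := ih (fun p hp => hM p (Multiset.mem_cons_of_mem hp)) (Multiset.card_pos.2 h0)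
      exact plus_mul Q K (hM a (by simp)) this.1

lemma gens_dec [Fintype Q.V] [Fintype Q.A] [CharP K 2] (m k : ℕ)
    (hm : ∀ l, Q.IsPrimL l → l.length ≤ m)
    (hk : m * (Fintype.card Q.A + 3 * Fintype.card Q.V * Fintype.card Q.V) + 2 * m < k)
    (G : MvPolynomial Q.Var K) (hG : G ∈ Q.pathGens K) (hh : G.IsHomogeneous k) : G ∈ Q.dec K := by
  by_cases hG0 : G = 0
  · rw [hG0]; exact Submodule.zero_mem _
  obtain ⟨Ls, Cs, hL, hC, rfl⟩ := hG
  rw [← Multiset.prod_add] at hh hG0 ⊢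
  have hP : ∀ p ∈ Ls.map (Q.pathTr K) + Cs.map (Q.pathDet K), p ∈ Q.PlusSet K := by
    intro p hp
    rcases Multiset.mem_add.1 hp with hp | hp
    · obtain ⟨l, hl, rfl⟩ := Multiset.mem_map.1 hp
      exact Q.pathTr_plus K (hL l hl)
    · obtain ⟨l, hl, rfl⟩ := Multiset.mem_map.1 hp
      exact Q.pathDet_plus K (hC l hl).1
  have hmem : ∀ p, Ls.map (Q.pathTr K) + Cs.map (Q.pathDet K) = {p} →
      (∃ l, Q.IsClosed l ∧ p = Q.pathTr K l) ∨ (∃ l, Q.IsPrimL l ∧ p = Q.pathDet K l) := by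
    intro p hp
    have : p ∈ Ls.map (Q.pathTr K) + Cs.map (Q.pathDet K) := by rw [hp]; simp
    rcases Multiset.mem_add.1 this with hp | hp
    · obtain ⟨l, hl, rfl⟩ := Multiset.mem_map.1 hp
      exact Or.inl ⟨l, hL l hl, rfl⟩
    · obtain ⟨l, hl, rfl⟩ := Multiset.mem_map.1 hp
      exact Or.inr ⟨l, hC l hl, rfl⟩
  generalize Ls.map (Q.pathTr K) + Cs.map (Q.pathDet K) = M at *
  rcases M.empty_or_exists_mem with h0 | ⟨p, hp⟩
  · subst h0
    have := hh.inj_right (n := 0) (by simpa using isHomogeneous_one Q.Var K) hG0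
    omega
  obtain ⟨M, rfl⟩ := Multiset.exists_cons_of_mem hp
  by_cases h1 : M = 0
  · subst h1
    simp only [Multiset.cons_zero, Multiset.prod_singleton] at *
    rcases hmem p rfl with ⟨l, hl, rfl⟩ | ⟨l, hl, rfl⟩
    · have := hh.inj_right (Q.pathTr_hom K l) hG0
      exact long_dec K m hm l hl (by omega)
    · have := hh.inj_right (Q.pathDet_hom K l) hG0
      have := hm l hl
      omega
  · rw [Multiset.prod_cons]
    exact dec_mul Q K (hP p (by simp))
      (plus_prod K M (fun q hq => hP q (Multiset.mem_cons_of_mem hq)) (Multiset.card_pos.2 h1))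

lemma upper [Fintype Q.V] [Fintype Q.A] [Infinite K] [CharP K 2] (m k : ℕ)
    (hm : ∀ l, Q.IsPrimL l → l.length ≤ m)
    (f : MvPolynomial Q.Var K) (hf : Q.IsInvariant K f) (hh : f.IsHomogeneous k)
    (hd : ¬ Q.Decomposable K f) :
    k ≤ m * (Fintype.card Q.A + 3 * Fintype.card Q.V * Fintype.card Q.V) + 2 * m := by
  by_contra hk
  push Not at hk
  apply hd
  change f ∈ Q.dec K
  refine Submodule.span_le.2 ?_ (gl_gen Q K k f hh hf)
  rintro G ⟨h1, h2⟩
  exact gens_dec K m k hm hk G h1 h2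

end upper
end QuiverData

namespace QuiverData
open MvPolynomial

section lower
variable {Q : QuiverData} (K : Type) [Field K] (S : Set Q.A)

/-- substitution of scalar matrices -/
noncomputable def sy (v : Q.Var) : MvPolynomial Q.A K :=
  if v.2.1 = v.2.2 then (if v.1 ∈ S then 1 else X v.1) else 0

/-- specialization to scalar matrices -/
noncomputable def spz : MvPolynomial Q.Var K →ₐ[K] MvPolynomial Q.A K := aeval (sy K S)

/-- variable with its type -/
def mkVar (a : Q.A) (i j : Fin 2) : Q.Var := (a, i, j)

lemma mkVar_inj {a a' : Q.A} {i j i' j' : Fin 2} :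
    (mkVar a i j : Q.Var) = mkVar a' i' j' ↔ a = a' ∧ i = i' ∧ j = j' := by
  constructor
  · intro h
    exact ⟨congrArg Prod.fst h, congrArg (fun v : Q.Var => v.2.1) h,
      congrArg (fun v : Q.Var => v.2.2) h⟩
  · rintro ⟨rfl, rfl, rfl⟩; rfl

lemma exists_mkVar (v : Q.Var) : ∃ a i j, v = mkVar a i j := ⟨v.1, v.2.1, v.2.2, rfl⟩

lemma sy_mkVar (a : Q.A) (i j : Fin 2) :
    sy K S (mkVar a i j) = if i = j then (if a ∈ S then 1 else X a) else 0 := rfl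

lemma chain (b : Q.A) (hb : b ∉ S) (q : MvPolynomial Q.Var K) :
    pderiv b (spz K S q) = spz K S (pderiv (mkVar b 0 0) q) + spz K S (pderiv (mkVar b 1 1) q) := by
  induction q using MvPolynomial.induction_on with
  | C r => simp [spz]
  | add p q hp hq => simp only [map_add, hp, hq]; ring
  | mul_X p v hp =>
    have hX : spz K S (X v) = sy K S v := aeval_X _ _
    have hv : pderiv b (sy K S v) = spz K S (pderiv (mkVar b 0 0) (X v)) +
        spz K S (pderiv (mkVar b 1 1) (X v)) := by
      obtain ⟨a, i, j, rfl⟩ := exists_mkVar v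
      rw [pderiv_X, pderiv_X, sy_mkVar]
      by_cases hab : a = b
      · subst hab
        fin_cases i <;> fin_cases j <;> simp [hb, Pi.single_apply, mkVar_inj]
      · simp only [Pi.single_apply, mkVar_inj, hab, Ne.symm hab, false_and, if_false, map_zero, add_zero]
        split_ifs <;> simp [pderiv_X_of_ne hab]
    simp only [map_mul, pderiv_mul, map_add, hX, hp, hv]
    ring

/-- swapping indices -/
def swp : Q.Var → Q.Var := fun v => mkVar v.1 (Equiv.swap 0 1 v.2.1) (Equiv.swap 0 1 v.2.2)

lemma swp_inj : Function.Injective (swp (Q := Q)) := by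
  rintro ⟨a, i, j⟩ ⟨a', i', j'⟩ h
  have h1 : a = a' := congrArg Prod.fst h
  have h2 := congrArg (fun v : Q.Var => v.2.1) h
  have h3 := congrArg (fun v : Q.Var => v.2.2) h
  have h2' : i = i' := (Equiv.swap 0 1).injective h2
  have h3' : j = j' := (Equiv.swap 0 1).injective h3
  subst h1 h2' h3'; rfl

lemma inv_swp (q : MvPolynomial Q.Var K) (hq : Q.IsInvariant K q) : rename swp q = q := by
  have h := hq (fun _ => !![0, 1; 1, 0]) (by intro v; simp [Matrix.det_fin_two])
  have h2 : Q.actVar K (fun _ => !![0, 1; 1, 0]) = fun v => X (swp v) := by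
    funext v
    have hinv : (!![0, 1; 1, 0] : Matrix (Fin 2) (Fin 2) K)⁻¹ = !![0, 1; 1, 0] := by
      apply Matrix.inv_eq_left_inv
      ext i j; fin_cases i <;> fin_cases j <;> simp
    obtain ⟨a, i, j, rfl⟩ := exists_mkVar v
    have h3 : Q.actVar K (fun _ => !![0, 1; 1, 0]) (mkVar a i j) = ∑ k : Fin 2, ∑ l : Fin 2,
        C (!![0, 1; 1, 0] i k * !![0, 1; 1, 0]⁻¹ l j) * X (mkVar a k l) := rfl
    have h4 : swp (mkVar a i j) = mkVar a (Equiv.swap 0 1 i) (Equiv.swap 0 1 j) := rfl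
    rw [h3, h4, hinv]
    fin_cases i <;> fin_cases j <;> simp [Fin.sum_univ_two]
  rw [h2] at h
  rw [rename_eq_aeval] 
  exact h

lemma swap_der (b : Q.A) (q : MvPolynomial Q.Var K) (hq : Q.IsInvariant K q) :
    spz K S (pderiv (mkVar b 1 1) q) = spz K S (pderiv (mkVar b 0 0) q) := by
  have h : pderiv (mkVar b 1 1) q = rename swp (pderiv (mkVar b 0 0) q) := by
    conv_lhs => rw [← inv_swp K q hq]
    have : (mkVar b 1 1 : Q.Var) = swp (mkVar b 0 0) := by
      change _ = mkVar b (Equiv.swap 0 1 0) (Equiv.swap 0 1 0)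
      simp
    rw [this, pderiv_rename swp_inj]
  rw [h, spz, aeval_rename]
  congr 2
  funext v
  obtain ⟨a, i, j, rfl⟩ := exists_mkVar v
  change sy K S (mkVar a (Equiv.swap 0 1 i) (Equiv.swap 0 1 j)) = _
  rw [sy_mkVar, sy_mkVar]
  simp

lemma der_zero [CharP K 2] (b : Q.A) (hb : b ∉ S) (q : MvPolynomial Q.Var K)
    (hq : Q.IsInvariant K q) : pderiv b (spz K S q) = 0 := by
  rw [chain K S b hb, swap_der K S b q hq]
  exact CharTwo.add_self_eq_zero _

lemma const_spz [Fintype Q.A] [Fintype Q.V] [Infinite K] (h : Q.V → ℤ)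
    (hS : ∀ a ∈ S, h (Q.tgt a) = h (Q.src a) + 1) (q : MvPolynomial Q.Var K)
    (hq : Q.IsInvariant K q) : constantCoeff (spz K S q) = constantCoeff q := by
  have h1 : ∀ q : MvPolynomial Q.Var K, constantCoeff (spz K S q) =
      eval (fun v => constantCoeff (sy K S v)) q := by
    intro q
    induction q using MvPolynomial.induction_on with
    | C r => simp [spz]
    | add p q hp hq => simp only [map_add, hp, hq]
    | mul_X p v hp =>
      have hX : spz K S (X v) = sy K S v := aeval_X _ _
      simp only [map_mul, hp, hX, eval_X]
  rw [h1, eval_eq]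
  have hz : ∀ d ∈ q.support, d ≠ 0 →
      q.coeff d * ∏ i ∈ d.support, (constantCoeff (sy K S i)) ^ d i = 0 := by
    intro d hd hd0
    by_cases hall : ∀ v ∈ d.support, v.1 ∈ S
    · exfalso
      have hw := Q.inv_weight K q hq (mem_support_iff.1 hd)
      rw [Finsupp.weight_apply, Finsupp.sum] at hw
      have hw2 : ∑ u, h u * (∑ v ∈ d.support, d v • Q.vw v) u = 0 := by
        rw [hw]; simp
      have hw3 : ∑ u, h u * (∑ v ∈ d.support, d v • Q.vw v) u = ∑ v ∈ d.support, (d v : ℤ) := by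
        simp only [Finset.sum_apply, Finset.mul_sum]
        rw [Finset.sum_comm]
        apply Finset.sum_congr rfl
        intro v hv
        have := hS _ (hall v hv)
        simp only [Pi.smul_apply, vw, bd, nsmul_eq_mul]
        have : ∑ u, h u * ((if Q.tgt v.1 = u then (1:ℤ) else 0) - (if Q.src v.1 = u then 1 else 0)) = 1 := by
          simp only [mul_sub, mul_ite, mul_one, mul_zero, Finset.sum_sub_distrib, Finset.sum_ite_eq, Finset.mem_univ, if_true]
          omega
        calc _ = (d v : ℤ) * ∑ u, h u * ((if Q.tgt v.1 = u then (1:ℤ) else 0) - (if Q.src v.1 = u then 1 else 0)) := by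
              rw [Finset.mul_sum]
              apply Finset.sum_congr rfl
              intro u _
              ring
          _ = _ := by rw [this, mul_one]
      rw [hw3] at hw2
      obtain ⟨v, hv⟩ := Finsupp.support_nonempty_iff.2 hd0
      have := (Finset.sum_eq_zero_iff_of_nonneg (fun v _ => by positivity)).1 hw2 v hv
      simp at this hv
      exact hv this
    · push Not at hall
      obtain ⟨v, hv, hvS⟩ := hall
      rw [Finset.prod_eq_zero hv, mul_zero]
      have : constantCoeff (sy K S v) = 0 := by
        unfold sy; rw [if_neg hvS]; split_ifs <;> simp
      rw [this, zero_pow (Finsupp.mem_support_iff.1 hv)]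
  rw [Finset.sum_eq_single 0 hz (by intro h0; rw [notMem_support_iff.1 h0, zero_mul])]
  simp only [Finsupp.support_zero, Finset.prod_empty, mul_one]; rfl

end lower
end QuiverData

namespace QuiverData
open MvPolynomial

section lower2
variable {Q : QuiverData} (K : Type) [Field K] (S : Set Q.A)

/-- exponent of a path outside `S` -/
noncomputable def mu (l : List Q.A) : Q.A →₀ ℕ :=
  (l.map fun a => if a ∈ S then 0 else Finsupp.single a 1).sum

lemma mu_apply (l : List Q.A) (a : Q.A) : mu S l a = if a ∈ S then 0 else l.count a := by
  induction l with
  | nil => simp [mu]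
  | cons b l ih =>
    have : mu S (b :: l) = (if b ∈ S then 0 else Finsupp.single b 1) + mu S l := by simp [mu]
    rw [this, Finsupp.add_apply, ih, List.count_cons]
    by_cases hb : b ∈ S <;> by_cases ha : a ∈ S <;> by_cases hab : b = a
    all_goals first | (subst hab; simp_all [add_comm]) | simp_all [Finsupp.single_apply]

lemma spz_genMat (a : Q.A) : (Q.genMat K a).map (spz K S) =
    (if a ∈ S then 1 else X a : MvPolynomial Q.A K) • 1 := by
  ext1 i j
  have : spz K S (Q.genMat K a i j) = sy K S (mkVar a i j) := aeval_X _ _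
  rw [Matrix.map_apply, this, sy_mkVar, Matrix.smul_apply, Matrix.one_apply]
  split_ifs <;> simp

lemma spz_pathMat (l : List Q.A) : (Q.pathMat K l).map (spz K S) =
    (monomial (mu S l) (1 : K)) • (1 : Matrix (Fin 2) (Fin 2) (MvPolynomial Q.A K)) := by
  have h := mprod_map_hom (spz K S : MvPolynomial Q.Var K →+* MvPolynomial Q.A K) (Q.genMat K) l
  rw [pathMat_eq]
  refine h.trans ?_
  clear h
  induction l with
  | nil => simp [mu]
  | cons b l ih =>
    have : mu S (b :: l) = (if b ∈ S then 0 else Finsupp.single b 1) + mu S l := by simp [mu]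
    rw [mprod_cons, ih, this]
    have h2 : (Q.genMat K b).map (spz K S : MvPolynomial Q.Var K →+* MvPolynomial Q.A K) =
      (if b ∈ S then 1 else X b : MvPolynomial Q.A K) • 1 := spz_genMat K S b
    rw [h2, smul_mul_smul_comm, one_mul]
    congr 1
    have h3 : (if b ∈ S then 1 else X b : MvPolynomial Q.A K) =
      monomial (if b ∈ S then 0 else Finsupp.single b 1) 1 := by
      split_ifs <;> rfl
    rw [h3, monomial_mul, mul_one, add_comm]

lemma genMat_mkVar (a : Q.A) (i j : Fin 2) : Q.genMat K a i j = X (mkVar a i j) := rfl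

lemma pderiv_path (b : Q.A) (l : List Q.A) (hb : b ∉ l) (v w i j : Fin 2) :
    pderiv (mkVar b v w) (Q.pathMat K l i j) = 0 := by
  induction l generalizing j with
  | nil =>
    rw [pathMat_eq, mprod_nil, Matrix.one_apply]
    split_ifs <;> simp
  | cons a l ih =>
    have hab : a ≠ b := fun h => hb (by simp [h])
    have ih := ih (fun h => hb (List.mem_cons_of_mem _ h))
    rw [pathMat_eq, mprod_cons, ← pathMat_eq, Matrix.mul_apply]
    simp only [Fin.sum_univ_two, map_add, pderiv_mul, ih, genMat_mkVar, pderiv_X, Pi.single_apply,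
      mkVar_inj, hab, false_and, if_false, zero_mul, mul_zero, add_zero]

lemma lam_tr (b : Q.A) (l : List Q.A) (hb : b ∉ l) :
    spz K S (pderiv (mkVar b 0 0) (Q.pathTr K (b :: l))) = monomial (mu S l) 1 := by
  have h1 : pderiv (mkVar b 0 0) (Q.pathTr K (b :: l)) = Q.pathMat K l 0 0 := by
    rw [pathTr, pathMat_eq, mprod_cons, ← pathMat_eq, Matrix.trace_fin_two, Matrix.mul_apply,
      Matrix.mul_apply]
    simp only [Fin.sum_univ_two, map_add, pderiv_mul, pderiv_path K b l hb, genMat_mkVar, pderiv_X,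
      Pi.single_apply, mkVar_inj]
    simp
  rw [h1]
  have := congrFun (congrFun (spz_pathMat K S l) 0) 0
  rw [Matrix.map_apply] at this
  rw [this]
  simp

lemma sqfree_coeff [Fintype Q.A] [Fintype Q.V] [Infinite K] [CharP K 2] (h : Q.V → ℤ)
    (hS : ∀ a ∈ S, h (Q.tgt a) = h (Q.src a) + 1) (q : MvPolynomial Q.Var K)
    (hq : q ∈ Q.PlusSet K) (ν : Q.A →₀ ℕ) (h1 : ∀ a, ν a ≤ 1) (h2 : ∀ a ∈ S, ν a = 0) :
    coeff ν (spz K S q) = 0 := by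
  by_cases h0 : ν = 0
  · subst h0
    have := const_spz K S h hS q hq.1
    rw [hq.2, constantCoeff_eq] at this
    exact this
  · obtain ⟨b, hb⟩ := Finsupp.support_nonempty_iff.2 h0
    have hb1 : ν b = 1 := by have := h1 b; have := Finsupp.mem_support_iff.1 hb; omega
    have hbS : b ∉ S := fun hbS => by rw [h2 b hbS] at hb1; omega
    have hd := der_zero K S b hbS q hq.1
    have hc := coeff_pderiv (i := b) (spz K S q) (ν - Finsupp.single b 1)
    rw [hd, coeff_zero, tsub_add_cancel_of_le (by
      rw [Finsupp.single_le_iff]; omega)] at hc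
    simpa [hb1] using hc.symm

lemma sqfree_mul [Fintype Q.A] [Fintype Q.V] [Infinite K] [CharP K 2] (h : Q.V → ℤ)
    (hS : ∀ a ∈ S, h (Q.tgt a) = h (Q.src a) + 1) (q : MvPolynomial Q.Var K)
    (hq : q ∈ Q.PlusSet K) (ν : Q.A →₀ ℕ) (h1 : ∀ a, ν a ≤ 1) (h2 : ∀ a ∈ S, ν a = 0)
    (F : MvPolynomial Q.A K) : coeff ν (F * spz K S q) = 0 := by
  rw [coeff_mul]
  apply Finset.sum_eq_zero
  rintro ⟨x, y⟩ hxy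
  have hxy := Finset.HasAntidiagonal.mem_antidiagonal.1 hxy
  dsimp only at hxy ⊢
  rw [sqfree_coeff K S h hS q hq y, mul_zero]
  · intro a; have := h1 a; rw [← hxy, Finsupp.add_apply] at this; omega
  · intro a ha; have := h2 a ha; rw [← hxy, Finsupp.add_apply] at this; omega

theorem indec [Fintype Q.A] [Fintype Q.V] [Infinite K] [CharP K 2] (h : Q.V → ℤ)
    (hS : ∀ a ∈ S, h (Q.tgt a) = h (Q.src a) + 1) (b : Q.A) (hbS : b ∉ S) (l : List Q.A)
    (hl : ∀ a ∉ S, (b :: l).count a ≤ 1) : ¬ Q.Decomposable K (Q.pathTr K (b :: l)) := by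
  intro hdec
  have hb : b ∉ l := by
    intro hb
    have h1 := hl b hbS
    rw [List.count_cons_self] at h1
    have := List.count_pos_iff.2 hb
    omega
  have h1 : ∀ a, mu S l a ≤ 1 := by
    intro a
    rw [mu_apply]
    split_ifs with ha
    · omega
    · exact (List.count_le_count_cons).trans (hl a ha)
  have h2 : ∀ a ∈ S, mu S l a = 0 := by
    intro a ha
    rw [mu_apply, if_pos ha]
  have key : ∀ f, f ∈ Submodule.span K
    {x : MvPolynomial Q.Var K | ∃ p ∈ Q.PlusSet K, ∃ q ∈ Q.PlusSet K, x = p * q} →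
    coeff (mu S l) (spz K S (pderiv (mkVar b 0 0) f)) = 0 := by
    intro f hf
    induction hf using Submodule.span_induction with
    | mem x hx =>
      obtain ⟨p, hp, q, hq, rfl⟩ := hx
      rw [pderiv_mul, map_add, map_mul, map_mul, coeff_add, sqfree_mul K S h hS q hq _ h1 h2,
        mul_comm (spz K S p), sqfree_mul K S h hS p hp _ h1 h2, add_zero]
    | zero => simp
    | add x y _ _ hx hy => simp only [map_add, coeff_add, hx, hy, add_zero]
    | smul r x _ hx => simp only [map_smul, Derivation.map_smul, coeff_smul, hx, smul_zero]
  have := key _ hdec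
  rw [lam_tr K S b l hb] at this
  simp at this

end lower2
end QuiverData

namespace QuiverData
open MvPolynomial

section example_quiver

/-- source function -/
def sN (n m e : ℕ) : ℕ :=
  if e < m - 1 then e else if e < n - 1 then 0 else if e < 2 * n - 1 - m then e - (n - 1) + m else m - 1

/-- target function -/
def tN (n e : ℕ) : ℕ := if e < n - 1 then e + 1 else 0


lemma exists_st {n d m : ℕ} (hm : 2 ≤ m) (hmn : m ≤ n) : ∃ s t : Fin d → Fin n,
    ∀ e, (s e).val = sN n m e ∧ (t e).val = tN n e :=
  ⟨fun e => ⟨sN n m e, by unfold sN; split_ifs <;> omega⟩,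
    fun e => ⟨tN n e, by unfold tN; split_ifs <;> omega⟩, fun e => ⟨rfl, rfl⟩⟩

lemma exA {n d m : ℕ} (hm : 2 ≤ m) (hmn : m ≤ n) (hd : 2 * n - m ≤ d)
    {s t : Fin d → Fin n} (hst : ∀ e, (s e).val = sN n m e ∧ (t e).val = tN n e) (k : ℕ) (hk : k ≤ m - 1) : ∃ A : List (Fin d),
    (QuiverData.mk (Fin n) (Fin d) s t).IsPathFrom ⟨0, by omega⟩ ⟨k, by omega⟩ A ∧ A.length = k ∧
    (∀ a ∈ A, a.val < m - 1) ∧ A.map (fun a => (t a).val) = List.range' 1 k := by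
  induction k with
  | zero => exact ⟨[], rfl, rfl, by simp, by simp⟩
  | succ k ih =>
    obtain ⟨A, h1, h2, h3, h4⟩ := ih (by omega)
    have hs := (hst ⟨k, by omega⟩).1
    have ht := (hst ⟨k, by omega⟩).2
    have hs' : (s ⟨k, by omega⟩).val = k := by rw [hs]; unfold sN; dsimp only; split_ifs <;> omega
    have ht' : (t ⟨k, by omega⟩).val = k + 1 := by rw [ht]; unfold tN; dsimp only; split_ifs <;> omega
    refine ⟨A ++ [⟨k, by omega⟩], isPath_append.2 ⟨_, h1, ?_⟩, by simp [h2], ?_, ?_⟩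
    · exact ⟨Fin.ext hs', Fin.ext ht'⟩
    · intro a ha
      rcases List.mem_append.1 ha with ha | ha
      · exact h3 a ha
      · rw [List.mem_singleton.1 ha]; dsimp only; omega
    · rw [List.map_append, h4, List.range'_concat]
      simp [ht', add_comm]

lemma exB {n d m : ℕ} (hm : 2 ≤ m) (hmn : m ≤ n) (hd : 2 * n - m ≤ d)
    {s t : Fin d → Fin n} (hst : ∀ e, (s e).val = sN n m e ∧ (t e).val = tN n e) (e : Fin d) (he : 2 * n - 1 - m ≤ e.val) :
    s e = ⟨m - 1, by omega⟩ ∧ t e = ⟨0, by omega⟩ := by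
  constructor
  · apply Fin.ext; rw [(hst e).1]; unfold sN; split_ifs <;> first | omega | rfl
  · apply Fin.ext; rw [(hst e).2]; unfold tN; split_ifs <;> first | omega | rfl

lemma ex_sc {n d m : ℕ} (hm : 2 ≤ m) (hmn : m ≤ n) (hd : 2 * n - m ≤ d)
    {s t : Fin d → Fin n} (hst : ∀ e, (s e).val = sN n m e ∧ (t e).val = tN n e) : (QuiverData.mk (Fin n) (Fin d) s t).StronglyConnected := by
  left
  have key : ∀ k (_ : m ≤ k) (_ : k ≤ n), ∃ l,
      (QuiverData.mk (Fin n) (Fin d) s t).IsClosedAt ⟨0, by omega⟩ l ∧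
        ∀ w : Fin n, w.val < k → ∃ a ∈ l, t a = w := by
    intro k hk
    induction k, hk using Nat.le_induction with
    | base =>
      intro _
      obtain ⟨A, h1, h2, h3, h4⟩ := exA hm hmn hd hst (m - 1) le_rfl
      obtain ⟨b, hb⟩ : ∃ b : Fin d, 2 * n - 1 - m ≤ b.val := ⟨⟨2 * n - 1 - m, by omega⟩, le_rfl⟩
      obtain ⟨hB1, hB2⟩ := exB hm hmn hd hst b hb
      have hpb : (QuiverData.mk (Fin n) (Fin d) s t).IsPathFrom ⟨m - 1, by omega⟩ ⟨0, by omega⟩ [b] :=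
        And.intro hB1 hB2
      refine ⟨A ++ [b], ⟨by simp, isPath_append.2 ⟨_, h1, hpb⟩⟩, ?_⟩
      intro w hw
      by_cases hw0 : w.val = 0
      · refine ⟨b, by simp, ?_⟩
        rw [hB2]; exact Fin.ext hw0.symm
      · have : w.val ∈ A.map (fun a => (t a).val) := by
          rw [h4, List.mem_range'_1]; omega
        obtain ⟨a, ha, haw⟩ := List.mem_map.1 this
        exact ⟨a, by simp [ha], Fin.ext haw⟩
    | succ k hk ih =>
      intro hkn
      obtain ⟨l, h1, h2⟩ := ih (by omega)
      have a1 : s ⟨k - 1, by omega⟩ = ⟨0, by omega⟩ := by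
        apply Fin.ext; rw [(hst _).1]; unfold sN; dsimp only; split_ifs <;> omega
      have a2 : t ⟨k - 1, by omega⟩ = ⟨k, by omega⟩ := by
        apply Fin.ext; rw [(hst _).2]; unfold tN; dsimp only; split_ifs <;> omega
      have a3 : s ⟨k - m + (n - 1), by omega⟩ = ⟨k, by omega⟩ := by
        apply Fin.ext; rw [(hst _).1]; unfold sN; dsimp only; split_ifs <;> omega
      have a4 : t ⟨k - m + (n - 1), by omega⟩ = ⟨0, by omega⟩ := by
        apply Fin.ext; rw [(hst _).2]; unfold tN; dsimp only; split_ifs <;> omega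
      have hpb : (QuiverData.mk (Fin n) (Fin d) s t).IsPathFrom ⟨0, by omega⟩ ⟨0, by omega⟩
          [⟨k - 1, by omega⟩, ⟨k - m + (n - 1), by omega⟩] :=
        And.intro a1 (And.intro (a3.trans a2.symm) a4)
      refine ⟨l ++ [⟨k - 1, by omega⟩, ⟨k - m + (n - 1), by omega⟩],
        ⟨by simp, isPath_append.2 ⟨_, h1.2, hpb⟩⟩, ?_⟩
      · intro w hw
        by_cases hwk : w.val = k
        · exact ⟨⟨k - 1, by omega⟩, by simp, a2.trans (Fin.ext hwk.symm)⟩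
        · obtain ⟨a, ha, haw⟩ := h2 w (by omega)
          exact ⟨a, by simp [ha], haw⟩
  obtain ⟨l, h1, h2⟩ := key n hmn le_rfl
  exact ⟨_, l, h1, fun w => h2 w w.2⟩

lemma ex_prim {n d m : ℕ} (hm : 2 ≤ m) (hmn : m ≤ n) (hd : 2 * n - m ≤ d)
    {s t : Fin d → Fin n} (hst : ∀ e, (s e).val = sN n m e ∧ (t e).val = tN n e) : (QuiverData.mk (Fin n) (Fin d) s t).MaxPrimDeg m := by
  constructor
  · obtain ⟨A, h1, h2, h3, h4⟩ := exA hm hmn hd hst (m - 1) le_rfl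
    obtain ⟨b, hb⟩ : ∃ b : Fin d, 2 * n - 1 - m ≤ b.val := ⟨⟨2 * n - 1 - m, by omega⟩, le_rfl⟩
    obtain ⟨hB1, hB2⟩ := exB hm hmn hd hst b hb
    have hpb : (QuiverData.mk (Fin n) (Fin d) s t).IsPathFrom ⟨m - 1, by omega⟩ ⟨0, by omega⟩ [b] :=
      And.intro hB1 hB2
    refine ⟨A ++ [b], (isPrimL_iff _).1 ⟨⟨⟨0, by omega⟩, by simp,
      isPath_append.2 ⟨_, h1, hpb⟩⟩, ?_⟩, by simp [h2]; omega⟩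
    have : ((A ++ [b]).map (fun a => (t a).val)).Nodup := by
      rw [List.map_append, h4]
      simp only [List.map_cons, List.map_nil, hB2]
      rw [List.nodup_append]
      refine ⟨List.nodup_range', by simp, ?_⟩
      intro a ha b hb
      rw [List.mem_range'_1] at ha
      rw [List.mem_singleton] at hb
      omega
    have h5 : ((A ++ [b]).map (fun a => (t a).val)) =
      ((A ++ [b]).map t).map Fin.val := by rw [List.map_map]; rfl
    rw [h5] at this
    exact this.of_map _
  · intro l hl
    obtain ⟨hcl, hnd⟩ := (isPrimL_iff _).2 hl
    by_cases hbig : ∃ a ∈ l, m ≤ (t a).val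
    · obtain ⟨a, ha, hta⟩ := hbig
      obtain ⟨A, B, rfl⟩ := List.append_of_mem ha
      obtain ⟨w, -, hp⟩ := rot_closed hcl
      have hnd2 : ((a :: B ++ A).map t).Nodup :=
        (List.Perm.map t List.perm_append_comm).nodup_iff.1 hnd
      have hsa : (s a).val = 0 := by
        rw [(hst a).2] at hta; rw [(hst a).1]
        unfold tN at hta; unfold sN
        split_ifs at hta ⊢ <;> omega
      have hlen : (A ++ a :: B).length = (B ++ A).length + 1 := by simp; omega
      rw [hlen]
      rw [List.cons_append] at hp hnd2
      obtain ⟨hw, hp⟩ := hp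
      change s a = w at hw
      change (QuiverData.mk (Fin n) (Fin d) s t).IsPathFrom (t a) w (B ++ A) at hp
      generalize B ++ A = R at *
      cases R with
      | nil => simp; omega
      | cons e r =>
        obtain ⟨h1, h2⟩ := hp
        change s e = t a at h1
        have hte : (t e).val = 0 := by
          have h3 : m ≤ (s e).val := by rw [h1]; exact hta
          rw [(hst e).1] at h3; rw [(hst e).2]
          unfold tN; unfold sN at h3
          split_ifs at h3 ⊢ <;> omega
        by_cases hr : r = []
        · subst hr; simp; omega
        · exfalso
          have h3 := tgt_mem_of_path (Q := QuiverData.mk (Fin n) (Fin d) s t) h2 hr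
          have h4 : w = t e := by
            rw [← hw]; apply Fin.ext; rw [hsa, hte]
          rw [h4] at h3
          have h5 : (t e :: r.map t).Nodup := (List.nodup_cons.1 hnd2).2
          exact (List.nodup_cons.1 h5).1 (List.mem_map.2 h3)
    · push Not at hbig
      have h1 : ((l.map t).map Fin.val).Nodup := List.Nodup.map Fin.val_injective hnd
      have h2 : (l.map t).map Fin.val ⊆ List.range m := by
        intro x hx
        simp only [List.map_map, List.mem_map, Function.comp_apply] at hx
        obtain ⟨a, ha, rfl⟩ := hx
        exact List.mem_range.2 (hbig a ha)
      have := (h1.subperm h2).length_le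
      simpa using this

lemma ex_indec {n d m : ℕ} (hm : 2 ≤ m) (hmn : m ≤ n) (hd : 2 * n - m ≤ d)
    {s t : Fin d → Fin n} (hst : ∀ e, (s e).val = sN n m e ∧ (t e).val = tN n e) (K : Type) [Field K] [Infinite K] [CharP K 2] :
    ∃ f, (QuiverData.mk (Fin n) (Fin d) s t).IsInvariant K f ∧
      f.IsHomogeneous (m * (d - (2 * n - 1 - m))) ∧
      ¬ (QuiverData.mk (Fin n) (Fin d) s t).Decomposable K f := by
  let Q := QuiverData.mk (Fin n) (Fin d) s t
  have : Fintype Q.V := inferInstanceAs (Fintype (Fin n))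
  have : Fintype Q.A := inferInstanceAs (Fintype (Fin d))
  obtain ⟨A, h1, h2, h3, h4⟩ := exA hm hmn hd hst (m - 1) le_rfl
  have key : ∀ Bs : List (Fin d), (∀ e ∈ Bs, 2 * n - 1 - m ≤ e.val) → Bs.Nodup →
      Q.IsPathFrom ⟨m - 1, by omega⟩ ⟨m - 1, by omega⟩ (Bs.flatMap fun e => e :: A) ∧
      (Bs.flatMap fun e => e :: A).length = m * Bs.length ∧
      ∀ a : Fin d, ¬ a.val < m - 1 → (Bs.flatMap fun e => e :: A).count a = Bs.count a := by
    intro Bs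
    induction Bs with
    | nil => intro _ _; exact ⟨rfl, by simp, by simp⟩
    | cons e Bs ih =>
      intro hB hn
      obtain ⟨i1, i2, i3⟩ := ih (fun e he => hB e (by simp [he])) (List.nodup_cons.1 hn).2
      obtain ⟨b1, b2⟩ := exB hm hmn hd hst e (hB e (by simp))
      rw [List.flatMap_cons]
      refine ⟨isPath_append.2 ⟨⟨m - 1, by omega⟩, ⟨b1, ?_⟩, i1⟩, ?_, ?_⟩
      · change Q.IsPathFrom (t e) _ A
        rw [b2]; exact h1
      · rw [List.length_append, i2, List.length_cons, List.length_cons, h2, mul_add]; omega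
      · intro a ha
        rw [List.count_append, i3 a ha, List.count_cons, List.count_cons,
          List.count_eq_zero_of_not_mem (fun h => ha (h3 a h))]
        omega
  let Bs : List (Fin d) := List.ofFn (fun j : Fin (d - (2 * n - 1 - m)) =>
    (⟨j.val + (2 * n - 1 - m), by omega⟩ : Fin d))
  have hBs : Bs.Nodup := by
    rw [List.nodup_ofFn]
    intro i j hij
    have := congrArg Fin.val hij
    dsimp only at this
    exact Fin.ext (by omega)
  have hBs2 : ∀ e ∈ Bs, 2 * n - 1 - m ≤ e.val := by
    intro e he
    obtain ⟨j, rfl⟩ := (List.mem_ofFn' _ _).1 he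
    dsimp only; omega
  have hBl : Bs.length = d - (2 * n - 1 - m) := List.length_ofFn
  obtain ⟨k1, k2, k3⟩ := key Bs hBs2 hBs
  refine ⟨Q.pathTr K (Bs.flatMap fun e => e :: A), Q.pathTr_inv K k1, ?_, ?_⟩
  · have := Q.pathTr_hom K (Bs.flatMap fun e => e :: A)
    rw [k2, hBl] at this
    exact this
  · have k3' : ∀ a : Fin d, ¬ a.val < m - 1 → (Bs.flatMap fun e => e :: A).count a ≤ 1 := by
      intro a ha
      rw [k3 a ha]; exact List.nodup_iff_count_le_one.1 hBs a
    clear k3 k2 k1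
    generalize Bs = Bs' at *
    cases Bs' with
    | nil => simp at hBl; omega
    | cons b Bs' =>
      have hb := hBs2 b (by simp)
      rw [List.flatMap_cons, List.cons_append] at k3' ⊢
      refine indec (Q := Q) K {e : Fin d | e.val < m - 1} (fun v : Fin n => (v.val : ℤ)) ?_ b ?_ _ ?_
      · intro a ha
        change a.val < m - 1 at ha
        change ((t a).val : ℤ) = (s a).val + 1
        rw [(hst a).1, (hst a).2]
        unfold sN tN
        split_ifs <;> push_cast <;> omega
      · intro h
        change b.val < m - 1 at h
        omega
      · intro a ha
        convert k3' a ha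

end example_quiver
end QuiverData

namespace QuiverData
open MvPolynomial

lemma dset_le (K : Type) [Field K] [Infinite K] [CharP K 2] {n d m : ℕ} (s t : Fin d → Fin n)
    (hp : (QuiverData.mk (Fin n) (Fin d) s t).MaxPrimDeg m) :
    m * (d + 3 * n * n) + 2 * m ∈ upperBounds {k | ∃ f : MvPolynomial (QuiverData.mk (Fin n) (Fin d) s t).Var K,
    (QuiverData.mk (Fin n) (Fin d) s t).IsInvariant K f ∧ f.IsHomogeneous k ∧
      ¬ (QuiverData.mk (Fin n) (Fin d) s t).Decomposable K f} := by
  rintro k ⟨f, h1, h2, h3⟩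
  let i1 : Fintype (QuiverData.mk (Fin n) (Fin d) s t).V := inferInstanceAs (Fintype (Fin n))
  let i2 : Fintype (QuiverData.mk (Fin n) (Fin d) s t).A := inferInstanceAs (Fintype (Fin d))
  have h := upper K m k (fun l hl => hp.2 l ((isPrimL_iff l).1 hl)) f h1 h2 h3
  have e1 : Fintype.card (QuiverData.mk (Fin n) (Fin d) s t).V = n := Fintype.card_fin n
  have e2 : Fintype.card (QuiverData.mk (Fin n) (Fin d) s t).A = d := Fintype.card_fin d
  rw [e1, e2] at h
  exact h

lemma maxset_le (K : Type) [Field K] [Infinite K] [CharP K 2] (n d m : ℕ) :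
    m * (d + 3 * n * n) + 2 * m ∈ upperBounds {N | ∃ s t : Fin d → Fin n,
    (QuiverData.mk (Fin n) (Fin d) s t).StronglyConnected ∧
    (QuiverData.mk (Fin n) (Fin d) s t).MaxPrimDeg m ∧
    N = (QuiverData.mk (Fin n) (Fin d) s t).Dnum K} := by
  rintro N ⟨s, t, -, hp, rfl⟩
  exact csSup_le' (dset_le K s t hp)

lemma maxD_le (K : Type) [Field K] [Infinite K] [CharP K 2] (n d m : ℕ) :
    QuiverData.maxD K n d m ≤ m * (d + 3 * n * n) + 2 * m := csSup_le' (maxset_le K n d m)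

lemma le_maxD (K : Type) [Field K] [Infinite K] [CharP K 2] (n d m : ℕ) (hm : 2 ≤ m) (hmn : m ≤ n)
    (hd : 2 * n - m ≤ d) : m * (d - (2 * n - 1 - m)) ≤ QuiverData.maxD K n d m := by
  obtain ⟨s, t, hst⟩ := exists_st (d := d) hm hmn
  have hp := ex_prim hm hmn hd hst
  refine le_trans ?_ (le_csSup ⟨_, maxset_le K n d m⟩ ⟨s, t, ex_sc hm hmn hd hst, hp, rfl⟩)
  exact le_csSup ⟨_, dset_le K s t hp⟩ (ex_indec hm hmn hd hst K)

end QuiverData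

theorem maxD_div_md_tendsto_one
    (K : Type) [Field K] [Infinite K] (hchar : ringChar K = 2)
    (n m : ℕ) (hm : 2 ≤ m) (hmn : m ≤ n) :
    Filter.Tendsto
      (fun d : ℕ => (QuiverData.maxD K n d m : ℝ) / ((m : ℝ) * (d : ℝ)))
      Filter.atTop (nhds 1) := by
  have : CharP K 2 := by rw [← hchar]; exact ringChar.charP K
  have hlim : ∀ c : ℝ, Filter.Tendsto (fun d : ℕ => 1 + c / (d : ℝ)) Filter.atTop (nhds 1) := by
    intro c
    have := (tendsto_const_div_atTop_nhds_zero_nat c).const_add 1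
    simpa using this
  refine tendsto_of_tendsto_of_tendsto_of_le_of_le' (hlim (-(2 * n : ℝ))) (hlim (3 * n * n + 2)) ?_ ?_
  · filter_upwards [Filter.eventually_ge_atTop (2 * n)] with d hd
    have h := QuiverData.le_maxD K n d m hm hmn (by omega)
    have h2 : m * d ≤ QuiverData.maxD K n d m + m * (2 * n) := by
      calc m * d ≤ m * (d - (2 * n - 1 - m) + 2 * n) := Nat.mul_le_mul_left _ (by omega)
        _ = m * (d - (2 * n - 1 - m)) + m * (2 * n) := by ring
        _ ≤ _ := by omega
    have h3 : (m : ℝ) * d ≤ QuiverData.maxD K n d m + m * (2 * n) := by exact_mod_cast h2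
    have hd0 : (0 : ℝ) < d := by exact_mod_cast (by omega : 0 < d)
    have hm0 : (0 : ℝ) < m := by exact_mod_cast (by omega : 0 < m)
    rw [le_div_iff₀ (by positivity)]
    have : (1 + -(2 * (n : ℝ)) / d) * (m * d) = m * d - m * (2 * n) := by field_simp; ring
    linarith
  · filter_upwards [Filter.eventually_ge_atTop (2 * n)] with d hd
    have h := QuiverData.maxD_le K n d m
    have h3 : (QuiverData.maxD K n d m : ℝ) ≤ m * (d + 3 * n * n) + 2 * m := by exact_mod_cast h
    have hd0 : (0 : ℝ) < d := by exact_mod_cast (by omega : 0 < d)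
    have hm0 : (0 : ℝ) < m := by exact_mod_cast (by omega : 0 < m)
    rw [div_le_iff₀ (by positivity)]
    have : (1 + (3 * (n : ℝ) * n + 2) / d) * (m * d) = m * (d + 3 * n * n) + 2 * m := by
      field_simp; ring
    linarith
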